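/- Let n ≥ 2, p ≥ 2, let Ω ⊆ ℝⁿ be open, and let u : Ω → ℝ^p be an energy minimizing map into the unit sphere S^{p−1} with weak gradient g. Then for every y ∈ Ω: y ∈ reg(u) if and only if ρ^{2−n} ∫_{B_ρ(y)} |Du|² → 0 as ρ ↓ 0 (i.e., the density Θ_u(y) = 0). -/

import Mathlib

open MeasureTheory Metric Filter Set

noncomputable section

/-- The pointwise energy density `|Du|²(x) = ∑_{i,j} ((g(x)eᵢ)_j)²` associated to a
(weak) gradient `g`. -/
def energyDensity (n p : ℕ)
    (g : EuclideanSpace ℝ (Fin n) →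
      (EuclideanSpace ℝ (Fin n) →L[ℝ] EuclideanSpace ℝ (Fin p)))
    (x : EuclideanSpace ℝ (Fin n)) : ℝ :=
  ∑ i : Fin n, ∑ j : Fin p, (g x (EuclideanSpace.single i 1) j) ^ 2

/-- `u` has weak gradient `g` on `Ω`: both are locally integrable on `Ω` and the
integration-by-parts identity holds against every smooth compactly supported test
function with support in `Ω`. -/
def HasWeakGradient (n p : ℕ) (Ω : Set (EuclideanSpace ℝ (Fin n)))
    (u : EuclideanSpace ℝ (Fin n) → EuclideanSpace ℝ (Fin p))
    (g : EuclideanSpace ℝ (Fin n) →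
      (EuclideanSpace ℝ (Fin n) →L[ℝ] EuclideanSpace ℝ (Fin p))) : Prop :=
  LocallyIntegrableOn u Ω volume ∧ LocallyIntegrableOn g Ω volume ∧
  ∀ φ : EuclideanSpace ℝ (Fin n) → ℝ, ContDiff ℝ (⊤ : ℕ∞) φ → HasCompactSupport φ →
    tsupport φ ⊆ Ω → ∀ i : Fin n, ∀ j : Fin p,
      ∫ x in Ω, u x j * fderiv ℝ φ x (EuclideanSpace.single i 1) =
        - ∫ x in Ω, φ x * g x (EuclideanSpace.single i 1) j

/-- `u : Ω → ℝᵖ` is an energy minimizing map into the unit sphere `S^(p-1)` with weak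
gradient `g`: `u` has weak gradient `g` with locally integrable energy density,
`‖u‖ = 1` a.e. on `Ω`, and `u` minimizes energy in every ball `B_ρ(y)` with closure in
`Ω` among sphere-valued competitors `w` agreeing with `u` a.e. outside a smaller
concentric ball. -/
def IsEnergyMinimizingToSphere (n p : ℕ) (Ω : Set (EuclideanSpace ℝ (Fin n)))
    (u : EuclideanSpace ℝ (Fin n) → EuclideanSpace ℝ (Fin p))
    (g : EuclideanSpace ℝ (Fin n) →
      (EuclideanSpace ℝ (Fin n) →L[ℝ] EuclideanSpace ℝ (Fin p))) : Prop :=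
  HasWeakGradient n p Ω u g ∧
  LocallyIntegrableOn (energyDensity n p g) Ω volume ∧
  (∀ᵐ x ∂volume.restrict Ω, ‖u x‖ = 1) ∧
  ∀ (y : EuclideanSpace ℝ (Fin n)) (ρ : ℝ), 0 < ρ → closedBall y ρ ⊆ Ω →
    ∀ (w : EuclideanSpace ℝ (Fin n) → EuclideanSpace ℝ (Fin p))
      (h : EuclideanSpace ℝ (Fin n) →
        (EuclideanSpace ℝ (Fin n) →L[ℝ] EuclideanSpace ℝ (Fin p))),
      HasWeakGradient n p Ω w h →
      LocallyIntegrableOn (energyDensity n p h) Ω volume →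
      (∀ᵐ x ∂volume.restrict Ω, ‖w x‖ = 1) →
      (∃ σ : ℝ, σ < ρ ∧ ∀ᵐ x ∂volume.restrict (Ω \ ball y σ), w x = u x) →
      ∫ x in ball y ρ, energyDensity n p g x ≤ ∫ x in ball y ρ, energyDensity n p h x

/-- The regular set of `u`: points of `Ω` having an open neighborhood (inside `Ω`) on
which `u` agrees almost everywhere with a `C^∞` map. -/
def regSet (n p : ℕ) (Ω : Set (EuclideanSpace ℝ (Fin n)))
    (u : EuclideanSpace ℝ (Fin n) → EuclideanSpace ℝ (Fin p)) :
    Set (EuclideanSpace ℝ (Fin n)) :=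
  {x | x ∈ Ω ∧ ∃ V : Set (EuclideanSpace ℝ (Fin n)), IsOpen V ∧ x ∈ V ∧ V ⊆ Ω ∧
    ∃ v : EuclideanSpace ℝ (Fin n) → EuclideanSpace ℝ (Fin p),
      ContDiffOn ℝ (⊤ : ℕ∞) v V ∧ ∀ᵐ z ∂volume.restrict V, u z = v z}

open scoped ContDiff Topology ENNReal NNReal

abbrev Eu (n : ℕ) := EuclideanSpace ℝ (Fin n)

abbrev bv (n : ℕ) (i : Fin n) : Eu n := EuclideanSpace.single i 1

structure Kern (n : ℕ) where
  η : Eu n → ℝ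
  Ψ : Eu n → ℝ
  η_smooth : ContDiff ℝ ∞ η
  Ψ_smooth : ContDiff ℝ ∞ Ψ
  η_nonneg : ∀ x, 0 ≤ η x
  η_int : ∫ x, η x = 1
  η_zero : ∀ x, 3/4 ≤ ‖x‖ → η x = 0
  Ψ_zero : ∀ x, 3/4 ≤ ‖x‖ → Ψ x = 0
  rel : ∀ x v, fderiv ℝ Ψ x v = - η x * inner ℝ x v

theorem kern_exists {n : ℕ} (hn : 2 ≤ n) : Nonempty (Kern n) := by
  let H : ℝ → ℝ := fun t => Real.smoothTransition (2 - 4 * t)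
  have hH : ContDiff ℝ ∞ H := Real.smoothTransition.contDiff.comp (by fun_prop)
  have hH' : ContDiff ℝ ∞ (deriv H) := by
    have := (contDiff_infty_iff_deriv (𝕜 := ℝ) (f := H)).1 hH
    exact this.2
  have hanti : Antitone H := by
    intro a b hab
    exact Real.smoothTransition.monotone (by linarith)
  have hd : ∀ t, deriv H t ≤ 0 := fun t => hanti.deriv_nonpos
  have hz : ∀ t, 1/2 ≤ t → H t = 0 := fun t ht =>
    Real.smoothTransition.zero_of_nonpos (by linarith)
  have hdz : ∀ t, 1/2 < t → deriv H t = 0 := by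
    intro t ht
    have : H =ᶠ[𝓝 t] fun _ => 0 := by
      filter_upwards [Ioi_mem_nhds ht] with s hs
      exact hz s (le_of_lt hs)
    rw [this.deriv_eq]; simp
  have hne : ∃ t, 0 < t ∧ deriv H t ≠ 0 := by
    by_contra! hcon
    have h1 : H (1/8) = 1 := Real.smoothTransition.one_of_one_le (by norm_num)
    have h2 : H 1 = 0 := hz 1 (by norm_num)
    obtain ⟨c, hc, hc'⟩ := exists_deriv_eq_slope H (show (1/8:ℝ) < 1 by norm_num)
      hH.continuous.continuousOn
      (hH.differentiable (by simp)).differentiableOn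
    rw [hcon c (by linarith [hc.1]), h1, h2] at hc'
    norm_num at hc'
  obtain ⟨t0, ht0, hdt0⟩ := hne
  let η0 : Eu n → ℝ := fun x => -2 * deriv H (‖x‖^2)
  let Ψ0 : Eu n → ℝ := fun x => H (‖x‖^2)
  have hη0 : ContDiff ℝ ∞ η0 := contDiff_const.mul (hH'.comp (contDiff_norm_sq ℝ))
  have hΨ0 : ContDiff ℝ ∞ Ψ0 := hH.comp (contDiff_norm_sq ℝ)
  have hη0n : ∀ x, 0 ≤ η0 x := fun x => by
    have := hd (‖x‖^2); simp only [η0]; linarith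
  have hη0z : ∀ x, 3/4 ≤ ‖x‖ → η0 x = 0 := fun x hx => by
    simp only [η0]; rw [hdz _ (by nlinarith)]; simp
  have hΨ0z : ∀ x, 3/4 ≤ ‖x‖ → Ψ0 x = 0 := fun x hx => hz _ (by nlinarith)
  have hcs : HasCompactSupport η0 := by
    refine HasCompactSupport.of_support_subset_isCompact (isCompact_closedBall 0 1) ?_
    intro x hx
    simp only [mem_closedBall, dist_zero_right]
    by_contra! h
    exact hx (hη0z x (by linarith))
  have hrel : ∀ x v, fderiv ℝ Ψ0 x v = - η0 x * inner ℝ x v := by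
    intro x v
    have h1 : HasFDerivAt Ψ0 (deriv H (‖x‖^2) • (2 • (innerSL ℝ x))) x := by
      have hh := ((hH.differentiable (by simp)) (‖x‖^2)).hasDerivAt
      exact hh.comp_hasFDerivAt x (hasStrictFDerivAt_norm_sq x).hasFDerivAt
    rw [h1.fderiv]
    simp [η0]; ring
  have hZ : 0 < ∫ x, η0 x := by
    apply hη0.continuous.integral_pos_of_hasCompactSupport_nonneg_nonzero hcs hη0n
      (x := (√t0) • bv n ⟨0, by omega⟩)
    simp only [η0, norm_smul, Real.norm_eq_abs, abs_of_nonneg (Real.sqrt_nonneg _)]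
    simp [Real.sq_sqrt ht0.le, hdt0]
  set Z := ∫ x, η0 x with hZdef
  refine ⟨⟨fun x => Z⁻¹ * η0 x, fun x => Z⁻¹ * Ψ0 x, contDiff_const.mul hη0,
    contDiff_const.mul hΨ0, fun x => mul_nonneg (inv_nonneg.2 hZ.le) (hη0n x), ?_,
    fun x hx => by rw [hη0z x hx, mul_zero], fun x hx => by rw [hΨ0z x hx, mul_zero], ?_⟩⟩
  · rw [integral_const_mul, ← hZdef, inv_mul_cancel₀ hZ.ne']
  · intro x v
    rw [fderiv_const_mul (hΨ0.differentiable (by simp) x)]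
    simp [hrel]; ring

theorem cs_of_zero {n : ℕ} {W : Type*} [NormedAddCommGroup W] {f : Eu n → W} {x : Eu n} {r : ℝ}
    (h : ∀ y, r ≤ ‖x - y‖ → f y = 0) : tsupport f ⊆ closedBall x r ∧ HasCompactSupport f := by
  have h1 : Function.support f ⊆ closedBall x r := by
    intro y hy
    rw [mem_closedBall, dist_comm, dist_eq_norm]
    by_contra! h'
    exact hy (h y h'.le)
  exact ⟨closure_minimal h1 isClosed_closedBall,
    HasCompactSupport.of_support_subset_isCompact (isCompact_closedBall x r) h1⟩

namespace Kern
variable {n : ℕ} (K : Kern n)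

theorem η_cs : HasCompactSupport K.η :=
  (cs_of_zero (x := 0) (r := 3/4) fun y hy => K.η_zero y (by simpa using hy)).2

theorem Ψ_cs : HasCompactSupport K.Ψ :=
  (cs_of_zero (x := 0) (r := 3/4) fun y hy => K.Ψ_zero y (by simpa using hy)).2

theorem bounds : ∃ C : ℝ, 1 ≤ C ∧ (∀ x, |K.η x| ≤ C) ∧ (∀ x, |K.Ψ x| ≤ C) ∧
    (∀ x, ‖fderiv ℝ K.Ψ x‖ ≤ C) ∧ (∀ x, ‖fderiv ℝ K.η x‖ ≤ C) ∧
    (∀ x y, |K.Ψ x - K.Ψ y| ≤ C * ‖x - y‖) ∧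
    (∀ x y, ‖fderiv ℝ K.Ψ x - fderiv ℝ K.Ψ y‖ ≤ C * ‖x - y‖) := by
  have hdΨ : ContDiff ℝ ∞ (fderiv ℝ K.Ψ) := K.Ψ_smooth.fderiv_right (by simp)
  have hdη : ContDiff ℝ ∞ (fderiv ℝ K.η) := K.η_smooth.fderiv_right (by simp)
  obtain ⟨C1, h1⟩ := K.η_smooth.continuous.bounded_above_of_compact_support K.η_cs
  obtain ⟨C2, h2⟩ := K.Ψ_smooth.continuous.bounded_above_of_compact_support K.Ψ_cs
  obtain ⟨C3, h3⟩ := hdΨ.continuous.bounded_above_of_compact_support (K.Ψ_cs.fderiv ℝ)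
  obtain ⟨C4, h4⟩ := hdη.continuous.bounded_above_of_compact_support (K.η_cs.fderiv ℝ)
  obtain ⟨C5, h5⟩ := K.Ψ_smooth.lipschitzWith_of_hasCompactSupport K.Ψ_cs (by simp)
  obtain ⟨C6, h6⟩ := hdΨ.lipschitzWith_of_hasCompactSupport (K.Ψ_cs.fderiv ℝ) (by simp)
  have hb : ∀ a b : ℝ, ∀ t : ℝ, 0 ≤ t → a ≤ b → a * t ≤ b * t := fun a b t ht h =>
    mul_le_mul_of_nonneg_right h ht
  have m : ∀ c ∈ ({1, C1, C2, C3, C4, (C5:ℝ), (C6:ℝ)} : Finset ℝ),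
      c ≤ ({1, C1, C2, C3, C4, (C5:ℝ), (C6:ℝ)} : Finset ℝ).sup' (by simp) id := fun c hc =>
    Finset.le_sup' id hc
  generalize ({1, C1, C2, C3, C4, (C5:ℝ), (C6:ℝ)} : Finset ℝ).sup' (by simp) id = C at m
  refine ⟨C, m _ (by simp), fun x => (h1 x).trans (m _ (by simp)),
    fun x => (h2 x).trans (m _ (by simp)), fun x => (h3 x).trans (m _ (by simp)),
    fun x => (h4 x).trans (m _ (by simp)), fun x y => ?_, fun x y => ?_⟩
  · have := h5.dist_le_mul x y
    rw [dist_eq_norm, dist_eq_norm] at this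
    exact this.trans (hb _ _ _ (norm_nonneg _) (m _ (by simp)))
  · have := h6.dist_le_mul x y
    rw [dist_eq_norm, dist_eq_norm] at this
    exact this.trans (hb _ _ _ (norm_nonneg _) (m _ (by simp)))

/-- scaled kernel -/
def ks (s : ℝ) (w : Eu n) : ℝ := (s ^ n)⁻¹ * K.η (s⁻¹ • w)

theorem ks_smooth (s : ℝ) : ContDiff ℝ ∞ (K.ks s) :=
  contDiff_const.mul (K.η_smooth.comp (contDiff_const_smul _))

theorem ks_zero {s : ℝ} (hs : 0 < s) (w : Eu n) (hw : 3/4 * s ≤ ‖w‖) : K.ks s w = 0 := by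
  rw [ks, K.η_zero, mul_zero]
  rw [norm_smul, norm_inv, Real.norm_of_nonneg hs.le, inv_mul_eq_div, le_div_iff₀ hs]
  exact hw

theorem ks_cs {s : ℝ} (hs : 0 < s) : HasCompactSupport (K.ks s) :=
  (cs_of_zero (x := 0) fun y hy => K.ks_zero hs y (by simpa using hy)).2

theorem ks_test {s : ℝ} (hs : 0 < s) (x : Eu n) :
    ContDiff ℝ ∞ (fun y => K.ks s (x - y)) ∧ HasCompactSupport (fun y => K.ks s (x - y)) ∧
    tsupport (fun y => K.ks s (x - y)) ⊆ ball x s := by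
  have := cs_of_zero (x := x) fun y hy => K.ks_zero hs (x - y) hy
  exact ⟨(K.ks_smooth s).comp (contDiff_const.sub contDiff_id), this.2,
    this.1.trans (closedBall_subset_ball (by linarith))⟩

variable {V : Type*} [NormedAddCommGroup V] [NormedSpace ℝ V]

/-- mollification -/
def mol (s : ℝ) (h : Eu n → V) (x : Eu n) : V := ∫ y, K.ks s (x - y) • h y

/-- the averaging measure -/
def ν : Measure (Eu n) := volume.withDensity fun z => ENNReal.ofReal (K.η z)

theorem η_integrable : Integrable K.η := K.η_smooth.continuous.integrable_of_hasCompactSupport K.η_cs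

instance : IsProbabilityMeasure K.ν := by
  constructor
  rw [ν, withDensity_apply _ MeasurableSet.univ, Measure.restrict_univ,
    ← ofReal_integral_eq_lintegral_ofReal K.η_integrable (ae_of_all _ K.η_nonneg), K.η_int]
  simp

theorem integral_ν (f : Eu n → V) : ∫ z, f z ∂K.ν = ∫ z, K.η z • f z := by
  rw [ν]
  have : (fun z => ENNReal.ofReal (K.η z)) = fun z => ((Real.toNNReal (K.η z) : ℝ≥0) : ℝ≥0∞) := rfl
  rw [this, integral_withDensity_eq_integral_smul (by
    exact (K.η_smooth.continuous.measurable).real_toNNReal)]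
  refine integral_congr_ae (ae_of_all _ fun z => ?_)
  simp only [NNReal.smul_def, Real.coe_toNNReal _ (K.η_nonneg z)]

theorem ν_ball : ∀ᵐ z ∂K.ν, ‖z‖ < 1 := by
  rw [ν, ae_withDensity_iff (by
    exact (K.η_smooth.continuous.measurable).ennreal_ofReal)]
  refine ae_of_all _ fun z hz => ?_
  by_contra! h
  exact hz (by rw [K.η_zero z (by linarith)]; simp)

theorem mol_eq {s : ℝ} (hs : 0 < s) (h : Eu n → V) (x : Eu n) :
    K.mol s h x = ∫ z, h (x - s • z) ∂K.ν := by
  rw [integral_ν, mol, ← integral_sub_left_eq_self (fun y => K.ks s (x - y) • h y) volume x]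
  have := Measure.integral_comp_smul (volume : Measure (Eu n))
    (fun y => K.ks s (x - (x - y)) • h (x - y)) s
  have h2 : ∫ z, K.η z • h (x - s • z)
      = (s ^ n) • ∫ z, K.ks s (x - (x - s • z)) • h (x - s • z) := by
    rw [← integral_smul]
    refine integral_congr_ae (ae_of_all _ fun z => ?_)
    simp only [ks, sub_sub_cancel, smul_smul]
    rw [inv_mul_cancel₀ hs.ne', one_smul, mul_inv_cancel_left₀ (by positivity)]
  rw [h2, this, smul_smul]
  simp only [finrank_euclideanSpace, Fintype.card_fin]
  rw [abs_of_nonneg (by positivity), mul_inv_cancel₀ (by positivity), one_smul]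

theorem mol_conv (s : ℝ) (h : Eu n → V) :
    K.mol s h = convolution (K.ks s) h (ContinuousLinearMap.lsmul ℝ ℝ) volume := by
  ext x
  rw [convolution_lsmul_swap, mol]

theorem mol_contDiff [CompleteSpace V] {s : ℝ} (hs : 0 < s) {h : Eu n → V} (hh : LocallyIntegrable h) :
    ContDiff ℝ ∞ (K.mol s h) := by
  rw [mol_conv]
  exact (K.ks_cs hs).contDiff_convolution_left _ (K.ks_smooth s) hh

theorem mol_fderiv [CompleteSpace V] {s : ℝ} (hs : 0 < s) {h : Eu n → V}
    (hh : LocallyIntegrable h) (x e : Eu n) :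
    fderiv ℝ (K.mol s h) x e = ∫ y, (fderiv ℝ (K.ks s) (x - y) e) • h y := by
  have h1 := (K.ks_cs hs).hasFDerivAt_convolution_left (ContinuousLinearMap.lsmul ℝ ℝ)
    ((K.ks_smooth s).of_le (by simp)) hh x
  rw [← mol_conv] at h1
  have hex : ConvolutionExistsAt (fderiv ℝ (K.ks s)) h x
      (ContinuousLinearMap.precompL (Eu n) (ContinuousLinearMap.lsmul ℝ ℝ)) volume :=
    ((K.ks_cs hs).fderiv ℝ).convolutionExists_left _
      ((K.ks_smooth s).continuous_fderiv (by simp)) hh x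
  rw [h1.fderiv, convolution, ContinuousLinearMap.integral_apply hex,
    ← integral_sub_left_eq_self _ volume x]
  refine integral_congr_ae (ae_of_all _ fun y => ?_)
  simp

end Kern

theorem fderiv_refl {n : ℕ} {W : Type*} [NormedAddCommGroup W] [NormedSpace ℝ W]
    {f : Eu n → W} {x y : Eu n} (hf : DifferentiableAt ℝ f (x - y)) (e : Eu n) :
    fderiv ℝ (fun y => f (x - y)) y e = - fderiv ℝ f (x - y) e := by
  have h1 : HasFDerivAt (fun y => x - y) (-ContinuousLinearMap.id ℝ (Eu n)) y :=
    (hasFDerivAt_id y).const_sub x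
  rw [HasFDerivAt.fderiv (f := fun y => f (x - y)) (hf.hasFDerivAt.comp y h1)]
  simp

/-- weak gradient with global integrability -/
structure WGI {n : ℕ} {V : Type*} [NormedAddCommGroup V] [NormedSpace ℝ V] (U : Set (Eu n))
    (u : Eu n → V) (g : Eu n → (Eu n →L[ℝ] V)) : Prop where
  iu : Integrable u
  ig : Integrable g
  ibp : ∀ φ : Eu n → ℝ, ContDiff ℝ ∞ φ → HasCompactSupport φ → tsupport φ ⊆ U → ∀ e,
    ∫ x, (fderiv ℝ φ x e) • u x = - ∫ x, φ x • g x e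

theorem bdd_smul_int {n : ℕ} {V : Type*} [NormedAddCommGroup V] [NormedSpace ℝ V] {φ : Eu n → ℝ}
    (h1 : Continuous φ) (h2 : HasCompactSupport φ) {h : Eu n → V} (hh : Integrable h) :
    Integrable fun y => φ y • h y := by
  obtain ⟨C, hC⟩ := h1.bounded_above_of_compact_support h2
  exact hh.bdd_smul C h1.aestronglyMeasurable (ae_of_all _ hC)

namespace Kern
variable {n : ℕ} (K : Kern n) {V : Type*} [NormedAddCommGroup V] [NormedSpace ℝ V] [CompleteSpace V]

theorem mol_grad {U : Set (Eu n)} {u : Eu n → V} {g : Eu n → (Eu n →L[ℝ] V)} (H : WGI U u g)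
    {s : ℝ} (hs : 0 < s) {x : Eu n} (hx : ball x s ⊆ U) :
    fderiv ℝ (K.mol s u) x = K.mol s g x := by
  ext e
  rw [K.mol_fderiv hs H.iu.locallyIntegrable, mol]
  obtain ⟨h1, h2, h3⟩ := K.ks_test hs x
  rw [ContinuousLinearMap.integral_apply (bdd_smul_int h1.continuous h2 H.ig)]
  have := H.ibp _ h1 h2 (h3.trans hx) e
  simp only [smul_apply]
  rw [← neg_eq_iff_eq_neg] at this
  rw [← this, ← integral_neg]
  refine integral_congr_ae (ae_of_all _ fun y => ?_)
  simp only [fderiv_refl ((K.ks_smooth s).differentiable (by simp) (x - y)), neg_smul, neg_neg]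

end Kern

theorem l2_eq {α V : Type*} [MeasurableSpace α] [NormedAddCommGroup V] (μ : Measure α) (f : α → V) :
    ∫⁻ x, ‖f x‖ₑ ^ 2 ∂μ = eLpNorm f 2 μ ^ 2 := by
  have := eLpNorm_nnreal_pow_eq_lintegral (μ := μ) (f := f) (p := 2) (by simp)
  simpa using this.symm

theorem jensen2 {α V : Type*} [MeasurableSpace α] [NormedAddCommGroup V] [NormedSpace ℝ V]
    (μ : Measure α) [IsProbabilityMeasure μ] {f : α → V} (hf : AEStronglyMeasurable f μ) :
    ‖∫ x, f x ∂μ‖ₑ ^ 2 ≤ ∫⁻ x, ‖f x‖ₑ ^ 2 ∂μ := by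
  rw [l2_eq]
  gcongr
  refine (enorm_integral_le_lintegral_enorm f).trans ?_
  rw [← eLpNorm_one_eq_lintegral_enorm]
  exact eLpNorm_le_eLpNorm_of_exponent_le (by norm_num) hf

theorem transl_cont {n : ℕ} {V : Type*} [NormedAddCommGroup V] {h : Eu n → V} (hh : MemLp h 2) :
    Tendsto (fun v : Eu n => ∫⁻ x, ‖h (x - v) - h x‖ₑ ^ 2) (𝓝 0) (𝓝 0) := by
  let T : Eu n → C(Eu n, Eu n) := fun v => ⟨fun x => x - v, by fun_prop⟩
  have hT : Continuous T := ContinuousMap.continuous_of_continuous_uncurry _ (by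
    simp only [T, Function.uncurry_def, ContinuousMap.coe_mk]; fun_prop)
  have hmp : ∀ v, MeasurePreserving (T v) volume volume := fun v =>
    measurePreserving_sub_right volume v
  have hc := (continuous_const (y := hh.toLp h)).compMeasurePreservingLp hT hmp (by norm_num)
  have h1 := (tendsto_iff_edist_tendsto_0.1 (hc.tendsto 0))
  have h2 : Tendsto (fun x : ℝ≥0∞ => x ^ 2) (𝓝 0) (𝓝 0) := by
    have := (ENNReal.continuous_pow 2).tendsto 0; simpa using this
  refine (h2.comp h1).congr fun v => ?_
  simp only [Function.comp, Lp.edist_def]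
  rw [l2_eq]
  congr 1
  apply eLpNorm_congr_ae
  have e1 := Lp.coeFn_compMeasurePreserving (hh.toLp h) (hmp v)
  have e2 := Lp.coeFn_compMeasurePreserving (hh.toLp h) (hmp 0)
  have e3 := (hmp v).quasiMeasurePreserving.ae_eq_comp hh.coeFn_toLp
  have e4 := (hmp 0).quasiMeasurePreserving.ae_eq_comp hh.coeFn_toLp
  filter_upwards [e1, e2, e3, e4] with x a1 a2 a3 a4
  simp only [Pi.sub_apply]
  rw [a1, a2, a3, a4]
  simp [T]

namespace Kern
variable {n : ℕ} (K : Kern n) {V : Type*} [NormedAddCommGroup V] [NormedSpace ℝ V]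

theorem mol_congr (s : ℝ) {h h' : Eu n → V} (e : h =ᵐ[volume] h') : K.mol s h = K.mol s h' := by
  ext x
  exact integral_congr_ae (e.mono fun y hy => by simp only [hy])

theorem ν_int {s : ℝ} (hs : 0 < s) {h : Eu n → V} (hh : Integrable h) (x : Eu n) :
    Integrable (fun z => h (x - s • z)) K.ν := by
  have h1 : Integrable fun z => h (x - s • z) :=
    (hh.comp_sub_left x).comp_smul hs.ne'
  have : (fun z => ENNReal.ofReal (K.η z)) = fun z => ((Real.toNNReal (K.η z) : ℝ≥0) : ℝ≥0∞) := rfl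
  rw [ν, this, integrable_withDensity_iff_integrable_smul
    ((K.η_smooth.continuous.measurable).real_toNNReal)]
  refine (bdd_smul_int K.η_smooth.continuous K.η_cs h1).congr (ae_of_all _ fun z => ?_)
  simp only [NNReal.smul_def, Real.coe_toNNReal _ (K.η_nonneg z)]

variable [CompleteSpace V]

theorem mol_const {s : ℝ} (hs : 0 < s) (c : V) (x : Eu n) : K.mol s (fun _ => c) x = c := by
  rw [K.mol_eq hs]; simp

theorem mol_norm_le {s : ℝ} (hs : 0 < s) {h : Eu n → V} (hh : Integrable h)
    (hb : ∀ᵐ x, ‖h x‖ ≤ 1) (x : Eu n) : ‖K.mol s h x‖ ≤ 1 := by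
  rw [← K.mol_const hs (1:ℝ) x]
  refine norm_integral_le_of_norm_le ?_ (hb.mono fun y hy => ?_)
  · obtain ⟨h1, h2, -⟩ := K.ks_test hs x
    exact (h1.continuous.integrable_of_hasCompactSupport h2).smul_const 1
  · have : 0 ≤ K.ks s (x - y) := mul_nonneg (by positivity) (K.η_nonneg _)
    rw [norm_smul, Real.norm_of_nonneg this, smul_eq_mul]
    gcongr

theorem ton {s : ℝ} (hs : 0 < s) {h k : Eu n → V} (hh : Integrable h) (hk : AEStronglyMeasurable k)
    (A : Set (Eu n)) :
    ∫⁻ x in A, ‖K.mol s h x - k x‖ₑ ^ 2 ≤ ∫⁻ z, (∫⁻ x in A, ‖h (x - s • z) - k x‖ₑ ^ 2) ∂K.ν := by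
  wlog hm : StronglyMeasurable h generalizing h with H
  · have e := hh.1.ae_eq_mk
    have := H (h := hh.1.mk h) (hh.congr e) hh.1.stronglyMeasurable_mk
    rw [K.mol_congr s e]
    refine this.trans (le_of_eq (lintegral_congr fun z => lintegral_congr_ae ?_))
    have := (measurePreserving_sub_right volume (s • z)).quasiMeasurePreserving.ae_eq_comp e
    filter_upwards [ae_restrict_of_ae this] with x hx
    simp only [Function.comp_apply] at hx
    rw [hx]
  rw [lintegral_lintegral_swap]
  · refine lintegral_mono fun x => ?_
    have h1 : K.mol s h x - k x = ∫ z, (h (x - s • z) - k x) ∂K.ν := by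
      rw [integral_sub (K.ν_int hs hh x) (integrable_const _), ← K.mol_eq hs]; simp
    rw [h1]
    exact jensen2 _ ((K.ν_int hs hh x).sub (integrable_const _)).1
  · have h1 : StronglyMeasurable fun q : Eu n × Eu n => h (q.2 - s • q.1) :=
      hm.comp_measurable (by fun_prop)
    have h2 : AEStronglyMeasurable (fun q : Eu n × Eu n => k q.2) (K.ν.prod (volume.restrict A)) :=
      hk.restrict.comp_snd
    exact (h1.aestronglyMeasurable.sub h2).enorm.pow_const 2

theorem mol_meas {s : ℝ} (hs : 0 < s) {h : Eu n → V} (hh : Integrable h) :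
    AEStronglyMeasurable (K.mol s h) :=
  (K.mol_contDiff hs hh.locallyIntegrable).continuous.aestronglyMeasurable

theorem mol_l2 {s : ℝ} (hs : 0 < s) {h : Eu n → V} (hh : Integrable h) {A B : Set (Eu n)}
    (hB : MeasurableSet B) (hA : MeasurableSet A)
    (hAB : ∀ x ∈ A, ball x s ⊆ B) :
    ∫⁻ x in A, ‖K.mol s h x‖ₑ ^ 2 ≤ ∫⁻ x in B, ‖h x‖ₑ ^ 2 := by
  have := K.ton hs hh (k := 0) aestronglyMeasurable_const A
  simp only [Pi.zero_apply, sub_zero] at this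
  refine this.trans ?_
  calc _ ≤ ∫⁻ z, (∫⁻ x in B, ‖h x‖ₑ ^ 2) ∂K.ν := by
        refine lintegral_mono_ae (K.ν_ball.mono fun z hz => ?_)
        rw [← lintegral_indicator hA, ← lintegral_indicator hB,
          ← lintegral_sub_right_eq_self (fun x => B.indicator _ x) (s • z)]
        refine lintegral_mono fun x => ?_
        by_cases hx : x ∈ A
        · rw [indicator_of_mem hx, indicator_of_mem]
          refine hAB x hx ?_
          rw [mem_ball, dist_eq_norm, sub_sub_cancel_left, norm_neg, norm_smul,
            Real.norm_of_nonneg hs.le]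
          nlinarith
        · rw [indicator_of_notMem hx]; exact zero_le
    _ = _ := by simp

theorem mol_l2_tendsto {h : Eu n → V} (hh : Integrable h) (h2 : MemLp h 2) :
    Tendsto (fun s => ∫⁻ x, ‖K.mol s h x - h x‖ₑ ^ 2) (𝓝[>] 0) (𝓝 0) := by
  rw [ENNReal.tendsto_nhds_zero]
  intro ε hε
  have h1 := (ENNReal.tendsto_nhds_zero.1 (transl_cont h2)) ε hε
  obtain ⟨δ, hδ, hδ'⟩ := Metric.eventually_nhds_iff.1 h1
  filter_upwards [Ioo_mem_nhdsGT hδ] with s hs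
  have := K.ton hs.1 hh (k := h) hh.1 univ
  simp only [Measure.restrict_univ] at this
  refine this.trans ?_
  calc _ ≤ ∫⁻ z, ε ∂K.ν := by
        refine lintegral_mono_ae (K.ν_ball.mono fun z hz => hδ' ?_)
        rw [dist_zero_right, norm_smul, Real.norm_of_nonneg hs.1.le]
        nlinarith [hs.1, hs.2]
    _ = _ := by simp

theorem mol_memLp {s : ℝ} (hs : 0 < s) {h : Eu n → V} (hh : Integrable h) (h2 : MemLp h 2) :
    MemLp (K.mol s h) 2 := by
  refine ⟨K.mol_meas hs hh, ?_⟩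
  have := K.mol_l2 hs hh (A := univ) (B := univ) MeasurableSet.univ MeasurableSet.univ
    (fun _ _ => subset_univ _)
  simp only [Measure.restrict_univ, l2_eq] at this
  by_contra hc
  have h3 := h2.2
  simp only [not_lt, top_le_iff] at hc
  rw [hc] at this
  simp at this
  exact absurd this h3.ne

end Kern

theorem transl_smooth {n : ℕ} {V : Type*} [NormedAddCommGroup V] [NormedSpace ℝ V] [CompleteSpace V]
    {f : Eu n → V} (hf : ContDiff ℝ ∞ f) (z v : Eu n) {a b : ℝ} (hab : a + ‖v‖ ≤ b) :
    ∫⁻ x in ball z a, ‖f (x - v) - f x‖ₑ ^ 2 ≤ ‖v‖ₑ ^ 2 * ∫⁻ x in ball z b, ‖fderiv ℝ f x‖ₑ ^ 2 := by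
  have hfc := hf.continuous_fderiv (by simp)
  let P : Measure ℝ := volume.restrict (Ioc 0 1)
  have hP : IsProbabilityMeasure P := ⟨by simp [P]⟩
  have h1 : ∀ x, ‖f (x - v) - f x‖ₑ ^ 2 ≤ ‖v‖ₑ ^ 2 * ∫⁻ t, ‖fderiv ℝ f (x - t • v)‖ₑ ^ 2 ∂P := by
    intro x
    have e : f (x - v) - f x = ∫ t, fderiv ℝ f (x - t • v) (-v) ∂P := by
      have hd : ∀ t ∈ uIcc (0:ℝ) 1, HasDerivAt (fun t : ℝ => f (x - t • v))
          (fderiv ℝ f (x - t • v) (-v)) t := by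
        intro t _
        have hd1 : HasDerivAt (fun t : ℝ => x - t • v) (-v) t := by
          simpa using ((hasDerivAt_id t).smul_const v).const_sub x
        exact ((hf.differentiable (by simp) (x - t • v)).hasFDerivAt.comp_hasDerivAt t hd1)
      have := intervalIntegral.integral_eq_sub_of_hasDerivAt hd (by
        apply Continuous.intervalIntegrable
        fun_prop)
      rw [intervalIntegral.integral_of_le zero_le_one] at this
      rw [this]; simp
    rw [e]
    refine (jensen2 P (by fun_prop)).trans ?_
    rw [← lintegral_const_mul _ (by fun_prop)]
    refine lintegral_mono fun t => ?_
    rw [← mul_pow]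
    gcongr
    rw [mul_comm, ← enorm_neg v]
    exact ContinuousLinearMap.le_opENorm _ _
  refine (lintegral_mono h1).trans ?_
  rw [lintegral_const_mul _ (by
    apply Measurable.lintegral_prod_right' (f := fun q : Eu n × ℝ => ‖fderiv ℝ f (q.1 - q.2 • v)‖ₑ ^ 2)
    fun_prop)]
  refine mul_le_mul_right ?_ _
  rw [lintegral_lintegral_swap (by
    apply Measurable.aemeasurable; simp only [Function.uncurry_def]; fun_prop)]
  calc _ ≤ ∫⁻ t, (∫⁻ x in ball z b, ‖fderiv ℝ f x‖ₑ ^ 2) ∂P := by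
        refine lintegral_mono_ae ((ae_restrict_mem measurableSet_Ioc).mono fun t ht => ?_)
        rw [← lintegral_indicator measurableSet_ball, ← lintegral_indicator measurableSet_ball,
          ← lintegral_sub_right_eq_self (fun x => (ball z b).indicator _ x) (t • v)]
        refine lintegral_mono fun x => ?_
        by_cases hx : x ∈ ball z a
        · rw [indicator_of_mem hx, indicator_of_mem]
          rw [mem_ball, dist_eq_norm] at hx ⊢
          have : x - t • v - z = (x - z) - t • v := by abel
          rw [this]
          refine (norm_sub_le _ _).trans_lt ?_
          rw [norm_smul, Real.norm_of_nonneg ht.1.le]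
          nlinarith [norm_nonneg v, ht.2]
        · rw [indicator_of_notMem hx]; exact zero_le
    _ = _ := by simp

namespace Kern
variable {n : ℕ} (K : Kern n) {V : Type*} [NormedAddCommGroup V] [NormedSpace ℝ V] [CompleteSpace V]

theorem mol_eLp_tendsto {u : Eu n → V} (hi : Integrable u) (hu : MemLp u 2) :
    Tendsto (fun t => eLpNorm (fun x => K.mol t u x - u x) 2 volume) (𝓝[>] 0) (𝓝 0) := by
  have := K.mol_l2_tendsto hi hu
  simp only [l2_eq] at this
  have h2 := (this.ennrpow_const (1/2 : ℝ))
  rw [ENNReal.zero_rpow_of_pos (by norm_num)] at h2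
  refine h2.congr fun t => ?_
  rw [← ENNReal.rpow_natCast, ← ENNReal.rpow_mul]; norm_num

theorem transl_weak (K : Kern n) {U : Set (Eu n)} {u : Eu n → V} {g : Eu n → (Eu n →L[ℝ] V)} (H : WGI U u g)
    (hu : MemLp u 2) {z v : Eu n} {a b : ℝ} (hab : a + ‖v‖ < b) (hU : ball z b ⊆ U) :
    ∫⁻ x in ball z a, ‖u (x - v) - u x‖ₑ ^ 2 ≤ ‖v‖ₑ ^ 2 * ∫⁻ x in ball z b, ‖g x‖ₑ ^ 2 := by
  obtain ⟨M, hM⟩ : ∃ M, M = ‖v‖ₑ ^ 2 * ∫⁻ x in ball z b, ‖g x‖ₑ ^ 2 := ⟨_, rfl⟩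
  rw [← hM]
  have key : ∀ t, 0 < t → t < b - (a + ‖v‖) →
      eLpNorm (fun x => u (x - v) - u x) 2 (volume.restrict (ball z a)) ≤
      M ^ (1/2 : ℝ) + 2 * eLpNorm (fun x => K.mol t u x - u x) 2 volume := by
    intro t ht ht'
    have hm := K.mol_contDiff ht H.iu.locallyIntegrable
    have h1 := transl_smooth hm z v (le_refl (a + ‖v‖))
    have h2 : ∫⁻ x in ball z (a + ‖v‖), ‖fderiv ℝ (K.mol t u) x‖ₑ ^ 2 ≤
        ∫⁻ x in ball z b, ‖g x‖ₑ ^ 2 := by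
      have hsub : ∀ x ∈ ball z (a + ‖v‖), ball x t ⊆ ball z b := fun x hx =>
        ball_subset_ball' (by rw [mem_ball] at hx; linarith)
      refine le_trans (le_of_eq ?_) (K.mol_l2 ht H.ig measurableSet_ball measurableSet_ball hsub)
      refine setLIntegral_congr_fun measurableSet_ball fun x hx => ?_
      rw [K.mol_grad H ht ((hsub x hx).trans hU)]
    have h3 : eLpNorm (fun x => K.mol t u (x - v) - K.mol t u x) 2 (volume.restrict (ball z a))
        ≤ M ^ (1/2 : ℝ) := by
      have h4 := h1.trans (mul_le_mul_right h2 _)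
      rw [l2_eq, ← hM] at h4
      have := ENNReal.rpow_le_rpow h4 (z := 1/2) (by norm_num)
      rwa [← ENNReal.rpow_natCast, ← ENNReal.rpow_mul, show ((2:ℕ):ℝ) * (1/2) = 1 by norm_num,
        ENNReal.rpow_one] at this
    have hmm := K.mol_meas ht H.iu
    have hq := (measurePreserving_sub_right (volume : Measure (Eu n)) v)
    have m1 : AEStronglyMeasurable (fun x => K.mol t u x - u x) := hmm.sub H.iu.1
    have m1' : AEStronglyMeasurable (fun x => K.mol t u (x - v) - u (x - v)) :=
      m1.comp_quasiMeasurePreserving hq.quasiMeasurePreserving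
    have m2 : AEStronglyMeasurable (fun x => K.mol t u (x - v) - K.mol t u x) :=
      (hmm.comp_quasiMeasurePreserving hq.quasiMeasurePreserving).sub hmm
    have e : (fun x => u (x - v) - u x) = (fun x => K.mol t u (x - v) - K.mol t u x)
        - ((fun x => K.mol t u (x - v) - u (x - v)) - (fun x => K.mol t u x - u x)) := by
      ext x; simp only [Pi.sub_apply]; abel
    rw [e]
    refine (eLpNorm_sub_le m2.restrict (m1'.restrict.sub m1.restrict) (by norm_num)).trans ?_
    refine add_le_add h3 ((eLpNorm_sub_le m1'.restrict m1.restrict (by norm_num)).trans ?_)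
    rw [two_mul]
    refine add_le_add ((eLpNorm_mono_measure _ Measure.restrict_le_self).trans ?_)
      (eLpNorm_mono_measure _ Measure.restrict_le_self)
    exact le_of_eq (eLpNorm_comp_measurePreserving (g := fun x => K.mol t u x - u x)
      (f := fun x => x - v) m1 hq)
  have hlim : Tendsto (fun t => M ^ (1/2 : ℝ) + 2 * eLpNorm (fun x => K.mol t u x - u x) 2 volume)
      (𝓝[>] 0) (𝓝 (M ^ (1/2 : ℝ) + 2 * 0)) := by
    exact tendsto_const_nhds.add (ENNReal.Tendsto.const_mul (K.mol_eLp_tendsto H.iu hu) (Or.inr (by simp)))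
  have := ge_of_tendsto hlim (by
    filter_upwards [Ioo_mem_nhdsGT (show 0 < b - (a + ‖v‖) by linarith)] with t ht
    exact key t ht.1 ht.2)
  rw [mul_zero, add_zero] at this
  rw [l2_eq]
  calc _ ≤ (M ^ (1/2 : ℝ)) ^ 2 := by gcongr
    _ = M := by rw [← ENNReal.rpow_natCast, ← ENNReal.rpow_mul]; norm_num

theorem mol_close {U : Set (Eu n)} {u : Eu n → V} {g : Eu n → (Eu n →L[ℝ] V)} (H : WGI U u g)
    (hu : MemLp u 2) {z : Eu n} {a b δ : ℝ} (hδ : 0 < δ) (hab : a + δ ≤ b) (hU : ball z b ⊆ U) :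
    ∫⁻ x in ball z a, ‖K.mol δ u x - u x‖ₑ ^ 2 ≤
      ENNReal.ofReal δ ^ 2 * ∫⁻ x in ball z b, ‖g x‖ₑ ^ 2 := by
  refine (K.ton hδ H.iu H.iu.1 _).trans ?_
  calc _ ≤ ∫⁻ y, (ENNReal.ofReal δ ^ 2 * ∫⁻ x in ball z b, ‖g x‖ₑ ^ 2) ∂K.ν := by
        refine lintegral_mono_ae (K.ν_ball.mono fun y hy => ?_)
        have hv : ‖δ • y‖ < δ := by
          rw [norm_smul, Real.norm_of_nonneg hδ.le]
          nlinarith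
        refine (K.transl_weak H hu (v := δ • y) (a := a) (b := b) (by linarith) hU).trans ?_
        gcongr
        rw [← ofReal_norm]
        exact ENNReal.ofReal_le_ofReal hv.le
    _ = _ := by simp

end Kern

theorem Kern.mol_seq {n : ℕ} (K : Kern n) {V : Type*} [NormedAddCommGroup V] [NormedSpace ℝ V]
    [CompleteSpace V] {u : Eu n → V} (hi : Integrable u) (hu : MemLp u 2) :
    ∃ s : ℕ → ℝ, (∀ k, 0 < s k) ∧ Tendsto s atTop (𝓝[>] 0) ∧
      ∀ᵐ x, Tendsto (fun k => K.mol (s k) u x) atTop (𝓝 (u x)) := by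
  let s0 : ℕ → ℝ := fun k => 1 / ((k:ℝ) + 1)
  have hs0 : ∀ k, 0 < s0 k := fun k => by positivity
  have ht : Tendsto s0 atTop (𝓝[>] 0) := tendsto_nhdsWithin_iff.2
    ⟨tendsto_one_div_add_atTop_nhds_zero_nat, Eventually.of_forall hs0⟩
  have h1 := (K.mol_eLp_tendsto hi hu).comp ht
  have h2 : TendstoInMeasure volume (fun k => K.mol (s0 k) u) atTop u :=
    tendstoInMeasure_of_tendsto_eLpNorm (p := 2) (by norm_num) (fun k => K.mol_meas (hs0 k) hi)
      hi.1 h1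
  obtain ⟨ns, hns, hae⟩ := h2.exists_seq_tendsto_ae
  exact ⟨fun k => s0 (ns k), fun k => hs0 _, ht.comp hns.tendsto_atTop, hae⟩

theorem pair_tendsto {α W F G : Type*} [MeasurableSpace α] {μ : Measure α} [NormedAddCommGroup W]
    [NormedSpace ℝ W]
    [NormedAddCommGroup F] [NormedAddCommGroup G] {a : α → G} (ha : MemLp a 2 μ)
    {ι : Type*} {l : Filter ι} {f : ι → α → F} (hf : ∀ᶠ k in l, AEStronglyMeasurable (f k) μ)
    (h0 : Tendsto (fun k => eLpNorm (f k) 2 μ) l (𝓝 0)) {T : ι → α → W}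
    (hT : ∀ᶠ k in l, ∀ᵐ x ∂μ, ‖T k x‖ ≤ ‖a x‖ * ‖f k x‖) :
    Tendsto (fun k => ∫ x, T k x ∂μ) l (𝓝 0) := by
  rw [tendsto_zero_iff_norm_tendsto_zero]
  have hlim : Tendsto (fun k => (eLpNorm a 2 μ * eLpNorm (f k) 2 μ).toReal) l (𝓝 0) := by
    have := ENNReal.Tendsto.const_mul h0 (a := eLpNorm a 2 μ) (Or.inr ha.2.ne)
    rw [mul_zero] at this
    have := (ENNReal.tendsto_toReal ENNReal.zero_ne_top).comp this
    simpa [Function.comp_def] using this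
  have hfin : ∀ᶠ k in l, eLpNorm (f k) 2 μ < 1 := h0.eventually (gt_mem_nhds one_pos)
  refine squeeze_zero' (Eventually.of_forall fun k => norm_nonneg _) ?_ hlim
  filter_upwards [hf, hT, hfin] with k hk1 hk2 hk3
  have h1 : ‖∫ x, T k x ∂μ‖ₑ ≤ eLpNorm a 2 μ * eLpNorm (f k) 2 μ := by
    refine (enorm_integral_le_lintegral_enorm _).trans ?_
    have h2 := eLpNorm_smul_le_mul_eLpNorm (r := 1) (p := 2) (q := 2) hk1.norm ha.1.norm
    rw [eLpNorm_norm, eLpNorm_norm, eLpNorm_one_eq_lintegral_enorm] at h2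
    refine le_trans (lintegral_mono_ae (hk2.mono fun x hx => ?_)) h2
    rw [← ofReal_norm, ← ofReal_norm]
    refine ENNReal.ofReal_le_ofReal (hx.trans (le_of_eq ?_))
    simp
  have := ENNReal.toReal_mono (ENNReal.mul_ne_top ha.2.ne (hk3.trans ENNReal.one_lt_top).ne) h1
  simpa using this

theorem ibp_c1 {n : ℕ} {W : Type*} [NormedAddCommGroup W] [NormedSpace ℝ W] {f : Eu n → W}
    (hf : ContDiff ℝ 1 f) {φ : Eu n → ℝ} (hφ : ContDiff ℝ 1 φ) (hc : HasCompactSupport φ) (e : Eu n) :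
    ∫ x, (fderiv ℝ φ x e) • f x = - ∫ x, φ x • fderiv ℝ f x e := by
  have c1 : Continuous fun x => fderiv ℝ φ x e := (hφ.continuous_fderiv (by simp)).clm_apply continuous_const
  have c2 : Continuous fun x => fderiv ℝ f x e := (hf.continuous_fderiv (by simp)).clm_apply continuous_const
  have k1 : HasCompactSupport fun x => fderiv ℝ φ x e := hc.fderiv_apply (𝕜 := ℝ) e
  rw [integral_smul_fderiv_eq_neg_fderiv_smul_of_integrable, neg_neg]
  · exact (c1.smul hf.continuous).integrable_of_hasCompactSupport k1.smul_right
  · exact (hφ.continuous.smul c2).integrable_of_hasCompactSupport hc.smul_right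
  · exact (hφ.continuous.smul hf.continuous).integrable_of_hasCompactSupport hc.smul_right
  · exact fun x _ => hφ.differentiable (by simp) x
  · exact fun x _ => hf.differentiable (by simp) x

theorem chain {n : ℕ} (K : Kern n) {V W : Type*} [NormedAddCommGroup V] [NormedSpace ℝ V]
    [FiniteDimensional ℝ V] [NormedAddCommGroup W] [NormedSpace ℝ W]
    {U : Set (Eu n)} (hU : IsOpen U) {u : Eu n → V} {g : Eu n → (Eu n →L[ℝ] V)} (H : WGI U u g)
    (hu : MemLp u 2) (hg : MemLp g 2) (hb : ∀ᵐ x, ‖u x‖ ≤ 1) {G : Eu n × V → W}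
    (hG : ContDiff ℝ 1 G) {φ : Eu n → ℝ} (hφ : ContDiff ℝ ∞ φ) (hc : HasCompactSupport φ)
    (hφU : tsupport φ ⊆ U) (e : Eu n) :
    ∫ x, (fderiv ℝ φ x e) • G (x, u x) = - ∫ x, φ x • fderiv ℝ G (x, u x) (e, g x e) := by
  have := FiniteDimensional.complete ℝ V
  obtain ⟨s, hs, hst, hae⟩ := K.mol_seq H.iu hu
  have hcpt : IsCompact (tsupport φ ×ˢ closedBall (0:V) 1) := hc.isCompact.prod (isCompact_closedBall 0 1)
  obtain ⟨C1, hC1⟩ := hcpt.exists_bound_of_continuousOn hG.continuous.continuousOn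
  obtain ⟨C2, hC2⟩ := hcpt.exists_bound_of_continuousOn (hG.continuous_fderiv (by simp)).continuousOn
  have hgc := hG.continuous_fderiv (by simp)
  have c1 : Continuous fun x => fderiv ℝ φ x e :=
    (hφ.continuous_fderiv (by simp)).clm_apply continuous_const
  have k1 : HasCompactSupport fun x => fderiv ℝ φ x e := hc.fderiv_apply (𝕜 := ℝ) e
  have hz1 : ∀ x, x ∉ tsupport φ → φ x = 0 := fun x hx => image_eq_zero_of_notMem_tsupport hx
  have hz2 : ∀ x, x ∉ tsupport φ → fderiv ℝ φ x e = 0 := fun x hx => by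
    rw [image_eq_zero_of_notMem_tsupport (fun h => hx (tsupport_fderiv_subset ℝ h))]; rfl
  have hmb : ∀ k x, ‖K.mol (s k) u x‖ ≤ 1 := fun k x => K.mol_norm_le (hs k) H.iu hb x
  have hmc : ∀ k, ContDiff ℝ ∞ (K.mol (s k) u) := fun k =>
    K.mol_contDiff (hs k) H.iu.locallyIntegrable
  -- left limit
  have L : Tendsto (fun k => ∫ x, (fderiv ℝ φ x e) • G (x, K.mol (s k) u x)) atTop
      (𝓝 (∫ x, (fderiv ℝ φ x e) • G (x, u x))) := by
    refine tendsto_integral_of_dominated_convergence (fun x => ‖fderiv ℝ φ x e‖ * C1) ?_ ?_ ?_ ?_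
    · intro k
      exact (c1.smul (hG.continuous.comp (continuous_id.prodMk (hmc k).continuous))).aestronglyMeasurable
    · exact (c1.integrable_of_hasCompactSupport k1).norm.mul_const _
    · intro k
      refine ae_of_all _ fun x => ?_
      rw [norm_smul]
      by_cases hx : x ∈ tsupport φ
      · gcongr
        exact hC1 _ ⟨hx, by simpa using hmb k x⟩
      · simp [hz2 x hx]
    · filter_upwards [hae] with x hx
      exact ((hG.continuous.tendsto (x, u x)).comp (tendsto_const_nhds.prodMk_nhds hx)).const_smul _
  have mu : AEStronglyMeasurable (fun x => (x, u x)) (volume : Measure (Eu n)) :=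
    aestronglyMeasurable_id.prodMk H.iu.1
  -- right, first part
  have mg : AEStronglyMeasurable (fun x => (e, g x e)) (volume : Measure (Eu n)) :=
    aestronglyMeasurable_const.prodMk (H.ig.1.apply_continuousLinearMap e)
  have ml : ∀ k, AEStronglyMeasurable (fun x => φ x • fderiv ℝ G (x, K.mol (s k) u x) (e, g x e))
      (volume : Measure (Eu n)) := by
    intro k
    have h1 : AEStronglyMeasurable (fun x => fderiv ℝ G (x, K.mol (s k) u x))
        (volume : Measure (Eu n)) :=
        (hgc.comp (continuous_id.prodMk (hmc k).continuous)).aestronglyMeasurable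
    exact hφ.continuous.aestronglyMeasurable.smul
        (isBoundedBilinearMap_apply.continuous.comp_aestronglyMeasurable (h1.prodMk mg))
  have bi : Integrable (fun x => ‖φ x • (C2 * (‖e‖ + ‖g x‖ * ‖e‖))‖) := by
    have : Integrable fun x => φ x • (C2 * ‖e‖ + (C2 * ‖e‖) * ‖g x‖) := by
        simp only [smul_add]
        refine Integrable.add ?_ (bdd_smul_int hφ.continuous hc (H.ig.norm.const_mul _))
        exact (hφ.continuous.integrable_of_hasCompactSupport hc).smul_const _
    refine this.norm.congr (ae_of_all _ fun x => ?_)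
    simp only; congr 2; ring
  have bl : ∀ k x, ‖φ x • fderiv ℝ G (x, K.mol (s k) u x) (e, g x e)‖ ≤
      ‖φ x • (C2 * (‖e‖ + ‖g x‖ * ‖e‖))‖ := by
    intro k x
    rw [norm_smul, norm_smul]
    by_cases hx : x ∈ tsupport φ
    · gcongr
      refine (ContinuousLinearMap.le_opNorm _ _).trans ?_
      refine le_trans ?_ (le_abs_self _)
      have h1 := hC2 (x, K.mol (s k) u x) ⟨hx, by simpa using hmb k x⟩
      gcongr
      · exact (norm_nonneg _).trans h1
      · rw [Prod.norm_def]
        refine max_le (by simp only; nlinarith [norm_nonneg (g x), norm_nonneg e]) ?_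
        exact ((g x).le_opNorm e).trans (by simp)
    · simp [hz1 x hx]
  have R1 : Tendsto (fun k => ∫ x, φ x • fderiv ℝ G (x, K.mol (s k) u x) (e, g x e)) atTop
      (𝓝 (∫ x, φ x • fderiv ℝ G (x, u x) (e, g x e))) := by
    refine tendsto_integral_of_dominated_convergence _ ml bi (fun k => ae_of_all _ (bl k)) ?_
    · filter_upwards [hae] with x hx
      have h1 := ((hgc.tendsto (x, u x)).comp (tendsto_const_nhds.prodMk_nhds hx))
      exact ((isBoundedBilinearMap_apply.continuous.tendsto (_, (e, g x e))).comp
        (h1.prodMk_nhds tendsto_const_nhds)).const_smul _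
  have R2 : Tendsto (fun k => ∫ x, φ x • fderiv ℝ G (x, K.mol (s k) u x)
      (0, (K.mol (s k) g x - g x) e)) atTop (𝓝 0) := by
    have hφ2 : MemLp (fun x => (φ x) * (C2 * ‖e‖)) 2 volume :=
      ((hφ.continuous.memLp_of_hasCompactSupport hc)).mul_const _
    refine pair_tendsto hφ2 (f := fun k x => K.mol (s k) g x - g x)
      (Eventually.of_forall fun k => (K.mol_meas (hs k) H.ig).sub H.ig.1)
      ((K.mol_eLp_tendsto H.ig hg).comp hst) (Eventually.of_forall fun k => ae_of_all _ fun x => ?_)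
    rw [norm_smul, norm_mul]
    by_cases hx : x ∈ tsupport φ
    · rw [mul_assoc]
      gcongr
      refine (ContinuousLinearMap.le_opNorm _ _).trans ?_
      have h1 := hC2 (x, K.mol (s k) u x) ⟨hx, by simpa using hmb k x⟩
      have h2 := (norm_nonneg _).trans h1
      rw [Real.norm_of_nonneg (by positivity), mul_assoc]
      gcongr
      rw [Prod.norm_def]
      refine max_le (by simp only [norm_zero]; positivity) ?_
      exact (ContinuousLinearMap.le_opNorm _ _).trans (le_of_eq (mul_comm _ _))
    · simp [hz1 x hx]
  obtain ⟨δ, hδ, hδU⟩ := hc.isCompact.exists_thickening_subset_open hU hφU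
  have E : ∀ᶠ k in atTop, ∫ x, (fderiv ℝ φ x e) • G (x, K.mol (s k) u x) =
      -((∫ x, φ x • fderiv ℝ G (x, K.mol (s k) u x) (e, g x e)) +
       ∫ x, φ x • fderiv ℝ G (x, K.mol (s k) u x) (0, (K.mol (s k) g x - g x) e)) := by
    filter_upwards [hst (Ioo_mem_nhdsGT hδ)] with k hk
    have hcd : ContDiff ℝ 1 fun x => (x, K.mol (s k) u x) :=
      contDiff_id.prodMk ((hmc k).of_le (by simp))
    have hGc : ContDiff ℝ 1 fun x => G (x, K.mol (s k) u x) := hG.comp hcd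
    rw [ibp_c1 hGc (hφ.of_le (by simp)) hc e]
    have i0 : Integrable fun x => φ x • fderiv ℝ (fun x => G (x, K.mol (s k) u x)) x e :=
      (hφ.continuous.smul ((hGc.continuous_fderiv (by simp)).clm_apply
        continuous_const)).integrable_of_hasCompactSupport hc.smul_right
    have i1 : Integrable fun x => φ x • fderiv ℝ G (x, K.mol (s k) u x) (e, g x e) :=
      bi.mono' (ml k) (ae_of_all _ (bl k))
    have hx : ∀ x, φ x • fderiv ℝ (fun x => G (x, K.mol (s k) u x)) x e
        = φ x • fderiv ℝ G (x, K.mol (s k) u x) (e, g x e) +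
          φ x • fderiv ℝ G (x, K.mol (s k) u x) (0, (K.mol (s k) g x - g x) e) := by
      intro x
      by_cases hx : x ∈ tsupport φ
      · rw [← smul_add, ← map_add]
        congr 1
        have hm := K.mol_grad H (hs k) (x := x) (fun y hy => hδU (mem_thickening_iff.2
          ⟨x, hx, (mem_ball.1 hy).trans hk.2⟩))
        have hd1 : HasFDerivAt (fun x => (x, K.mol (s k) u x))
            ((ContinuousLinearMap.id ℝ (Eu n)).prod (K.mol (s k) g x)) x := by
          rw [← hm]
          exact (hasFDerivAt_id x).prodMk ((hmc k).differentiable (by simp) x).hasFDerivAt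
        have hd2 := (hG.differentiable (by simp) (x, K.mol (s k) u x)).hasFDerivAt.comp x hd1
        rw [HasFDerivAt.fderiv (f := fun x => G (x, K.mol (s k) u x)) hd2]
        simp
      · simp [hz1 x hx]
    rw [← integral_add i1 ((i0.sub i1).congr (ae_of_all _ fun x => by
      simp only [Pi.sub_apply, hx x]; abel))]
    simp only [hx]
  have := tendsto_nhds_unique (L.congr' E) (R1.add R2).neg
  rw [this, add_zero]

/-- energy of a linear map -/
def en {n p : ℕ} (A : Eu n →L[ℝ] Eu p) : ℝ := ∑ i, ‖A (bv n i)‖ ^ 2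

theorem en_eq {n p : ℕ} (g : Eu n → (Eu n →L[ℝ] Eu p)) (x : Eu n) :
    energyDensity n p g x = en (g x) := by
  simp only [energyDensity, en, EuclideanSpace.norm_sq_eq, Real.norm_eq_abs, sq_abs]

theorem en_nonneg {n p : ℕ} (A : Eu n →L[ℝ] Eu p) : 0 ≤ en A := Finset.sum_nonneg fun _ _ => by positivity

theorem en_le {n p : ℕ} (A : Eu n →L[ℝ] Eu p) : en A ≤ n * ‖A‖ ^ 2 := by
  calc en A ≤ ∑ _i : Fin n, ‖A‖ ^ 2 := Finset.sum_le_sum fun i _ => by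
        have := A.le_opNorm (bv n i); simp at this; gcongr
    _ = _ := by simp

theorem eu_sum {n : ℕ} (v : Eu n) : v = ∑ i, v i • bv n i := by
  ext j; simp [Finset.sum_apply, Pi.single_apply]

theorem le_en {n p : ℕ} (A : Eu n →L[ℝ] Eu p) : ‖A‖ ^ 2 ≤ en A := by
  have h : ‖A‖ ≤ √(en A) := by
    refine A.opNorm_le_bound (Real.sqrt_nonneg _) fun v => ?_
    calc ‖A v‖ = ‖∑ i, v i • A (bv n i)‖ := by
          conv_lhs => rw [eu_sum v]
          simp
      _ ≤ ∑ i, |v i| * ‖A (bv n i)‖ := by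
          refine (norm_sum_le _ _).trans (le_of_eq ?_)
          simp [norm_smul]
      _ ≤ √(∑ i, |v i| ^ 2) * √(∑ i, ‖A (bv n i)‖ ^ 2) := Real.sum_mul_le_sqrt_mul_sqrt _ _ _
      _ = _ := by
          rw [mul_comm, en, EuclideanSpace.norm_eq]; simp
  calc ‖A‖ ^ 2 ≤ √(en A) ^ 2 := by gcongr
    _ = _ := Real.sq_sqrt (en_nonneg A)

theorem en_cont {n p : ℕ} : Continuous (en : (Eu n →L[ℝ] Eu p) → ℝ) := by
  unfold en; fun_prop

theorem test_facts {n : ℕ} {φ : Eu n → ℝ} (hφ : ContDiff ℝ ∞ φ) (hc : HasCompactSupport φ) (e : Eu n) :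
    Continuous (fun x => fderiv ℝ φ x e) ∧ HasCompactSupport (fun x => fderiv ℝ φ x e) ∧
    tsupport (fun x => fderiv ℝ φ x e) ⊆ tsupport φ ∧ (∀ x, x ∉ tsupport φ → φ x = 0) ∧
    (∀ x, x ∉ tsupport φ → fderiv ℝ φ x = 0) :=
  ⟨(hφ.continuous_fderiv (by simp)).clm_apply continuous_const, hc.fderiv_apply (𝕜 := ℝ) e,
    tsupport_fderiv_apply_subset ℝ e, fun x hx => image_eq_zero_of_notMem_tsupport hx,
    fun x hx => image_eq_zero_of_notMem_tsupport (fun h => hx (tsupport_fderiv_subset ℝ h))⟩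

theorem int_test {n : ℕ} {V : Type*} [NormedAddCommGroup V] [NormedSpace ℝ V] {Ω : Set (Eu n)}
    {h : Eu n → V} (hh : LocallyIntegrableOn h Ω) {ψ : Eu n → ℝ} (h1 : Continuous ψ)
    (h2 : HasCompactSupport ψ) (h3 : tsupport ψ ⊆ Ω) : Integrable fun x => ψ x • h x := by
  have h4 : IntegrableOn h (tsupport ψ) := hh.integrableOn_compact_subset h3 h2
  have h5 := bdd_smul_int h1 h2 ((integrable_indicator_iff (isClosed_tsupport ψ).measurableSet).2 h4)
  refine h5.congr (ae_of_all _ fun x => ?_)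
  by_cases hx : x ∈ tsupport ψ
  · simp [hx]
  · simp [image_eq_zero_of_notMem_tsupport hx]

theorem hwg_iff {n p : ℕ} {Ω : Set (Eu n)} (u : Eu n → Eu p)
    (g : Eu n → (Eu n →L[ℝ] Eu p)) : HasWeakGradient n p Ω u g ↔
    LocallyIntegrableOn u Ω ∧ LocallyIntegrableOn g Ω ∧
    ∀ φ : Eu n → ℝ, ContDiff ℝ ∞ φ → HasCompactSupport φ → tsupport φ ⊆ Ω → ∀ e,
    ∫ x, (fderiv ℝ φ x e) • u x = - ∫ x, φ x • g x e := by
  refine and_congr_right fun hu => and_congr_right fun hg => forall_congr' fun φ =>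
    forall_congr' fun hφ => forall_congr' fun hc => forall_congr' fun hs => ?_
  have key : ∀ i j, (∫ x in Ω, u x j * fderiv ℝ φ x (EuclideanSpace.single i 1) =
        - ∫ x in Ω, φ x * g x (EuclideanSpace.single i 1) j) ↔
        (∫ x, (fderiv ℝ φ x (bv n i)) • u x) j = (- ∫ x, φ x • g x (bv n i)) j := by
    intro i j
    obtain ⟨t1, t2, t3, t4, t5⟩ := test_facts hφ hc (bv n i)
    have i1 := int_test hu t1 t2 (t3.trans hs)
    have hg' : LocallyIntegrableOn (fun x => g x (bv n i)) Ω := fun x hx => by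
      obtain ⟨s, hs, hs'⟩ := hg x hx
      exact ⟨s, hs, hs'.apply_continuousLinearMap _⟩
    have i2 := int_test hg' hφ.continuous hc hs
    have e1 : (∫ x, (fderiv ℝ φ x (bv n i)) • u x) j = ∫ x, ((fderiv ℝ φ x (bv n i)) • u x) j :=
      (((EuclideanSpace.proj (𝕜 := ℝ) j : Eu p →L[ℝ] ℝ)).integral_comp_comm i1).symm
    have e2 : (∫ x, φ x • g x (bv n i)) j = ∫ x, (φ x • g x (bv n i)) j :=
      (((EuclideanSpace.proj (𝕜 := ℝ) j : Eu p →L[ℝ] ℝ)).integral_comp_comm i2).symm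
    rw [PiLp.neg_apply, e1, e2, setIntegral_eq_integral_of_forall_compl_eq_zero,
      setIntegral_eq_integral_of_forall_compl_eq_zero]
    · simp only [PiLp.smul_apply, smul_eq_mul, mul_comm]
    · intro x hx; rw [t4 x (fun h => hx (hs h)), zero_mul]
    · intro x hx; rw [t5 x (fun h => hx (hs h))]; simp
  simp only [key]
  constructor
  · intro h e
    have h' : ∀ i, ∫ x, (fderiv ℝ φ x (bv n i)) • u x = - ∫ x, φ x • g x (bv n i) := fun i => by
      ext j; exact h i j
    rw [eu_sum e]
    simp only [map_sum, map_smul, Finset.sum_smul, Finset.smul_sum, smul_assoc]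
    rw [integral_finsetSum, integral_finsetSum, ← Finset.sum_neg_distrib]
    · refine Finset.sum_congr rfl fun i _ => ?_
      simp only [smul_comm (φ _)]
      rw [integral_smul, integral_smul, h' i, smul_neg]
    · intro i _
      have hg' : LocallyIntegrableOn (fun x => e i • g x (bv n i)) Ω := fun x hx => by
        obtain ⟨s, hs, hs'⟩ := hg x hx
        exact ⟨s, hs, (hs'.apply_continuousLinearMap (bv n i)).smul (e i)⟩
      exact int_test hg' hφ.continuous hc hs
    · intro i _
      obtain ⟨t1, t2, t3, t4, t5⟩ := test_facts hφ hc (bv n i)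
      exact (int_test hu t1 t2 (t3.trans hs)).smul (e i)
  · intro h i j
    rw [h]

/-- localised data of a minimizer -/
structure LocMin {n p : ℕ} (y : Eu n) (R : ℝ) (u : Eu n → Eu p) (g : Eu n → (Eu n →L[ℝ] Eu p)) :
    Prop where
  W : WGI (ball y R) u g
  u1 : ∀ᵐ x, x ∈ ball y R → ‖u x‖ = 1
  ub : ∀ᵐ x, ‖u x‖ ≤ 1
  hu : MemLp u 2
  hg : MemLp g 2
  min : ∀ z ρ σ, 0 < σ → σ < ρ → closedBall z ρ ⊆ ball y R →
    ∀ (w : Eu n → Eu p) (h : Eu n → (Eu n →L[ℝ] Eu p)),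
      AEStronglyMeasurable w → AEStronglyMeasurable h →
      (∀ᵐ x, x ∈ ball z ρ → ‖w x‖ = 1) → (∀ x, x ∉ ball z σ → w x = u x ∧ h x = g x) →
      IntegrableOn (fun x => ‖h x‖ ^ 2) (ball z ρ) →
      (∀ φ : Eu n → ℝ, ContDiff ℝ ∞ φ → HasCompactSupport φ → tsupport φ ⊆ ball z ρ → ∀ e,
        ∫ x, (fderiv ℝ φ x e) • w x = - ∫ x, φ x • h x e) →
      ∫ x in ball z ρ, en (g x) ≤ ∫ x in ball z ρ, en (h x)

theorem sq_int_of_bdd {n : ℕ} {V : Type*} [NormedAddCommGroup V] {f : Eu n → V} {s : Set (Eu n)}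
    {E : Eu n → ℝ} (hE : IntegrableOn E s) (hf : AEStronglyMeasurable f (volume.restrict s))
    (h : ∀ x, ‖f x‖ ^ 2 ≤ E x) : IntegrableOn (fun x => ‖f x‖ ^ 2) s :=
  Integrable.mono' hE (hf.norm.pow 2) (ae_of_all _ fun x => by
    rw [Real.norm_of_nonneg (by positivity)]; exact h x)

theorem min_on {n p : ℕ} {Ω : Set (Eu n)} (hΩ : IsOpen Ω) {u : Eu n → Eu p}
    {g : Eu n → (Eu n →L[ℝ] Eu p)} (hm : IsEnergyMinimizingToSphere n p Ω u g) {z : Eu n}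
    {ρ σ : ℝ} (hσ : 0 < σ) (hσρ : σ < ρ) (hz : closedBall z ρ ⊆ Ω)
    (w : Eu n → Eu p) (h : Eu n → (Eu n →L[ℝ] Eu p))
    (mw : AEStronglyMeasurable w (volume.restrict (ball z ρ)))
    (mh : AEStronglyMeasurable h (volume.restrict (ball z ρ)))
    (w1 : ∀ᵐ x, x ∈ ball z ρ → ‖w x‖ = 1) (hwu : ∀ x, x ∉ ball z σ → w x = u x ∧ h x = g x)
    (hh : IntegrableOn (fun x => ‖h x‖ ^ 2) (ball z ρ))
    (ibp : ∀ φ : Eu n → ℝ, ContDiff ℝ ∞ φ → HasCompactSupport φ → tsupport φ ⊆ ball z ρ → ∀ e,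
        ∫ x, (fderiv ℝ φ x e) • w x = - ∫ x, φ x • h x e) :
    ∫ x in ball z ρ, en (g x) ≤ ∫ x in ball z ρ, en (h x) := by
  obtain ⟨hW, hE, hu1, hmin⟩ := hm
  rw [hwg_iff] at hW
  obtain ⟨lu, lg, hibp⟩ := hW
  have fin : volume (ball z ρ) ≠ ⊤ := measure_ball_lt_top.ne
  have iw : IntegrableOn w (ball z ρ) := by
    refine Integrable.mono' (g := fun _ => (1:ℝ)) (integrableOn_const fin) mw ?_
    filter_upwards [ae_restrict_of_ae w1, ae_restrict_mem measurableSet_ball] with x hx hx'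
    exact (hx hx').le
  have ih : IntegrableOn h (ball z ρ) := by
    have hb : IntegrableOn (fun x => (1:ℝ) + ‖h x‖ ^ 2) (ball z ρ) :=
      Integrable.add (integrableOn_const (C := (1:ℝ)) fin) hh
    refine Integrable.mono' hb mh ?_
    refine ae_of_all _ fun x => ?_
    nlinarith [sq_nonneg (‖h x‖ - 1)]
  -- gluing of local integrability
  have glue : ∀ {X : Type} [NormedAddCommGroup X] (a b : Eu n → X), LocallyIntegrableOn a Ω →
      IntegrableOn b (ball z ρ) → (∀ x, x ∉ ball z σ → b x = a x) → LocallyIntegrableOn b Ω := by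
    intro X _ a b ha hb hab
    rw [locallyIntegrableOn_iff hΩ.isLocallyClosed] at ha ⊢
    intro k hk hkc
    have h1 : IntegrableOn b (k \ ball z σ) :=
      ((ha k hk hkc).mono_set sdiff_subset).congr_fun (fun x hx => (hab x hx.2).symm)
        (hkc.measurableSet.diff measurableSet_ball)
    refine (h1.union hb).mono_set fun x hx => ?_
    by_cases hx' : x ∈ ball z ρ
    · exact Or.inr hx'
    · exact Or.inl ⟨hx, fun h => hx' (ball_subset_ball hσρ.le h)⟩
  have lw := glue u w lu iw fun x hx => (hwu x hx).1
  have lh := glue g h lg ih fun x hx => (hwu x hx).2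
  have := hmin z ρ (hσ.trans hσρ) hz w h ?_ ?_ ?_ ⟨σ, hσρ, ?_⟩
  · simpa only [en_eq] using this
  · rw [hwg_iff]
    refine ⟨lw, lh, fun φ hφ hc hs e => ?_⟩
    let ζ : ContDiffBump z := ⟨(2 * σ + ρ) / 3, (σ + 2 * ρ) / 3, by linarith, by linarith⟩
    have hζ : ContDiff ℝ ∞ ζ := ζ.contDiff
    let φ1 : Eu n → ℝ := fun x => ζ x * φ x
    let φ2 : Eu n → ℝ := fun x => (1 - ζ x) * φ x
    have d1 : ContDiff ℝ ∞ φ1 := hζ.mul hφ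
    have d2 : ContDiff ℝ ∞ φ2 := (contDiff_const.sub hζ).mul hφ
    have s1 : tsupport φ1 ⊆ tsupport φ := closure_mono fun x hx => by
      simp only [φ1, Function.mem_support] at hx ⊢; exact right_ne_zero_of_mul hx
    have s2 : tsupport φ2 ⊆ tsupport φ := closure_mono fun x hx => by
      simp only [φ2, Function.mem_support] at hx ⊢; exact right_ne_zero_of_mul hx
    have s3 : tsupport φ1 ⊆ ball z ρ := by
      refine (closure_mono (t := Function.support ζ) fun x hx => ?_).trans ?_
      · simp only [φ1, Function.mem_support] at hx ⊢; exact left_ne_zero_of_mul hx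
      · have := ζ.tsupport_eq
        rw [tsupport] at this
        rw [this]
        exact closedBall_subset_ball (by simp only [ζ]; linarith)
    have c1 : HasCompactSupport φ1 := hc.mul_left
    have c2 : HasCompactSupport φ2 := hc.mul_left
    have z2 : ∀ x ∈ ball z σ, φ2 x = 0 ∧ fderiv ℝ φ2 x = 0 := by
      intro x hx
      have : φ2 =ᶠ[𝓝 x] fun _ => 0 := by
        filter_upwards [isOpen_ball.mem_nhds hx] with x' hx'
        have : ζ x' = 1 := ζ.one_of_mem_closedBall (by
          rw [mem_ball] at hx'; rw [mem_closedBall]; simp only [ζ]; linarith)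
        simp [φ2, this]
      exact ⟨this.eq_of_nhds, by rw [this.fderiv_eq]; simp⟩
    have a1 := ibp φ1 d1 c1 s3 e
    have a2 := hibp φ2 d2 c2 (s2.trans hs) e
    have b1 : ∫ x, (fderiv ℝ φ2 x e) • u x = ∫ x, (fderiv ℝ φ2 x e) • w x := by
      congr 1; ext1 x
      by_cases hx : x ∈ ball z σ
      · simp [(z2 x hx).2]
      · rw [(hwu x hx).1]
    have b2 : ∫ x, φ2 x • g x e = ∫ x, φ2 x • h x e := by
      congr 1; ext1 x
      by_cases hx : x ∈ ball z σ
      · simp [(z2 x hx).1]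
      · rw [(hwu x hx).2]
    rw [b1, b2] at a2
    obtain ⟨t1, t2, t3, -, -⟩ := test_facts d1 c1 e
    obtain ⟨r1, r2, r3, -, -⟩ := test_facts d2 c2 e
    have lhe : LocallyIntegrableOn (fun x => h x e) Ω := fun x hx => by
      obtain ⟨s, hs, hs'⟩ := lh x hx
      exact ⟨s, hs, hs'.apply_continuousLinearMap _⟩
    have f1 : ∀ x, fderiv ℝ φ x e • w x = fderiv ℝ φ1 x e • w x + fderiv ℝ φ2 x e • w x := by
      intro x
      have : φ = φ1 + φ2 := by ext x; simp only [φ1, φ2, Pi.add_apply]; ring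
      conv_lhs => rw [this]
      rw [fderiv_add (d1.differentiable (by simp) x) (d2.differentiable (by simp) x), ← add_smul]; rfl
    have f2 : ∀ x, φ x • h x e = φ1 x • h x e + φ2 x • h x e := by
      intro x; rw [← add_smul]; congr 1; simp only [φ1, φ2]; ring
    simp only [f1, f2]
    rw [integral_add (int_test lw t1 t2 ((t3.trans s1).trans hs))
      (int_test lw r1 r2 ((r3.trans s2).trans hs)), a1, a2, integral_add
      (int_test lhe d1.continuous c1 (s1.trans hs)) (int_test lhe d2.continuous c2 (s2.trans hs))]
    abel
  · refine glue _ _ hE ?_ fun x hx => by simp only [en_eq, (hwu x hx).2]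
    refine Integrable.mono' (hh.const_mul (n:ℝ)) ?_ (ae_of_all _ fun x => ?_)
    · simp only [funext (en_eq h)]
      exact en_cont.comp_aestronglyMeasurable mh
    · rw [en_eq, Real.norm_of_nonneg (en_nonneg _)]; exact en_le _
  · rw [ae_restrict_iff' hΩ.measurableSet] at hu1 ⊢
    filter_upwards [hu1, w1] with x hx1 hx2 hx
    by_cases hx' : x ∈ ball z ρ
    · exact hx2 hx'
    · rw [(hwu x (fun h => hx' (ball_subset_ball hσρ.le h))).1]; exact hx1 hx
  · rw [ae_restrict_iff' (hΩ.measurableSet.diff measurableSet_ball)]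
    exact ae_of_all _ fun x hx => (hwu x hx.2).1

/-- truncation to a set -/
def cut {n : ℕ} {V : Type*} [NormedAddCommGroup V] (s : Set (Eu n)) (f : Eu n → V) : Eu n → V :=
  s.indicator f

theorem cut_mem {n : ℕ} {V : Type*} [NormedAddCommGroup V] {s : Set (Eu n)} {x : Eu n} (h : x ∈ s)
    (f : Eu n → V) : cut s f x = f x := indicator_of_mem h f

theorem cut_notMem {n : ℕ} {V : Type*} [NormedAddCommGroup V] {s : Set (Eu n)} {x : Eu n}
    (h : x ∉ s) (f : Eu n → V) : cut s f x = 0 := indicator_of_notMem h f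

theorem cut_int {n : ℕ} {V : Type*} [NormedAddCommGroup V] {s : Set (Eu n)} {f : Eu n → V}
    (h : IntegrableOn f s) (hs : MeasurableSet s) : Integrable (cut s f) := h.integrable_indicator hs

theorem cut_memLp {n : ℕ} {V : Type*} [NormedAddCommGroup V] {s : Set (Eu n)} {f : Eu n → V}
    {q : ℝ≥0∞} (hs : MeasurableSet s) (h : MemLp f q (volume.restrict s)) : MemLp (cut s f) q :=
  (memLp_indicator_iff_restrict hs).2 h

theorem locMin_of_aux {n p : ℕ} {Ω : Set (Eu n)} (hΩ : IsOpen Ω) {u : Eu n → Eu p}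
    {g : Eu n → (Eu n →L[ℝ] Eu p)} (hm' : IsEnergyMinimizingToSphere n p Ω u g) {y : Eu n}
    {R : ℝ} (hy : closedBall y R ⊆ Ω) : ∀ z ρ σ, 0 < σ → σ < ρ → closedBall z ρ ⊆ ball y R →
    ∀ (w : Eu n → Eu p) (h : Eu n → (Eu n →L[ℝ] Eu p)),
      AEStronglyMeasurable w → AEStronglyMeasurable h →
      (∀ᵐ x, x ∈ ball z ρ → ‖w x‖ = 1) → (∀ x, x ∉ ball z σ → w x = cut (closedBall y R) u x ∧
        h x = cut (closedBall y R) g x) →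
      IntegrableOn (fun x => ‖h x‖ ^ 2) (ball z ρ) →
      (∀ φ : Eu n → ℝ, ContDiff ℝ ∞ φ → HasCompactSupport φ → tsupport φ ⊆ ball z ρ → ∀ e,
        ∫ x, (fderiv ℝ φ x e) • w x = - ∫ x, φ x • h x e) →
      ∫ x in ball z ρ, en (cut (closedBall y R) g x) ≤ ∫ x in ball z ρ, en (h x) := by
  classical
  have sub : ball y R ⊆ closedBall y R := ball_subset_closedBall
  intro z ρ σ hσ hσρ hz w h mw mh w1 hwu hh ibp
  have hρ : ball z ρ ⊆ closedBall y R := (ball_subset_closedBall.trans hz).trans sub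
  have := min_on hΩ hm' hσ hσρ (hz.trans (sub.trans hy))
    (fun x => (ball z ρ).piecewise w u x) (fun x => (ball z ρ).piecewise h g x) ?_ ?_ ?_ ?_ ?_ ?_
  · calc _ = ∫ x in ball z ρ, en (g x) := setIntegral_congr_fun measurableSet_ball fun x hx => by
          simp only [cut_mem (hρ hx)]
      _ ≤ _ := this
      _ = _ := setIntegral_congr_fun measurableSet_ball fun x hx => by
          simp only [piecewise_eq_of_mem _ _ _ hx]
  · refine (mw.restrict (s := ball z ρ)).congr ?_
    filter_upwards [ae_restrict_mem measurableSet_ball] with x hx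
    rw [piecewise_eq_of_mem _ _ _ hx]
  · refine (mh.restrict (s := ball z ρ)).congr ?_
    filter_upwards [ae_restrict_mem measurableSet_ball] with x hx
    rw [piecewise_eq_of_mem _ _ _ hx]
  · filter_upwards [w1] with x hx h
    rw [piecewise_eq_of_mem _ _ _ h]; exact hx h
  · intro x hx
    by_cases hx' : x ∈ ball z ρ
    · rw [piecewise_eq_of_mem _ _ _ hx', piecewise_eq_of_mem _ _ _ hx']
      have := hwu x hx
      rw [cut_mem (hρ hx'), cut_mem (hρ hx')] at this
      exact this
    · rw [piecewise_eq_of_notMem _ _ _ hx', piecewise_eq_of_notMem _ _ _ hx']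
      exact ⟨rfl, rfl⟩
  · refine hh.congr_fun (fun x hx => ?_) measurableSet_ball
    simp only [piecewise_eq_of_mem _ _ _ hx]
  · intro φ hφ hc hs e
    obtain ⟨t1, t2, t3, t4, t5⟩ := test_facts hφ hc e
    convert ibp φ hφ hc hs e using 2
    · ext1 x
      by_cases hx : x ∈ ball z ρ
      · rw [piecewise_eq_of_mem _ _ _ hx]
      · rw [t5 x fun h => hx (hs h)]; simp
    · congr 1; ext1 x
      by_cases hx : x ∈ ball z ρ
      · rw [piecewise_eq_of_mem _ _ _ hx]
      · rw [t4 x fun h => hx (hs h)]; simp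

theorem locMin_of {n p : ℕ} {Ω : Set (Eu n)} (hΩ : IsOpen Ω) {u : Eu n → Eu p}
    {g : Eu n → (Eu n →L[ℝ] Eu p)} (hm : IsEnergyMinimizingToSphere n p Ω u g) {y : Eu n}
    {R : ℝ} (hy : closedBall y R ⊆ Ω) :
    LocMin y R (cut (closedBall y R) u) (cut (closedBall y R) g) := by
  have hm' := hm
  obtain ⟨hW, hE, hu1, hmin⟩ := hm
  rw [hwg_iff] at hW
  obtain ⟨lu, lg, hibp⟩ := hW
  have mB : MeasurableSet (closedBall y R) := measurableSet_closedBall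
  have cB : IsCompact (closedBall y R) := isCompact_closedBall y R
  have fin : volume (closedBall y R) ≠ ⊤ := measure_closedBall_lt_top.ne
  have iu := lu.integrableOn_compact_subset hy cB
  have ig := lg.integrableOn_compact_subset hy cB
  have iE := hE.integrableOn_compact_subset hy cB
  rw [ae_restrict_iff' hΩ.measurableSet] at hu1
  have ub : ∀ᵐ x, ‖cut (closedBall y R) u x‖ ≤ 1 := by
    filter_upwards [hu1] with x hx
    by_cases h : x ∈ closedBall y R
    · rw [cut_mem h, hx (hy h)]
    · rw [cut_notMem h]; simp
  have sub : ball y R ⊆ closedBall y R := ball_subset_closedBall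
  have W : WGI (ball y R) (cut (closedBall y R) u) (cut (closedBall y R) g) := by
    refine ⟨cut_int iu mB, cut_int ig mB, ?_⟩
    intro φ hφ hc hs e
    obtain ⟨t1, t2, t3, t4, t5⟩ := test_facts hφ hc e
    have := hibp φ hφ hc (hs.trans (sub.trans hy)) e
    convert this using 2
    · ext1 x
      by_cases hx : x ∈ closedBall y R
      · rw [cut_mem hx]
      · rw [t5 x fun h => hx (sub (hs h))]; simp
    · congr 1; ext1 x
      by_cases hx : x ∈ closedBall y R
      · rw [cut_mem hx]
      · rw [t4 x fun h => hx (sub (hs h))]; simp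
  have A1 : ∀ᵐ x, x ∈ ball y R → ‖cut (closedBall y R) u x‖ = 1 := by
    filter_upwards [hu1] with x hx h
    rw [cut_mem (sub h), hx (hy (sub h))]
  have A2 : MemLp (cut (closedBall y R) u) 2 := by
    refine cut_memLp mB ?_
    have : IsFiniteMeasure (volume.restrict (closedBall y R)) := ⟨by simpa using fin.lt_top⟩
    refine MemLp.of_bound iu.1 1 ?_
    rw [ae_restrict_iff' mB]
    filter_upwards [hu1] with x hx h
    exact (hx (hy h)).le
  have A3 : MemLp (cut (closedBall y R) g) 2 := by
    refine cut_memLp mB ?_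
    rw [memLp_two_iff_integrable_sq_norm ig.1]
    exact sq_int_of_bdd iE ig.1 fun x => by rw [en_eq]; exact le_en _
  exact ⟨W, A1, ub, A2, A3, locMin_of_aux hΩ hm' hy⟩

/-- derivative of a composition `G (x, u x)` -/
def dG {n : ℕ} {V W : Type*} [NormedAddCommGroup V] [NormedSpace ℝ V] [NormedAddCommGroup W]
    [NormedSpace ℝ W] (G : Eu n × V → W) (u : Eu n → V) (g : Eu n → (Eu n →L[ℝ] V)) (x : Eu n) :
    Eu n →L[ℝ] W :=
  (fderiv ℝ G (x, u x)).comp ((ContinuousLinearMap.id ℝ (Eu n)).prod (g x))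

theorem dG_meas {n : ℕ} {V W : Type*} [NormedAddCommGroup V] [NormedSpace ℝ V] [NormedAddCommGroup W]
    [NormedSpace ℝ W] {G : Eu n × V → W} (hG : ContDiff ℝ 1 G) {u : Eu n → V}
    {g : Eu n → (Eu n →L[ℝ] V)} {μ : Measure (Eu n)} (hu : AEStronglyMeasurable u μ) (hg : AEStronglyMeasurable g μ) :
    AEStronglyMeasurable (fun x => G (x, u x)) μ ∧ AEStronglyMeasurable (dG G u g) μ := by
  have h1 : AEStronglyMeasurable (fun x => (x, u x)) μ :=
    (continuous_id.aestronglyMeasurable).prodMk hu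
  refine ⟨hG.continuous.comp_aestronglyMeasurable h1, ?_⟩
  have h2 := (hG.continuous_fderiv (by simp)).comp_aestronglyMeasurable h1
  have h3 : AEStronglyMeasurable (fun x => (ContinuousLinearMap.id ℝ (Eu n)).prod (g x)) μ := by
    have : Continuous fun L : Eu n →L[ℝ] V => (ContinuousLinearMap.id ℝ (Eu n)).prod L :=
      ((ContinuousLinearMap.prodₗᵢ ℝ).continuous).comp (continuous_const.prodMk continuous_id)
    exact this.comp_aestronglyMeasurable hg
  exact (isBoundedBilinearMap_comp (𝕜 := ℝ)).continuous.comp_aestronglyMeasurable (h2.prodMk h3)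

theorem fd_bound {n p : ℕ} {W : Type*} [NormedAddCommGroup W] [NormedSpace ℝ W]
    {G : Eu n × Eu p → W} (hG : ContDiff ℝ 1 G) (z : Eu n) (ρ : ℝ) :
    ∃ C, 0 ≤ C ∧ ∀ x ∈ closedBall z ρ, ∀ v : Eu p, ‖v‖ ≤ 1 → ‖fderiv ℝ G (x, v)‖ ≤ C := by
  have hc : IsCompact (closedBall z ρ ×ˢ closedBall (0 : Eu p) 1) :=
    (isCompact_closedBall _ _).prod (isCompact_closedBall _ _)
  obtain ⟨C, hC⟩ := hc.exists_bound_of_continuousOn (hG.continuous_fderiv (by simp)).continuousOn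
  refine ⟨max C 0, le_max_right _ _, fun x hx v hv => (hC (x, v) ⟨hx, ?_⟩).trans (le_max_left _ _)⟩
  simpa using hv

theorem dG_norm {n : ℕ} {V W : Type*} [NormedAddCommGroup V] [NormedSpace ℝ V] [NormedAddCommGroup W]
    [NormedSpace ℝ W] {G : Eu n × V → W} {u : Eu n → V} {g : Eu n → (Eu n →L[ℝ] V)} {x : Eu n}
    {C : ℝ} (hC : 0 ≤ C) (h : ‖fderiv ℝ G (x, u x)‖ ≤ C) : ‖dG G u g x‖ ≤ C * (1 + ‖g x‖) := by
  refine (ContinuousLinearMap.opNorm_comp_le _ _).trans ?_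
  refine mul_le_mul h ?_ (norm_nonneg _) hC
  rw [ContinuousLinearMap.opNorm_prod, Prod.norm_def]
  refine max_le ?_ ?_
  · exact (ContinuousLinearMap.norm_id_le).trans (by simp)
  · simp

theorem LocMin.ug {n p : ℕ} (K : Kern n) {y : Eu n} {R : ℝ} {u : Eu n → Eu p}
    {g : Eu n → (Eu n →L[ℝ] Eu p)} (H : LocMin y R u g) :
    ∀ᵐ x, x ∈ ball y R → ∀ e, inner ℝ (u x) (g x e) = 0 := by
  have key : ∀ i : Fin n, ∀ᵐ x, x ∈ ball y R → inner ℝ (u x) (g x (bv n i)) = 0 := by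
    intro i
    have hm : Integrable (fun x => (inner ℝ (u x) (g x (bv n i)) : ℝ)) :=
      (H.W.ig.apply_continuousLinearMap (bv n i)).norm.mono'
        (H.W.iu.1.inner (H.W.ig.1.apply_continuousLinearMap _)) (by
          filter_upwards [H.ub] with x hx
          exact (norm_inner_le_norm _ _).trans (mul_le_of_le_one_left (norm_nonneg _) hx))
    refine isOpen_ball.ae_eq_zero_of_integral_contDiff_smul_eq_zero
      (hm.locallyIntegrable.locallyIntegrableOn _) fun φ hφ hc hs => ?_
    have hG : ContDiff ℝ 1 (fun q : Eu n × Eu p => (inner ℝ q.2 q.2 : ℝ)) :=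
      contDiff_snd.inner ℝ contDiff_snd
    have c1 := chain K isOpen_ball H.W H.hu H.hg H.ub hG hφ hc hs (bv n i)
    have c2 := chain K isOpen_ball H.W H.hu H.hg H.ub
      (contDiff_const (c := (1:ℝ)) : ContDiff ℝ 1 (fun q : Eu n × Eu p => (1:ℝ))) hφ hc hs (bv n i)
    have e1 : ∫ x, (fderiv ℝ φ x (bv n i)) • (inner ℝ (u x) (u x) : ℝ) =
        ∫ x, (fderiv ℝ φ x (bv n i)) • (1:ℝ) := by
      refine integral_congr_ae ?_
      filter_upwards [H.u1] with x hx
      by_cases h : x ∈ tsupport φ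
      · rw [real_inner_self_eq_norm_sq, hx (hs h)]; simp
      · rw [(test_facts hφ hc (bv n i)).2.2.2.2 x h]; simp
    have fd : ∀ q : Eu n × Eu p, ∀ d, fderiv ℝ (fun q : Eu n × Eu p => (inner ℝ q.2 q.2 : ℝ)) q d =
        2 * inner ℝ q.2 d.2 := by
      intro q d
      have := (hasFDerivAt_snd (𝕜 := ℝ) (p := q)).inner ℝ (hasFDerivAt_snd (𝕜 := ℝ) (p := q))
      rw [this.fderiv]
      simp [real_inner_comm]; ring
    simp only [fd] at c1
    rw [e1, c2] at c1
    simp only [fderiv_fun_const, smul_eq_mul] at c1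
    have : ∫ x, φ x * (2 * inner ℝ (u x) (g x (bv n i))) =
        2 * ∫ x, φ x • (inner ℝ (u x) (g x (bv n i)) : ℝ) := by
      rw [← integral_const_mul]; congr 1; ext1 x; rw [smul_eq_mul]; ring
    rw [this] at c1
    simp at c1
    simpa using c1
  filter_upwards [ae_all_iff.2 key] with x hx hb e
  rw [eu_sum e]
  simp only [map_sum, map_smul, inner_sum, inner_smul_right, hx _ hb, mul_zero, Finset.sum_const_zero]

section rot
variable {p : ℕ} (A : Eu p →L[ℝ] Eu p)

/-- rotation -/
def rot (τ : ℝ) (v : Eu p) : Eu p := v + Real.sin τ • A v + (1 - Real.cos τ) • A (A v)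

variable {A} (sk : ∀ v w, inner ℝ (A v) w = - (inner ℝ v (A w) : ℝ)) (cu : ∀ v, A (A (A v)) = - A v)
include sk cu

theorem rot_norm (τ : ℝ) (v : Eu p) : ‖rot A τ v‖ = ‖v‖ := by
  have h1 : inner ℝ v (A v) = (0:ℝ) := by
    have := sk v v; rw [real_inner_comm] at this; linarith
  have h2 : inner ℝ v (A (A v)) = - (inner ℝ (A v) (A v) : ℝ) := by rw [sk v (A v)]; ring
  have h3 : inner ℝ (A v) (A (A v)) = (0:ℝ) := by
    have := sk (A v) (A v); rw [real_inner_comm] at this; linarith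
  have h4 : inner ℝ (A (A v)) (A (A v)) = (inner ℝ (A v) (A v) : ℝ) := by
    rw [sk (A v) (A (A v)), cu, inner_neg_right]; ring
  have h5 : inner ℝ (rot A τ v) (rot A τ v) = (inner ℝ v v : ℝ) := by
    simp only [rot, inner_add_left, inner_add_right, inner_smul_left, inner_smul_right, h4,
      real_inner_comm v (A v), real_inner_comm v (A (A v)), real_inner_comm (A v) (A (A v)), h1, h2, h3]
    simp only [real_inner_comm v, real_inner_comm (A v), h1, h2, h3, conj_trivial]
    have := Real.sin_sq_add_cos_sq τ
    linear_combination (inner ℝ (A v) (A v) : ℝ) * this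
  rw [real_inner_self_eq_norm_sq, real_inner_self_eq_norm_sq] at h5
  exact (pow_left_inj₀ (norm_nonneg _) (norm_nonneg _) two_ne_zero).1 h5

omit sk in
theorem rot_fd {n : ℕ} {a : Eu n × Eu p → ℝ} (ha : ContDiff ℝ 1 a) (t : ℝ) :
    ContDiff ℝ 1 (fun q : Eu n × Eu p => rot A (t * a q) q.2) ∧
    ∀ q d, fderiv ℝ (fun q : Eu n × Eu p => rot A (t * a q) q.2) q d =
      rot A (t * a q) (d.2 + (t * fderiv ℝ a q d) • A q.2) := by
  constructor
  · unfold rot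
    have h1 : ContDiff ℝ 1 (fun q : Eu n × Eu p => A q.2) := A.contDiff.comp contDiff_snd
    have h2 : ContDiff ℝ 1 (fun q : Eu n × Eu p => A (A q.2)) := A.contDiff.comp h1
    have h3 : ContDiff ℝ 1 (fun q => t * a q) := contDiff_const.mul ha
    exact (contDiff_snd.add ((Real.contDiff_sin.comp h3).smul h1)).add
      ((contDiff_const.sub (Real.contDiff_cos.comp h3)).smul h2)
  · intro q d
    have h0 : HasFDerivAt (fun q => t * a q) (t • fderiv ℝ a q) q :=
      ((ha.differentiable (by simp)) q).hasFDerivAt.const_mul t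
    have h1 : HasFDerivAt (fun q : Eu n × Eu p => A q.2) (A.comp (ContinuousLinearMap.snd ℝ _ _)) q :=
      A.hasFDerivAt.comp q hasFDerivAt_snd
    have h2 : HasFDerivAt (fun q : Eu n × Eu p => A (A q.2))
      (A.comp (A.comp (ContinuousLinearMap.snd ℝ _ _))) q := A.hasFDerivAt.comp q h1
    have h := ((hasFDerivAt_snd (𝕜 := ℝ) (p := q)).add (h0.sin.smul h1)).add ((h0.cos.const_sub 1).smul h2)
    have h' : HasFDerivAt (fun q : Eu n × Eu p => rot A (t * a q) q.2) _ q := h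
    rw [h'.fderiv]
    simp only [rot, map_add, map_smul, cu]
    simp
    module
end rot

theorem iadd {α V : Type*} [MeasurableSpace α] [NormedAddCommGroup V] {μ : Measure α} {f g : α → V}
    (hf : Integrable f μ) (hg : Integrable g μ) : Integrable (fun x => f x + g x) μ := hf.add hg

theorem quad_zero {I J : ℝ} (h : ∀ t : ℝ, 0 ≤ 2 * t * I + t ^ 2 * J) : I = 0 := by
  have hJ := h
  by_contra hI
  have hJ' : 0 ≤ |J| + 1 := by positivity
  have := h (-I / (|J| + 1))
  have e : 2 * (-I / (|J| + 1)) * I + (-I / (|J| + 1)) ^ 2 * J =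
    I ^ 2 / (|J| + 1) ^ 2 * (J - 2 * (|J| + 1)) := by
    field_simp; ring
  rw [e] at this
  have h1 : 0 < I ^ 2 / (|J| + 1) ^ 2 := by positivity
  have h2 : J - 2 * (|J| + 1) < 0 := by have := le_abs_self J; have := abs_nonneg J; linarith
  nlinarith

theorem LocMin.en_int {n p : ℕ} {y : Eu n} {R : ℝ} {u : Eu n → Eu p}
    {g : Eu n → (Eu n →L[ℝ] Eu p)} (H : LocMin y R u g) : Integrable fun x => en (g x) := by
  refine Integrable.mono' ((memLp_two_iff_integrable_sq_norm H.W.ig.1).1 H.hg |>.const_mul (n:ℝ))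
    (en_cont.comp_aestronglyMeasurable H.W.ig.1) (ae_of_all _ fun x => ?_)
  rw [Real.norm_of_nonneg (en_nonneg _)]; exact en_le _

theorem LocMin.vary {n p : ℕ} (K : Kern n) {y : Eu n} {R : ℝ} {u : Eu n → Eu p}
    {g : Eu n → (Eu n →L[ℝ] Eu p)} (H : LocMin y R u g) {A : Eu p →L[ℝ] Eu p}
    (sk : ∀ v w, inner ℝ (A v) w = - (inner ℝ v (A w) : ℝ)) (cu : ∀ v, A (A (A v)) = - A v)
    {a : Eu n × Eu p → ℝ} (ha : ContDiff ℝ 1 a) {σ ρ : ℝ} (hσ : 0 < σ) (hσρ : σ < ρ) (hρ : ρ < R)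
    (h0 : ∀ x, x ∉ closedBall y σ → ∀ v, a (x, v) = 0) :
    IntegrableOn (fun x => ∑ i, fderiv ℝ a (x, u x) (bv n i, g x (bv n i)) *
      (inner ℝ (A (u x)) (g x (bv n i)) : ℝ)) (ball y ρ) ∧
    ∫ x in ball y ρ, ∑ i, fderiv ℝ a (x, u x) (bv n i, g x (bv n i)) *
      (inner ℝ (A (u x)) (g x (bv n i)) : ℝ) = 0 := by
  obtain ⟨C, hC, hCb⟩ := fd_bound ha y ρ
  have mB : MeasurableSet (ball y ρ) := measurableSet_ball
  have fin : volume (ball y ρ) ≠ ⊤ := measure_ball_lt_top.ne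
  have g2 : Integrable (fun x => ‖g x‖ ^ 2) := (memLp_two_iff_integrable_sq_norm H.W.ig.1).1 H.hg
  have dom : IntegrableOn (fun x => (1:ℝ) + ‖g x‖ ^ 2) (ball y ρ) :=
    Integrable.add (integrableOn_const (C := (1:ℝ)) fin) g2.integrableOn
  have ub := ae_restrict_of_ae (s := ball y ρ) H.ub
  have mem := ae_restrict_mem mB (μ := volume)
  obtain ⟨mD0, mD⟩ := dG_meas ha H.W.iu.1 H.W.ig.1
  have mDi : ∀ i, AEStronglyMeasurable (fun x => fderiv ℝ a (x, u x) (bv n i, g x (bv n i))) :=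
    fun i => mD.apply_continuousLinearMap (bv n i)
  have mgi : ∀ i, AEStronglyMeasurable (fun x => g x (bv n i)) :=
    fun i => H.W.ig.1.apply_continuousLinearMap (bv n i)
  have mAu : AEStronglyMeasurable (fun x => A (u x)) := A.continuous.comp_aestronglyMeasurable H.W.iu.1
  have bD : ∀ᵐ x ∂(volume.restrict (ball y ρ)), ∀ i,
      |fderiv ℝ a (x, u x) (bv n i, g x (bv n i))| ≤ C * (1 + ‖g x‖) := by
    filter_upwards [ub, mem] with x hx hm i
    have := dG_norm (g := g) hC (hCb x (ball_subset_closedBall hm) (u x) hx)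
    refine ((dG a u g x).le_opNorm (bv n i)).trans ?_
    simpa using this
  have bg : ∀ x i, ‖g x (bv n i)‖ ≤ ‖g x‖ := fun x i => by
    simpa using (g x).le_opNorm (bv n i)
  have bA : ∀ᵐ x ∂(volume.restrict (ball y ρ)), ‖A (u x)‖ ≤ ‖A‖ := by
    filter_upwards [ub] with x hx
    exact (A.le_opNorm _).trans (mul_le_of_le_one_right (norm_nonneg _) hx)
  have iI : IntegrableOn (fun x => ∑ i, fderiv ℝ a (x, u x) (bv n i, g x (bv n i)) *
      (inner ℝ (A (u x)) (g x (bv n i)) : ℝ)) (ball y ρ) := by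
    refine integrable_finsetSum _ fun i _ => ?_
    refine Integrable.mono' (dom.const_mul (2 * C * ‖A‖))
      ((mDi i).mul (mAu.inner (mgi i))).restrict ?_
    filter_upwards [bD, bA] with x h1 h2
    rw [norm_mul]
    have h3 : ‖(inner ℝ (A (u x)) (g x (bv n i)) : ℝ)‖ ≤ ‖A‖ * ‖g x‖ :=
      (norm_inner_le_norm _ _).trans (mul_le_mul h2 (bg x i) (norm_nonneg _) (norm_nonneg _))
    calc _ ≤ (C * (1 + ‖g x‖)) * (‖A‖ * ‖g x‖) := mul_le_mul (h1 i) h3 (norm_nonneg _) (by positivity)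
      _ = C * ‖A‖ * (‖g x‖ + ‖g x‖ ^ 2) := by ring
      _ ≤ C * ‖A‖ * (2 * (1 + ‖g x‖ ^ 2)) := by
        refine mul_le_mul_of_nonneg_left ?_ (by positivity)
        nlinarith [sq_nonneg (‖g x‖ - 1)]
      _ = _ := by ring
  have iJ : IntegrableOn (fun x => ∑ i, (fderiv ℝ a (x, u x) (bv n i, g x (bv n i))) ^ 2 *
      ‖A (u x)‖ ^ 2) (ball y ρ) := by
    refine integrable_finsetSum _ fun i _ => ?_
    refine Integrable.mono' (dom.const_mul (2 * C ^ 2 * ‖A‖ ^ 2))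
      (((mDi i).pow 2).mul (mAu.norm.pow 2)).restrict ?_
    filter_upwards [bD, bA] with x h1 h2
    rw [norm_mul, norm_pow, norm_pow, norm_norm, Real.norm_eq_abs]
    calc _ ≤ (C * (1 + ‖g x‖)) ^ 2 * ‖A‖ ^ 2 := by gcongr; exact h1 i
      _ = C ^ 2 * ‖A‖ ^ 2 * (1 + ‖g x‖) ^ 2 := by ring
      _ ≤ C ^ 2 * ‖A‖ ^ 2 * (2 * (1 + ‖g x‖ ^ 2)) := by
        refine mul_le_mul_of_nonneg_left ?_ (by positivity)
        nlinarith [sq_nonneg (‖g x‖ - 1)]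
      _ = _ := by ring
  refine ⟨iI, ?_⟩
  refine quad_zero (J := ∫ x in ball y ρ, ∑ i, (fderiv ℝ a (x, u x) (bv n i, g x (bv n i))) ^ 2 *
      ‖A (u x)‖ ^ 2) fun t => ?_
  obtain ⟨Gs, Gd⟩ := rot_fd (A := A) cu ha t
  obtain ⟨G, hG⟩ : ∃ G : Eu n × Eu p → Eu p, G = fun q => rot A (t * a q) q.2 := ⟨_, rfl⟩
  rw [← hG] at Gs Gd
  obtain ⟨m1, m2⟩ := dG_meas Gs H.W.iu.1 H.W.ig.1
  have enh : ∀ x, en (dG G u g x) = en (g x) + (2 * t * ∑ i, fderiv ℝ a (x, u x) (bv n i, g x (bv n i)) *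
      (inner ℝ (A (u x)) (g x (bv n i)) : ℝ) + t ^ 2 *
        ∑ i, (fderiv ℝ a (x, u x) (bv n i, g x (bv n i))) ^ 2 * ‖A (u x)‖ ^ 2) := by
    intro x
    simp only [en, Finset.mul_sum, ← Finset.sum_add_distrib]
    refine Finset.sum_congr rfl fun i _ => ?_
    have : dG G u g x (bv n i) = fderiv ℝ G (x, u x) (bv n i, g x (bv n i)) := rfl
    rw [this, Gd, rot_norm sk cu, norm_add_sq_real, inner_smul_right, norm_smul, mul_pow,
      Real.norm_eq_abs, sq_abs, real_inner_comm]
    ring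
  have zz : ∀ x, x ∉ ball y ((σ + ρ) / 2) → ∀ v, a (x, v) = 0 ∧ fderiv ℝ a (x, v) = 0 := by
    intro x hx v
    have : a =ᶠ[𝓝 (x, v)] fun _ => 0 := by
      have ho : IsOpen {q : Eu n × Eu p | q.1 ∉ closedBall y σ} :=
        (isClosed_closedBall.isOpen_compl).preimage continuous_fst
      filter_upwards [ho.mem_nhds (show (x, v) ∈ {q : Eu n × Eu p | q.1 ∉ closedBall y σ} from by
        simp only [mem_ofPred_eq, mem_closedBall, mem_ball] at hx ⊢; linarith)] with q hq
      exact h0 q.1 hq q.2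
    exact ⟨this.eq_of_nhds, by rw [this.fderiv_eq]; simp⟩
  have := H.min y ρ ((σ + ρ) / 2) (by linarith) (by linarith) (closedBall_subset_ball hρ)
    (fun x => G (x, u x)) (dG G u g) m1 m2 ?_ ?_ ?_ ?_
  · simp only [enh] at this
    rw [integral_add H.en_int.integrableOn (iadd (iI.const_mul _) (iJ.const_mul _)),
      integral_add (iI.const_mul _) (iJ.const_mul _), integral_const_mul, integral_const_mul] at this
    linarith
  · filter_upwards [H.u1] with x hx hb
    rw [hG]; simp only
    rw [rot_norm sk cu]
    exact hx (ball_subset_ball hρ.le hb)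
  · intro x hx
    obtain ⟨z1, z2⟩ := zz x hx (u x)
    constructor
    · rw [hG]; simp [rot, z1]
    · ext1 e
      have : dG G u g x e = fderiv ℝ G (x, u x) (e, g x e) := rfl
      rw [this, Gd, z1, z2]
      simp [rot]
  · refine Integrable.mono' (g := fun x => en (dG G u g x)) ?_ (m2.norm.pow 2).restrict
      (ae_of_all _ fun x => by rw [Real.norm_of_nonneg (by positivity)]; exact le_en _)
    simp only [enh]
    exact iadd H.en_int.integrableOn (iadd (iI.const_mul _) (iJ.const_mul _))
  · intro φ hφ hc hs e
    exact chain K isOpen_ball H.W H.hu H.hg H.ub Gs hφ hc (hs.trans (ball_subset_ball hρ.le)) e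

/-- Laplacian -/
def lap {n : ℕ} (φ : Eu n → ℝ) (x : Eu n) : ℝ :=
  ∑ i, fderiv ℝ (fun z => fderiv ℝ φ z (bv n i)) x (bv n i)

/-- elementary skew map -/
def skw {p : ℕ} (k j : Fin p) : Eu p →L[ℝ] Eu p :=
  (EuclideanSpace.proj k).smulRight (bv p j) - (EuclideanSpace.proj j).smulRight (bv p k)

theorem skw_apply {p : ℕ} (k j : Fin p) (v : Eu p) : skw k j v = v k • bv p j - v j • bv p k := rfl

theorem skw_inner {p : ℕ} (k j : Fin p) (v w : Eu p) :
    (inner ℝ (skw k j v) w : ℝ) = v k * w j - v j * w k := by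
  rw [skw_apply, inner_sub_left, inner_smul_left, inner_smul_left]
  simp [EuclideanSpace.inner_single_left]

theorem skw_sk {p : ℕ} (k j : Fin p) (v w : Eu p) :
    inner ℝ (skw k j v) w = - (inner ℝ v (skw k j w) : ℝ) := by
  rw [skw_inner, real_inner_comm, skw_inner]; ring

theorem skw_cu {p : ℕ} (k j : Fin p) (v : Eu p) :
    skw k j (skw k j (skw k j v)) = - skw k j v := by
  by_cases h : k = j
  · subst h; simp [skw_apply]
  · have h' : j ≠ k := fun e => h e.symm
    simp [skw_apply, h, h']
    module

theorem sum_facts {p : ℕ} (v w : Eu p) : ∑ k, v k * w k = inner ℝ v w ∧ ∑ k, v k ^ 2 = ‖v‖ ^ 2 := by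
  constructor
  · simp [PiLp.inner_apply, mul_comm]
  · rw [EuclideanSpace.norm_sq_eq]; simp

theorem LocMin.pde1 {n p : ℕ} (K : Kern n) {y : Eu n} {R : ℝ} (hR : 0 < R) {u : Eu n → Eu p}
    {g : Eu n → (Eu n →L[ℝ] Eu p)} (H : LocMin y R u g) {φ : Eu n → ℝ} (hφ : ContDiff ℝ ∞ φ)
    (hc : HasCompactSupport φ) (hs : tsupport φ ⊆ ball y R) (j : Fin p) :
    ∫ x, ((∑ i, fderiv ℝ φ x (bv n i) * g x (bv n i) j) - φ x * en (g x) * u x j) = 0 := by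
  obtain ⟨σ, ⟨hσ, hσR⟩, hs'⟩ := exists_pos_lt_subset_ball hR hc.isClosed hs
  have key : ∀ k : Fin p, _ := fun k => H.vary K (skw_sk k j) (skw_cu k j)
    (a := fun q => φ q.1 * q.2 k)
    ((hφ.of_le (by simp)).comp contDiff_fst |>.mul
      ((EuclideanSpace.proj (𝕜 := ℝ) k).contDiff.comp contDiff_snd)) hσ
    (show σ < (σ + R) / 2 by linarith) (by linarith) (fun x hx v => by
      have : φ x = 0 := image_eq_zero_of_notMem_tsupport fun h => hx (ball_subset_closedBall (hs' h))
      simp [this])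
  have fd : ∀ (k : Fin p) (q d : Eu n × Eu p), fderiv ℝ (fun q : Eu n × Eu p => φ q.1 * q.2 k) q d =
      fderiv ℝ φ q.1 d.1 * q.2 k + φ q.1 * d.2 k := by
    intro k q d
    have h1 : HasFDerivAt (fun q : Eu n × Eu p => φ q.1)
        ((fderiv ℝ φ q.1).comp (ContinuousLinearMap.fst ℝ _ _)) q :=
      ((hφ.differentiable (by simp)) q.1).hasFDerivAt.comp q hasFDerivAt_fst
    have h2 : HasFDerivAt (fun q : Eu n × Eu p => q.2 k)
        ((EuclideanSpace.proj (𝕜 := ℝ) k).comp (ContinuousLinearMap.snd ℝ _ _)) q :=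
      (EuclideanSpace.proj (𝕜 := ℝ) k).hasFDerivAt.comp q hasFDerivAt_snd
    rw [show fderiv ℝ (fun q : Eu n × Eu p => φ q.1 * q.2 k) q = _ from (h1.mul h2).fderiv]
    simp; ring
  simp only [fd, skw_inner] at key
  have k2 := integral_finsetSum (μ := volume.restrict (ball y ((σ + R) / 2))) Finset.univ
    fun k _ => (key k).1
  simp only [fun k => (key k).2, Finset.sum_const_zero] at k2
  rw [← k2, ← setIntegral_eq_integral_of_forall_compl_eq_zero (s := ball y ((σ + R) / 2))]
  · refine setIntegral_congr_ae measurableSet_ball ?_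
    filter_upwards [H.u1, H.ug K] with x h1 h2 hx
    have hx' := ball_subset_ball (show (σ + R) / 2 ≤ R by linarith) hx
    have e1 := (sum_facts (u x) (u x)).2
    rw [h1 hx'] at e1
    rw [Finset.sum_comm, en, Finset.mul_sum, Finset.sum_mul, ← Finset.sum_sub_distrib]
    refine Finset.sum_congr rfl fun i _ => ?_
    have e2 := (sum_facts (u x) (g x (bv n i))).1
    rw [h2 hx'] at e2
    have e3 := (sum_facts (g x (bv n i)) (u x)).2
    have : ∀ k, (fderiv ℝ φ x (bv n i) * u x k + φ x * g x (bv n i) k) *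
        (u x k * g x (bv n i) j - u x j * g x (bv n i) k) =
        fderiv ℝ φ x (bv n i) * g x (bv n i) j * u x k ^ 2 + (φ x * g x (bv n i) j -
        fderiv ℝ φ x (bv n i) * u x j) * (u x k * g x (bv n i) k) - φ x * u x j * g x (bv n i) k ^ 2 := by
      intro k; ring
    simp only [this, Finset.sum_sub_distrib, Finset.sum_add_distrib, ← Finset.mul_sum, e1, e2, e3]
    ring
  · intro x hx
    have hx' : x ∉ tsupport φ := fun h => hx (ball_subset_ball (by linarith) (hs' h))
    obtain ⟨t1, t2, t3, t4, t5⟩ := test_facts hφ hc 0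
    simp [t4 x hx', t5 x hx']

theorem pi_int {n p : ℕ} {f : Eu n → Eu p} (hf : Integrable f) (j : Fin p) : 
    (∫ x, f x) j = ∫ x, f x j :=
  ((EuclideanSpace.proj (𝕜 := ℝ) j).integral_comp_comm hf).symm

theorem lap_test {n : ℕ} {φ : Eu n → ℝ} (hφ : ContDiff ℝ ∞ φ)
    (hc : HasCompactSupport φ) (i : Fin n) : ContDiff ℝ ∞ (fun x => fderiv ℝ φ x (bv n i)) :=
  (hφ.fderiv_right (m := ∞) (by simp)).clm_apply contDiff_const

theorem lap_ibp {n : ℕ} {V : Type*} [NormedAddCommGroup V] [NormedSpace ℝ V]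
    {U : Set (Eu n)} {u : Eu n → V} {g : Eu n → (Eu n →L[ℝ] V)} (H : WGI U u g)
    {φ : Eu n → ℝ} (hφ : ContDiff ℝ ∞ φ) (hc : HasCompactSupport φ) (hs : tsupport φ ⊆ U) :
    ∫ x, lap φ x • u x = - ∑ i, ∫ x, (fderiv ℝ φ x (bv n i)) • g x (bv n i) := by
  simp only [lap, Finset.sum_smul]
  rw [integral_finsetSum, ← Finset.sum_neg_distrib]
  · refine Finset.sum_congr rfl fun i _ => ?_
    obtain ⟨t1, t2, t3, t4, t5⟩ := test_facts hφ hc (bv n i)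
    exact H.ibp _ (lap_test hφ hc i) t2 (t3.trans hs) (bv n i)
  · intro i _
    obtain ⟨t1, t2, t3, t4, t5⟩ := test_facts hφ hc (bv n i)
    obtain ⟨r1, r2, -⟩ := test_facts (lap_test hφ hc i) t2 (bv n i)
    exact bdd_smul_int r1 r2 H.iu

theorem LocMin.eu_int {n p : ℕ} {y : Eu n} {R : ℝ} {u : Eu n → Eu p}
    {g : Eu n → (Eu n →L[ℝ] Eu p)} (H : LocMin y R u g) : Integrable fun x => en (g x) • u x := by
  refine H.en_int.mono' (H.en_int.1.smul H.W.iu.1) ?_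
  filter_upwards [H.ub] with x hx
  rw [norm_smul, Real.norm_of_nonneg (en_nonneg _)]
  exact mul_le_of_le_one_right (en_nonneg _) hx

theorem LocMin.pde {n p : ℕ} (K : Kern n) {y : Eu n} {R : ℝ} (hR : 0 < R) {u : Eu n → Eu p}
    {g : Eu n → (Eu n →L[ℝ] Eu p)} (H : LocMin y R u g) {φ : Eu n → ℝ} (hφ : ContDiff ℝ ∞ φ)
    (hc : HasCompactSupport φ) (hs : tsupport φ ⊆ ball y R) :
    ∫ x, lap φ x • u x = - ∫ x, φ x • en (g x) • u x := by
  rw [lap_ibp H.W hφ hc hs, neg_inj]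
  have i1 : ∀ i, Integrable fun x => (fderiv ℝ φ x (bv n i)) • g x (bv n i) := fun i => by
    obtain ⟨t1, t2, t3, t4, t5⟩ := test_facts hφ hc (bv n i)
    exact bdd_smul_int t1 t2 (H.W.ig.apply_continuousLinearMap _)
  have i2 := bdd_smul_int hφ.continuous hc H.eu_int
  ext j
  rw [← integral_finsetSum _ fun i _ => i1 i, pi_int (integrable_finsetSum _ fun i _ => i1 i), pi_int i2,
    ← sub_eq_zero, ← integral_sub]
  · rw [← H.pde1 K hR hφ hc hs j]
    congr 1; ext1 x
    simp; ring
  · exact (EuclideanSpace.proj (𝕜 := ℝ) j).integrable_comp (integrable_finsetSum _ fun i _ => i1 i)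
  · exact (EuclideanSpace.proj (𝕜 := ℝ) j).integrable_comp i2

namespace Kern
variable {n : ℕ} (K : Kern n)

/-- scaled potential -/
def psi (s : ℝ) (x y : Eu n) : ℝ := K.Ψ (s⁻¹ • (x - y))

/-- Laplacian of the potential -/
def LP (w : Eu n) : ℝ := - n * K.η w - fderiv ℝ K.η w w

theorem psi_test {s : ℝ} (hs : 0 < s) (x : Eu n) :
    ContDiff ℝ ∞ (K.psi s x) ∧ HasCompactSupport (K.psi s x) ∧ tsupport (K.psi s x) ⊆ ball x s := by
  have h : tsupport (K.psi s x) ⊆ closedBall x (3 / 4 * s) ∧ HasCompactSupport (K.psi s x) := by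
    refine cs_of_zero fun y hy => K.Ψ_zero _ ?_
    rw [norm_smul, norm_inv, Real.norm_of_nonneg hs.le, inv_mul_eq_div, le_div_iff₀ hs]
    exact hy
  refine ⟨K.Ψ_smooth.comp (show ContDiff ℝ ∞ (fun y : Eu n => s⁻¹ • (x - y)) from
      (contDiff_const.sub contDiff_id).const_smul _), h.2,
    h.1.trans (closedBall_subset_ball (by linarith))⟩

theorem psi_fd (s : ℝ) (x y e : Eu n) :
    fderiv ℝ (K.psi s x) y e = - s⁻¹ * fderiv ℝ K.Ψ (s⁻¹ • (x - y)) e := by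
  have h1 : HasFDerivAt (fun y : Eu n => s⁻¹ • (x - y)) (s⁻¹ • (-ContinuousLinearMap.id ℝ (Eu n))) y :=
    ((hasFDerivAt_id y).const_sub x).const_smul s⁻¹
  have h2 : HasFDerivAt (K.psi s x) _ y :=
    ((K.Ψ_smooth.differentiable (by simp)) (s⁻¹ • (x - y))).hasFDerivAt.comp y h1
  rw [h2.fderiv]
  simp

theorem lap_psi (s : ℝ) (x y : Eu n) :
    lap (K.psi s x) y = s⁻¹ ^ 2 * K.LP (s⁻¹ • (x - y)) := by
  unfold lap
  simp only [K.psi_fd, K.rel]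
  have key : ∀ i, fderiv ℝ (fun z => -s⁻¹ * (-K.η (s⁻¹ • (x - z)) * inner ℝ (s⁻¹ • (x - z)) (bv n i))) y
      (bv n i) = s⁻¹ ^ 2 * (- fderiv ℝ K.η (s⁻¹ • (x - y)) ((s⁻¹ • (x - y)) i • bv n i)
        - K.η (s⁻¹ • (x - y))) := by
    intro i
    have h1 : HasFDerivAt (fun y : Eu n => s⁻¹ • (x - y)) (s⁻¹ • (-ContinuousLinearMap.id ℝ (Eu n))) y :=
      ((hasFDerivAt_id y).const_sub x).const_smul s⁻¹
    have h2 : HasFDerivAt (fun y => K.η (s⁻¹ • (x - y))) _ y :=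
      ((K.η_smooth.differentiable (by simp)) (s⁻¹ • (x - y))).hasFDerivAt.comp y h1
    have h3 := h1.inner ℝ (hasFDerivAt_const (bv n i) y)
    have h4 := ((h2.fun_neg.fun_mul h3).const_mul (-s⁻¹)).fderiv
    rw [h4]
    simp [EuclideanSpace.inner_single_right]
    ring
  simp only [key]
  rw [← Finset.mul_sum, Finset.sum_sub_distrib, Finset.sum_neg_distrib, ← map_sum, ← eu_sum, LP]
  simp; left; ring

theorem LP_bound : ∃ C, 0 ≤ C ∧ ∀ w, |K.LP w| ≤ C := by
  have h : Continuous K.LP := (continuous_const.mul K.η_smooth.continuous).sub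
    ((K.η_smooth.continuous_fderiv (by simp)).clm_apply continuous_id)
  have hc : HasCompactSupport K.LP := by
    refine HasCompactSupport.intro K.η_cs (fun x hx => ?_)
    have h1 : K.η x = 0 := image_eq_zero_of_notMem_tsupport hx
    have h2 : fderiv ℝ K.η x = 0 := image_eq_zero_of_notMem_tsupport fun h =>
      hx (tsupport_fderiv_subset ℝ h)
    simp [LP, h1, h2]
  obtain ⟨C, hC⟩ := h.bounded_above_of_compact_support hc
  exact ⟨C, (norm_nonneg _).trans (hC 0), hC⟩

theorem ks_deriv {s : ℝ} (hs : 0 < s) (w : Eu n) :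
    HasDerivAt (fun s => K.ks s w) ((s ^ n)⁻¹ * s⁻¹ * K.LP (s⁻¹ • w)) s := by
  have h1 : HasDerivAt (fun s : ℝ => (s ^ n)⁻¹) (- (n * ((s ^ n)⁻¹ * s⁻¹))) s := by
    have := (hasDerivAt_pow n s).inv (pow_ne_zero n hs.ne')
    refine HasDerivAt.congr_deriv this ?_
    rcases n with - | m
    · simp
    · simp only [Nat.add_sub_cancel, pow_succ]
      field_simp
  have h2 : HasDerivAt (fun s : ℝ => s⁻¹ • w) ((-(s ^ 2)⁻¹) • w) s := (hasDerivAt_inv hs.ne').smul_const w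
  have h3 : HasDerivAt (fun s : ℝ => K.η (s⁻¹ • w)) (fderiv ℝ K.η (s⁻¹ • w) ((-(s ^ 2)⁻¹) • w)) s :=
    ((K.η_smooth.differentiable (by simp)) (s⁻¹ • w)).hasFDerivAt.comp_hasDerivAt s h2
  refine HasDerivAt.congr_deriv (h1.mul h3) ?_
  simp only [LP, map_smul, smul_eq_mul]
  have : (s ^ 2)⁻¹ = s⁻¹ * s⁻¹ := by rw [sq, mul_inv]
  rw [this]; ring

variable {V : Type*} [NormedAddCommGroup V] [NormedSpace ℝ V]

theorem mol_deriv {s : ℝ} (hs : 0 < s) {h : Eu n → V} (hh : Integrable h) (x : Eu n) :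
    HasDerivAt (fun s => K.mol s h x) (((s ^ n)⁻¹ * s) • ∫ y, lap (K.psi s x) y • h y) s := by
  obtain ⟨C, hC, hCb⟩ := K.LP_bound
  have meas : ∀ s, 0 < s → AEStronglyMeasurable (fun y => K.ks s (x - y) • h y) := fun s hs =>
    (bdd_smul_int (K.ks_test hs x).1.continuous (K.ks_test hs x).2.1 hh).1
  have hcLP : Continuous K.LP := (continuous_const.mul K.η_smooth.continuous).sub
    ((K.η_smooth.continuous_fderiv (by simp)).clm_apply continuous_id)
  have := (hasDerivAt_integral_of_dominated_loc_of_deriv_le (μ := volume) (x₀ := s)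
    (F := fun s y => K.ks s (x - y) • h y)
    (F' := fun s y => ((s ^ n)⁻¹ * s⁻¹ * K.LP (s⁻¹ • (x - y))) • h y)
    (bound := fun y => (((s / 2) ^ n)⁻¹ * (s / 2)⁻¹ * C) * ‖h y‖) (s := Ioi (s / 2))
    (Ioi_mem_nhds (by linarith)) ?_ ?_ ?_ ?_ ?_ ?_).2
  · refine HasDerivAt.congr_deriv this ?_
    rw [← integral_smul]
    congr 1; ext1 y
    rw [lap_psi, smul_smul]
    congr 1
    field_simp
  · filter_upwards [Ioi_mem_nhds hs] with t ht using meas t ht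
  · exact bdd_smul_int (K.ks_test hs x).1.continuous (K.ks_test hs x).2.1 hh
  · refine Continuous.aestronglyMeasurable ?_ |>.smul hh.1
    fun_prop
  · refine ae_of_all _ fun y t ht => ?_
    have ht' : s / 2 < t := ht
    have hs2 : 0 < s / 2 := by linarith
    have ht0 : 0 < t := hs2.trans ht'
    rw [norm_smul, norm_mul, norm_mul, Real.norm_of_nonneg (by positivity), Real.norm_of_nonneg (by positivity)]
    refine mul_le_mul_of_nonneg_right ?_ (norm_nonneg _)
    refine mul_le_mul ?_ (hCb _) (norm_nonneg _) (by positivity)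
    gcongr
  · exact hh.norm.const_mul _
  · refine ae_of_all _ fun y t ht => ?_
    have ht' : s / 2 < t := ht
    exact (K.ks_deriv (by linarith) (x - y)).smul_const (h y)

end Kern

theorem moment_aux {p : ℕ} (hp : 3 ≤ p) : ∃ C : ℝ≥0, ∀ w : Eu p, ‖w‖ ≤ 1 →
    ∫⁻ a in ball (0 : Eu p) (1/2), (‖w - a‖ₑ ^ 2)⁻¹ ≤ C := by
  have hne : Nontrivial (Eu p) := by
    have : Nonempty (Fin p) := ⟨⟨0, by omega⟩⟩
    infer_instance
  have h1 : IntegrableOn (fun b : Eu p => (‖b‖ ^ 2)⁻¹) (ball 0 2) := by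
    rw [integrableOn_fun_norm_addHaar volume (f := fun y => (y ^ 2)⁻¹)]
    have : IntegrableOn (fun y : ℝ => y ^ (p - 3)) (Ioo 0 2) :=
      ((continuous_pow _).integrableOn_Icc (a := 0) (b := 2)).mono_set Ioo_subset_Icc_self
    refine this.congr_fun (fun y hy => ?_) measurableSet_Ioo
    have e : Module.finrank ℝ (Eu p) - 1 = (p - 3) + 2 := by simp; omega
    have := hy.1.ne'
    simp only [e, smul_eq_mul]
    rw [pow_add, mul_assoc, mul_inv_cancel₀ (pow_ne_zero 2 this), mul_one]
  have h2 : ∫⁻ b in ball (0 : Eu p) 2, (‖b‖ₑ ^ 2)⁻¹ ≠ ⊤ := by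
    have := h1.2.ne
    rw [show (∫⁻ b in ball (0 : Eu p) 2, (‖b‖ₑ ^ 2)⁻¹) = ∫⁻ b in ball (0 : Eu p) 2, ‖(‖b‖ ^ 2)⁻¹‖ₑ from ?_]
    · exact this
    refine lintegral_congr_ae (ae_restrict_of_ae ?_)
    filter_upwards [compl_mem_ae_iff.2 (measure_singleton (0 : Eu p))] with b hb
    have : b ≠ 0 := hb
    rw [enorm_inv (by simpa using this), enorm_pow, enorm_norm]
  refine ⟨(∫⁻ b in ball (0 : Eu p) 2, (‖b‖ₑ ^ 2)⁻¹).toNNReal, fun w hw => ?_⟩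
  rw [ENNReal.coe_toNNReal h2]
  rw [← lintegral_indicator measurableSet_ball, ← lintegral_indicator measurableSet_ball,
    ← lintegral_sub_left_eq_self _ w]
  refine lintegral_mono fun a => ?_
  by_cases ha : w - a ∈ ball (0 : Eu p) (1/2)
  · rw [indicator_of_mem ha, indicator_of_mem]
    · simp
    · rw [mem_ball_zero_iff] at ha ⊢
      calc ‖a‖ = ‖w - (w - a)‖ := by simp
        _ ≤ ‖w‖ + ‖w - a‖ := norm_sub_le _ _
        _ < 2 := by linarith
  · rw [indicator_of_notMem ha]; exact zero_le

theorem moment {p : ℕ} (hp : 3 ≤ p) : ∃ C : ℝ≥0, ∀ (n : ℕ) (μ : Measure (Eu n)) [IsFiniteMeasure μ]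
    (w : Eu n → Eu p) (F : Eu n → ℝ≥0∞), AEStronglyMeasurable w μ → AEMeasurable F μ →
    (∀ᵐ x ∂μ, ‖w x‖ ≤ 1) → ∃ a : Eu p, ‖a‖ < 1/2 ∧ (∀ᵐ x ∂μ, w x ≠ a) ∧
      ∫⁻ x, (‖w x - a‖ₑ ^ 2)⁻¹ * F x ∂μ ≤ C * ∫⁻ x, F x ∂μ := by
  obtain ⟨C, hC⟩ := moment_aux hp
  have v0 : volume (ball (0 : Eu p) (1/2)) ≠ 0 := (measure_ball_pos _ _ (by norm_num)).ne'
  have v1 : volume (ball (0 : Eu p) (1/2)) ≠ ⊤ := measure_ball_lt_top.ne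
  obtain ⟨v, hv⟩ : ∃ v, v = volume (ball (0 : Eu p) (1/2)) := ⟨_, rfl⟩
  refine ⟨(v⁻¹ * C).toNNReal, fun n μ _ w F hw hF hb => ?_⟩
  have hvC : v⁻¹ * C ≠ ⊤ := ENNReal.mul_ne_top (ENNReal.inv_ne_top.2 (hv ▸ v0)) (by simp)
  rw [ENNReal.coe_toNNReal hvC]
  obtain ⟨m, hm⟩ : ∃ m, m = (volume : Measure (Eu p)).restrict (ball (0 : Eu p) (1/2)) := ⟨_, rfl⟩
  have fm : IsFiniteMeasure m := ⟨by rw [hm]; simpa using v1.lt_top⟩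
  have meas : ∀ F : Eu n → ℝ≥0∞, AEMeasurable F μ →
      AEMeasurable (fun q : Eu p × Eu n => (‖w q.2 - q.1‖ₑ ^ 2)⁻¹ * F q.2) (m.prod μ) := by
    intro F hF
    have h1 : AEStronglyMeasurable (fun q : Eu p × Eu n => w q.2 - q.1) (m.prod μ) :=
      hw.comp_snd.sub measurable_fst.aestronglyMeasurable
    exact ((h1.enorm.pow_const 2).inv).mul hF.comp_snd
  have tot : ∀ F : Eu n → ℝ≥0∞, AEMeasurable F μ →
      ∫⁻ a, ∫⁻ x, (‖w x - a‖ₑ ^ 2)⁻¹ * F x ∂μ ∂m ≤ C * ∫⁻ x, F x ∂μ := by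
    intro F hF
    rw [lintegral_lintegral_swap (meas F hF), ← lintegral_const_mul'' _ hF]
    refine lintegral_mono_ae ?_
    filter_upwards [hb] with x hx
    have : Measurable fun a : Eu p => (‖w x - a‖ₑ ^ 2)⁻¹ := by fun_prop
    rw [lintegral_mul_const _ this]
    exact mul_le_mul_left (by rw [hm]; exact hC _ hx) _
  have t1 := tot (fun _ => 1) aemeasurable_const
  have t1' : ∀ᵐ a ∂m, ∀ᵐ x ∂μ, w x ≠ a := by
    have f1 := ae_lt_top' (meas (fun _ => 1) aemeasurable_const).lintegral_prod_right'
      (t1.trans_lt (ENNReal.mul_lt_top (by simp) (by simp))).ne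
    filter_upwards [f1, Measure.ae_ae_of_ae_prod (ae_of_all (m.prod μ) fun _ => trivial)] with a ha _
    have hma : AEMeasurable (fun x => (‖w x - a‖ₑ ^ 2)⁻¹ * (1:ℝ≥0∞)) μ :=
      (((hw.sub aestronglyMeasurable_const).enorm.pow_const 2).inv).mul aemeasurable_const
    filter_upwards [ae_lt_top' hma ha.ne] with x hx he
    rw [he] at hx; simp at hx
  have ma : ∀ᵐ a ∂m, a ∈ ball (0 : Eu p) (1/2) := by rw [hm]; exact ae_restrict_mem measurableSet_ball
  have m0 : m ≠ 0 := by
    intro h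
    have : m univ = 0 := by rw [h]; simp
    rw [hm, Measure.restrict_apply_univ] at this; exact v0 this
  obtain ⟨a, ha, hle⟩ := exists_notMem_null_le_laverage m0 (meas F hF).lintegral_prod_right'
    (ae_iff.1 (ma.and t1'))
  simp only [mem_ofPred_eq, not_not] at ha
  refine ⟨a, by simpa using ha.1, ha.2, hle.trans ?_⟩
  rw [laverage_eq, ENNReal.div_eq_inv_mul, mul_assoc]
  have : m univ = v := by rw [hm, hv]; simp
  rw [this]
  exact mul_le_mul_right (tot F hF) _

/-- radius factor -/
def lam {p : ℕ} (a v : Eu p) : ℝ := - inner ℝ a v + √((inner ℝ a v : ℝ) ^ 2 + 1 - ‖a‖ ^ 2)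
/-- regularised normalisation -/
def nrm {p : ℕ} (a : Eu p) (q : ℝ × Eu p) : Eu p := (√(‖q.2 - a‖ ^ 2 + q.1 ^ 2))⁻¹ • (q.2 - a)
/-- regularised projection from the interior point `a` to the sphere -/
def retr {p : ℕ} (a : Eu p) (q : ℝ × Eu p) : Eu p := a + lam a (nrm a q) • nrm a q

theorem lam_pos {p : ℕ} {a : Eu p} (ha : ‖a‖ < 1/2) (v : Eu p) :
    0 < (inner ℝ a v : ℝ) ^ 2 + 1 - ‖a‖ ^ 2 := by
  nlinarith [norm_nonneg a, sq_nonneg (inner ℝ a v : ℝ)]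

theorem retr_smooth {p : ℕ} {a : Eu p} (ha : ‖a‖ < 1/2) {q : ℝ × Eu p}
    (hq : 0 < ‖q.2 - a‖ ^ 2 + q.1 ^ 2) : ContDiffAt ℝ 1 (retr a) q := by
  have h1 : ContDiffAt ℝ 1 (fun q : ℝ × Eu p => ‖q.2 - a‖ ^ 2 + q.1 ^ 2) q :=
    ContDiffAt.add ((contDiff_norm_sq ℝ).contDiffAt.comp q (contDiffAt_snd.sub contDiffAt_const))
      (contDiffAt_fst.pow 2)
  have h2 : ContDiffAt ℝ 1 (nrm a) q :=
    ((h1.sqrt hq.ne').inv (Real.sqrt_pos.2 hq).ne').smul (contDiffAt_snd.sub contDiffAt_const)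
  have h3 : ContDiffAt ℝ 1 (fun q => (inner ℝ a (nrm a q) : ℝ)) q := contDiffAt_const.inner ℝ h2
  have h4 : ContDiffAt ℝ 1 (fun q => lam a (nrm a q)) q := by
    refine ContDiffAt.add h3.neg (ContDiffAt.sqrt (((h3.pow 2).add contDiffAt_const).sub
      contDiffAt_const) (lam_pos ha _).ne')
  exact contDiffAt_const.add (h4.smul h2)

theorem nrm_le {p : ℕ} (a : Eu p) (q : ℝ × Eu p) : ‖nrm a q‖ ≤ 1 := by
  rw [nrm, norm_smul, norm_inv, Real.norm_eq_abs, abs_of_nonneg (Real.sqrt_nonneg _),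
    inv_mul_eq_div]
  refine div_le_one_of_le₀ (Real.le_sqrt_of_sq_le ?_) (Real.sqrt_nonneg _)
  nlinarith [sq_nonneg q.1]

theorem lam_le {p : ℕ} {a : Eu p} (ha : ‖a‖ < 1/2) {v : Eu p} (hv : ‖v‖ ≤ 1) : |lam a v| ≤ 2 := by
  have h1 : |(inner ℝ a v : ℝ)| ≤ 1/2 := by
    have := abs_real_inner_le_norm a v
    nlinarith [norm_nonneg a, norm_nonneg v]
  have h2 : √((inner ℝ a v : ℝ) ^ 2 + 1 - ‖a‖ ^ 2) ≤ 3/2 := by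
    rw [Real.sqrt_le_left (by norm_num)]
    nlinarith [abs_le.1 h1, sq_nonneg ‖a‖, sq_abs (inner ℝ a v : ℝ)]
  have := Real.sqrt_nonneg ((inner ℝ a v : ℝ) ^ 2 + 1 - ‖a‖ ^ 2)
  rw [lam, abs_le]; constructor <;> linarith [abs_le.1 h1]

theorem retr_le {p : ℕ} {a : Eu p} (ha : ‖a‖ < 1/2) (q : ℝ × Eu p) : ‖retr a q‖ ≤ 3 := by
  refine (norm_add_le _ _).trans ?_
  rw [norm_smul, Real.norm_eq_abs]
  nlinarith [lam_le ha (nrm_le a q), nrm_le a q, norm_nonneg (nrm a q), abs_nonneg (lam a (nrm a q))]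

theorem nrm_one {p : ℕ} {a w : Eu p} (h : w ≠ a) : ‖nrm a (0, w)‖ = 1 ∧
    nrm a (0, w) = ‖w - a‖⁻¹ • (w - a) := by
  have e : nrm a (0, w) = ‖w - a‖⁻¹ • (w - a) := by simp [nrm]
  refine ⟨?_, e⟩
  rw [e, norm_smul, norm_inv, norm_norm, inv_mul_cancel₀ (norm_ne_zero_iff.2 (sub_ne_zero.2 h))]

theorem retr_norm {p : ℕ} {a : Eu p} (ha : ‖a‖ < 1/2) {w : Eu p} (h : w ≠ a) :
    ‖retr a (0, w)‖ = 1 := by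
  obtain ⟨h1, -⟩ := nrm_one h
  have : ‖retr a (0, w)‖ ^ 2 = 1 := by
    rw [retr, norm_add_sq_real, inner_smul_right, norm_smul, mul_pow, h1, Real.norm_eq_abs, sq_abs,
      lam]
    nlinarith [Real.sq_sqrt (lam_pos ha (nrm a (0, w))).le]
  nlinarith [norm_nonneg (retr a (0, w))]

theorem retr_id {p : ℕ} {a : Eu p} (ha : ‖a‖ < 1/2) {w : Eu p} (h : ‖w‖ = 1) :
    retr a (0, w) = w := by
  have hne : w ≠ a := by rintro rfl; linarith
  have hr : 0 < ‖w - a‖ := norm_pos_iff.2 (sub_ne_zero.2 hne)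
  obtain ⟨h1, h2⟩ := nrm_one hne
  have e1 : ‖w - a‖ ^ 2 = 1 - 2 * inner ℝ a w + ‖a‖ ^ 2 := by
    rw [norm_sub_sq_real, h, real_inner_comm]; ring
  have e2 : (inner ℝ a (nrm a (0, w)) : ℝ) = ‖w - a‖⁻¹ * (inner ℝ a w - ‖a‖ ^ 2) := by
    rw [h2, inner_smul_right, inner_sub_right, real_inner_self_eq_norm_sq]
  have e3 : (inner ℝ a w : ℝ) ≤ 1/2 := by
    have := real_inner_le_norm a w
    rw [h] at this; linarith
  have e4 : lam a (nrm a (0, w)) = ‖w - a‖ := by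
    have : √((inner ℝ a (nrm a (0, w)) : ℝ) ^ 2 + 1 - ‖a‖ ^ 2) = ‖w - a‖⁻¹ * (1 - inner ℝ a w) := by
      rw [Real.sqrt_eq_iff_mul_self_eq (lam_pos ha _).le
        (mul_nonneg (inv_nonneg.2 hr.le) (by linarith)), e2]
      field_simp
      rw [e1]; ring
    rw [lam, this, e2]
    field_simp
    rw [e1]; ring
  rw [retr, e4, h2, smul_smul, mul_inv_cancel₀ hr.ne', one_smul]; abel

theorem retr_d {p : ℕ} {a : Eu p} (ha : ‖a‖ < 1/2) {q : ℝ × Eu p}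
    (hq : 0 < ‖q.2 - a‖ ^ 2 + q.1 ^ 2) (k : Eu p) :
    ‖fderiv ℝ (retr a) q (0, k)‖ * ‖q.2 - a‖ ≤ 6 * ‖k‖ := by
  obtain ⟨δ, w⟩ := q
  simp only at hq ⊢
  have hf := ((retr_smooth (q := (δ, w)) ha hq).differentiableAt (by norm_num)).hasFDerivAt
  have hc : HasDerivAt (fun t : ℝ => (δ, w + t • k)) (0, k) 0 := by
    have : HasDerivAt (fun t : ℝ => w + t • k) k 0 := by
      simpa using ((hasDerivAt_id (0:ℝ)).smul_const k).const_add w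
    exact (hasDerivAt_const _ _).prodMk this
  have d0 : HasDerivAt (fun t : ℝ => retr a (δ, w + t • k)) (fderiv ℝ (retr a) (δ, w) (0, k)) 0 := by
    have : HasFDerivAt (retr a) (fderiv ℝ (retr a) (δ, w)) (δ, w + (0:ℝ) • k) := by simpa using hf
    exact this.comp_hasDerivAt (0:ℝ) hc
  obtain ⟨r, hr⟩ : ∃ r, r = √(‖w - a‖ ^ 2 + δ ^ 2) := ⟨_, rfl⟩
  have r0 : 0 < r := hr ▸ Real.sqrt_pos.2 hq
  have ry : ‖w - a‖ ≤ r := by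
    rw [hr]; refine Real.le_sqrt_of_sq_le ?_; nlinarith [sq_nonneg δ]
  have dy : HasDerivAt (fun t : ℝ => w + t • k - a) k 0 := by
    simpa using (((hasDerivAt_id (0:ℝ)).smul_const k).const_add w).sub_const a
  have dn : ∃ m : Eu p, ‖m‖ * r ≤ 2 * ‖k‖ ∧ HasDerivAt (fun t : ℝ => nrm a (δ, w + t • k)) m 0 := by
    have h1 : HasDerivAt (fun t : ℝ => √(‖w + t • k - a‖ ^ 2 + δ ^ 2))
        ((2 * inner ℝ (w - a) k) / (2 * r)) 0 := by
      have := (dy.norm_sq.add_const (δ ^ 2)).sqrt (by simpa using hq.ne')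
      simpa [hr] using this
    have h2 : HasDerivAt (fun t : ℝ => (√(‖w + t • k - a‖ ^ 2 + δ ^ 2))⁻¹ • (w + t • k - a))
        (r⁻¹ • k + (-(2 * inner ℝ (w - a) k / (2 * r)) / r ^ 2) • (w - a)) 0 := by
      have := (h1.fun_inv (by simpa [← hr] using r0.ne')).fun_smul dy
      simpa only [zero_smul, add_zero, ← hr] using this
    refine ⟨r⁻¹ • k + (-(2 * inner ℝ (w - a) k / (2 * r)) / r ^ 2) • (w - a), ?_, by
      simpa only [nrm] using h2⟩
    have b1 : ‖(r⁻¹ • k : Eu p)‖ * r = ‖k‖ := by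
      rw [norm_smul, norm_inv, Real.norm_eq_abs, abs_of_pos r0]; field_simp
    have b2 : ‖(-(2 * inner ℝ (w - a) k / (2 * r)) / r ^ 2) • (w - a)‖ * r ≤ ‖k‖ := by
      have : ‖(-(2 * inner ℝ (w - a) k / (2 * r)) / r ^ 2) • (w - a)‖ * r
          = |(inner ℝ (w - a) k : ℝ)| * ‖w - a‖ / r ^ 2 := by
        rw [norm_smul, Real.norm_eq_abs, abs_div, abs_neg, abs_div, abs_mul, abs_mul, abs_of_pos r0,
          abs_of_pos (pow_pos r0 2)]; field_simp
      rw [this, div_le_iff₀ (by positivity)]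
      have := abs_real_inner_le_norm (w - a) k
      calc _ ≤ ‖w - a‖ * ‖k‖ * ‖w - a‖ := by gcongr
        _ ≤ r * ‖k‖ * r := by gcongr
        _ = _ := by ring
    have := norm_add_le (r⁻¹ • k : Eu p) ((-(2 * inner ℝ (w - a) k / (2 * r)) / r ^ 2) • (w - a))
    nlinarith
  obtain ⟨m, hm, dm⟩ := dn
  obtain ⟨v, hv⟩ : ∃ v, v = nrm a (δ, w) := ⟨_, rfl⟩
  have hv1 : ‖v‖ ≤ 1 := hv ▸ nrm_le a _
  have di : HasDerivAt (fun t : ℝ => (inner ℝ a (nrm a (δ, w + t • k)) : ℝ)) (inner ℝ a m) 0 := by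
    simpa using (hasDerivAt_const (0:ℝ) a).inner ℝ dm
  obtain ⟨S, hS⟩ : ∃ S, S = √((inner ℝ a v : ℝ) ^ 2 + 1 - ‖a‖ ^ 2) := ⟨_, rfl⟩
  have S0 : 0 < S := hS ▸ Real.sqrt_pos.2 (lam_pos ha v)
  have Sle : |(inner ℝ a v : ℝ)| ≤ S := by
    rw [hS]; refine Real.le_sqrt_of_sq_le ?_; rw [sq_abs]; nlinarith [norm_nonneg a]
  have dl : HasDerivAt (fun t : ℝ => lam a (nrm a (δ, w + t • k)))
      (- inner ℝ a m + (2 * inner ℝ a v * inner ℝ a m) / (2 * S)) 0 := by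
    have := (((di.fun_pow 2).add_const 1).sub_const (‖a‖^2)).sqrt (by
      simpa using (lam_pos ha _).ne')
    refine (di.fun_neg.fun_add this).congr_deriv ?_
    simp [← hv, hS]
  have dF := (dl.fun_smul dm).const_add a
  have := d0.unique dF
  rw [this]
  simp only [zero_smul, add_zero, ← hv]
  have c1 : |(inner ℝ a m : ℝ)| ≤ 1/2 * ‖m‖ := (abs_real_inner_le_norm a m).trans (by gcongr)
  have c2 : |- inner ℝ a m + (2 * inner ℝ a v * inner ℝ a m) / (2 * S)| ≤ ‖m‖ := by
    have : |(2 * inner ℝ a v * inner ℝ a m) / (2 * S)| ≤ 1/2 * ‖m‖ := by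
      rw [abs_div, abs_mul, abs_mul, abs_of_pos (by positivity : 0 < 2 * S),
        div_le_iff₀ (by positivity), abs_two]
      calc _ ≤ 2 * S * (1/2 * ‖m‖) := by gcongr
        _ = _ := by ring
    refine (abs_add_le _ _).trans ?_
    rw [abs_neg]; linarith
  have c3 : ‖lam a v • m + (- inner ℝ a m + (2 * inner ℝ a v * inner ℝ a m) / (2 * S)) • v‖
      ≤ 3 * ‖m‖ := by
    refine (norm_add_le _ _).trans ?_
    rw [norm_smul, norm_smul, Real.norm_eq_abs, Real.norm_eq_abs]
    have := mul_le_mul_of_nonneg_right (lam_le ha hv1) (norm_nonneg m)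
    have := mul_le_mul c2 hv1 (norm_nonneg v) (norm_nonneg m)
    linarith
  calc _ ≤ 3 * ‖m‖ * r := mul_le_mul c3 ry (norm_nonneg _) (by positivity)
    _ ≤ _ := by linarith

theorem retr_tan {p : ℕ} {a : Eu p} (ha : ‖a‖ < 1/2) {w k : Eu p} (h : ‖w‖ = 1)
    (hk : inner ℝ w k = (0:ℝ)) : fderiv ℝ (retr a) (0, w) (0, k) = k := by
  have hne : w ≠ a := by rintro rfl; linarith
  have hq : 0 < ‖((0:ℝ), w).2 - a‖ ^ 2 + ((0:ℝ), w).1 ^ 2 := by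
    have : 0 < ‖w - a‖ := norm_pos_iff.2 (sub_ne_zero.2 hne)
    simp only; positivity
  have hf := ((retr_smooth (q := ((0:ℝ), w)) ha hq).differentiableAt (by norm_num)).hasFDerivAt
  let γ : ℝ → Eu p := fun t => (√(1 + t ^ 2 * ‖k‖ ^ 2))⁻¹ • (w + t • k)
  have hγ : HasDerivAt γ k 0 := by
    have h1 : HasDerivAt (fun t : ℝ => √(1 + t ^ 2 * ‖k‖ ^ 2)) 0 0 := by
      have := ((((hasDerivAt_id (0:ℝ)).pow 2).mul_const (‖k‖^2)).const_add 1).sqrt (by simp)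
      simpa using this
    have h2 : HasDerivAt (fun t : ℝ => w + t • k) k 0 := by
      simpa using ((hasDerivAt_id (0:ℝ)).smul_const k).const_add w
    refine ((h1.fun_inv (by simp)).fun_smul h2).congr_deriv ?_
    simp
  have γ0 : γ 0 = w := by simp [γ]
  have γ1 : ∀ t, ‖γ t‖ = 1 := by
    intro t
    have : ‖w + t • k‖ = √(1 + t ^ 2 * ‖k‖ ^ 2) := by
      rw [eq_comm, Real.sqrt_eq_iff_mul_self_eq (by positivity) (norm_nonneg _), ← pow_two,
        norm_add_sq_real, inner_smul_right, hk, h, norm_smul, mul_pow, Real.norm_eq_abs, sq_abs]; ring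
    rw [norm_smul, this, norm_inv, Real.norm_eq_abs, abs_of_nonneg (Real.sqrt_nonneg _),
      inv_mul_cancel₀ (Real.sqrt_pos.2 (by positivity)).ne']
  have hc : HasDerivAt (fun t : ℝ => ((0:ℝ), γ t)) (0, k) 0 := (hasDerivAt_const _ _).prodMk hγ
  have d1 : HasDerivAt (fun t : ℝ => retr a (0, γ t)) (fderiv ℝ (retr a) (0, w) (0, k)) 0 := by
    have : HasFDerivAt (retr a) (fderiv ℝ (retr a) (0, w)) (0, γ 0) := by rw [γ0]; exact hf
    exact this.comp_hasDerivAt (0:ℝ) hc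
  have e : (fun t : ℝ => retr a (0, γ t)) = γ := funext fun t => retr_id ha (γ1 t)
  rw [e] at d1
  exact d1.unique hγ

/-- derivative of the retracted map -/
def dT {n p : ℕ} (a : Eu p) (G : Eu n × Eu p → Eu p) (u : Eu n → Eu p) (g : Eu n → (Eu n →L[ℝ] Eu p))
    (δ : ℝ) (x : Eu n) : Eu n →L[ℝ] Eu p :=
  (fderiv ℝ (retr a) (δ, G (x, u x))).comp
    ((ContinuousLinearMap.inr ℝ ℝ (Eu p)).comp (dG G u g x))

theorem dT_le {n p : ℕ} {a : Eu p} (ha : ‖a‖ < 1/2) (G : Eu n × Eu p → Eu p) (u : Eu n → Eu p)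
    (g : Eu n → (Eu n →L[ℝ] Eu p)) (δ : ℝ) (x : Eu n) (h : G (x, u x) ≠ a) :
    ‖dT a G u g δ x‖ ≤ 6 * (‖G (x, u x) - a‖⁻¹ * ‖dG G u g x‖) := by
  have h0 : 0 < ‖G (x, u x) - a‖ := norm_pos_iff.2 (sub_ne_zero.2 h)
  refine ContinuousLinearMap.opNorm_le_bound _ (by positivity) fun e => ?_
  have := retr_d (q := (δ, G (x, u x))) ha (by simp only; positivity) (dG G u g x e)
  have h2 := (dG G u g x).le_opNorm e
  change ‖fderiv ℝ (retr a) (δ, G (x, u x)) (0, dG G u g x e)‖ ≤ _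
  rw [← le_div_iff₀ h0] at this
  refine this.trans ?_
  rw [div_eq_inv_mul]
  calc _ ≤ ‖G (x, u x) - a‖⁻¹ * (6 * (‖dG G u g x‖ * ‖e‖)) := by gcongr
    _ = _ := by ring

theorem dT_tend {n p : ℕ} {a : Eu p} (ha : ‖a‖ < 1/2) (G : Eu n × Eu p → Eu p) (u : Eu n → Eu p)
    (g : Eu n → (Eu n →L[ℝ] Eu p)) (x : Eu n) (h : G (x, u x) ≠ a) {δ : ℕ → ℝ}
    (hδ : Tendsto δ atTop (𝓝 0)) :
    Tendsto (fun k => retr a (δ k, G (x, u x))) atTop (𝓝 (retr a (0, G (x, u x)))) ∧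
    Tendsto (fun k => dT a G u g (δ k) x) atTop (𝓝 (dT a G u g 0 x)) := by
  have h0 : 0 < ‖G (x, u x) - a‖ := norm_pos_iff.2 (sub_ne_zero.2 h)
  have hs := retr_smooth (q := (0, G (x, u x))) ha (by simp only; positivity)
  have ht : Tendsto (fun k => (δ k, G (x, u x))) atTop (𝓝 (0, G (x, u x))) :=
    hδ.prodMk_nhds tendsto_const_nhds
  refine ⟨hs.continuousAt.tendsto.comp ht, ?_⟩
  have := ((hs.fderiv_right (m := 0) (by norm_num)).continuousAt.tendsto).comp ht
  exact (((ContinuousLinearMap.compL ℝ (Eu n) (ℝ × Eu p) (Eu p)).flip _).continuous.tendsto _).comp this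

theorem dT_c1 {n p : ℕ} {a : Eu p} (ha : ‖a‖ < 1/2) {G : Eu n × Eu p → Eu p} (hG : ContDiff ℝ 1 G)
    (u : Eu n → Eu p) (g : Eu n → (Eu n →L[ℝ] Eu p)) {δ : ℝ} (hδ : 0 < δ) :
    ContDiff ℝ 1 (fun q => retr a (δ, G q)) ∧ dG (fun q => retr a (δ, G q)) u g = dT a G u g δ := by
  have hs : ∀ v, ContDiffAt ℝ 1 (retr a) (δ, v) := fun v =>
    retr_smooth (q := (δ, v)) ha (by simp only; positivity)
  have c1 : ContDiff ℝ 1 (fun q => retr a (δ, G q)) := contDiff_iff_contDiffAt.2 fun q =>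
    ContDiffAt.comp (g := retr a) (f := fun q => (δ, G q)) q (hs (G q))
      (contDiff_const.prodMk hG).contDiffAt
  refine ⟨c1, ?_⟩
  funext x
  ext1 e
  change fderiv ℝ (fun q => retr a (δ, G q)) (x, u x) (e, g x e) =
    fderiv ℝ (retr a) (δ, G (x, u x)) (0, fderiv ℝ G (x, u x) (e, g x e))
  have h1 : HasFDerivAt (fun q => (δ, G q)) _ (x, u x) := (hasFDerivAt_const δ (x, u x)).prodMk
    (hG.differentiable (by norm_num) (x, u x)).hasFDerivAt
  have := (((hs (G (x, u x))).differentiableAt (by norm_num)).hasFDerivAt.comp (x, u x) h1).fderiv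
  change fderiv ℝ (fun q => retr a (δ, G q)) (x, u x) = _ at this
  rw [this]; rfl

theorem retr_ibp {n p : ℕ} (K : Kern n) {y z : Eu n} {R ρ : ℝ} {u : Eu n → Eu p}
    {g : Eu n → (Eu n →L[ℝ] Eu p)} (H : LocMin y R u g) {G : Eu n × Eu p → Eu p}
    (hG : ContDiff ℝ 1 G) {a : Eu p} (ha : ‖a‖ < 1/2) (hB : ball z ρ ⊆ ball y R)
    (good : ∀ᵐ x, x ∈ ball z ρ → G (x, u x) ≠ a)
    (hP : IntegrableOn (fun x => ‖G (x, u x) - a‖⁻¹ * ‖dG G u g x‖) (ball z ρ)) :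
    AEStronglyMeasurable (fun x => retr a (0, G (x, u x))) (volume.restrict (ball z ρ)) ∧
    AEStronglyMeasurable (dT a G u g 0) (volume.restrict (ball z ρ)) ∧
    ∀ φ : Eu n → ℝ, ContDiff ℝ ∞ φ → HasCompactSupport φ → tsupport φ ⊆ ball z ρ → ∀ e,
      ∫ x, (fderiv ℝ φ x e) • retr a (0, G (x, u x)) = - ∫ x, φ x • dT a G u g 0 x e := by
  let δ : ℕ → ℝ := fun k => 1 / ((k : ℝ) + 1)
  have hδ : Tendsto δ atTop (𝓝 0) := tendsto_one_div_add_atTop_nhds_zero_nat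
  have δ0 : ∀ k, 0 < δ k := fun k => by positivity
  have hm := fun k => dG_meas (dT_c1 ha hG u g (δ0 k)).1 H.hu.1 H.hg.1
  simp only [(dT_c1 ha hG u g (δ0 _)).2] at hm
  have good' : ∀ᵐ x ∂(volume.restrict (ball z ρ)), G (x, u x) ≠ a :=
    (ae_restrict_iff' measurableSet_ball).2 good
  refine ⟨aestronglyMeasurable_of_tendsto_ae atTop (fun k => (hm k).1.restrict) ?_,
    aestronglyMeasurable_of_tendsto_ae atTop (fun k => (hm k).2.restrict) ?_, ?_⟩
  · filter_upwards [good'] with x hx using (dT_tend ha G u g x hx hδ).1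
  · filter_upwards [good'] with x hx using (dT_tend ha G u g x hx hδ).2
  intro φ hφ hc hs e
  obtain ⟨t1, t2, t3, t4, t5⟩ := test_facts hφ hc e
  have key := fun k => chain K isOpen_ball H.W H.hu H.hg H.ub (dT_c1 ha hG u g (δ0 k)).1 hφ hc
    (hs.trans hB) e
  have l1 : Tendsto (fun k => ∫ x, (fderiv ℝ φ x e) • retr a (δ k, G (x, u x))) atTop
      (𝓝 (∫ x, (fderiv ℝ φ x e) • retr a (0, G (x, u x)))) := by
    refine tendsto_integral_of_dominated_convergence (fun x => ‖fderiv ℝ φ x e‖ * 3)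
      (fun k => t1.aestronglyMeasurable.smul (hm k).1)
      ((t1.integrable_of_hasCompactSupport t2).norm.mul_const 3) (fun k => ae_of_all _ fun x => ?_) ?_
    · rw [norm_smul]; gcongr; exact retr_le ha _
    · filter_upwards [good] with x hx
      by_cases hxB : x ∈ ball z ρ
      · exact (dT_tend ha G u g x (hx hxB) hδ).1.const_smul _
      · simp [t5 x fun h => hxB (hs h)]
  have l2 : Tendsto (fun k => ∫ x, φ x • dT a G u g (δ k) x e) atTop
      (𝓝 (∫ x, φ x • dT a G u g 0 x e)) := by
    obtain ⟨M, hM⟩ := hφ.continuous.bounded_above_of_compact_support hc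
    refine tendsto_integral_of_dominated_convergence ((ball z ρ).indicator
      fun x => (6 * M * ‖e‖) * (‖G (x, u x) - a‖⁻¹ * ‖dG G u g x‖))
      (fun k => hφ.continuous.aestronglyMeasurable.smul ((hm k).2.apply_continuousLinearMap e))
      ((integrable_indicator_iff measurableSet_ball).2 (hP.const_mul _)) (fun k => ?_) ?_
    · filter_upwards [good] with x hx
      by_cases hxB : x ∈ ball z ρ
      · rw [indicator_of_mem hxB, norm_smul]
        have h1 := (dT a G u g (δ k) x).le_of_opNorm_le (dT_le ha G u g (δ k) x (hx hxB)) e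
        calc _ ≤ M * (6 * (‖G (x, u x) - a‖⁻¹ * ‖dG G u g x‖) * ‖e‖) :=
              mul_le_mul (hM x) h1 (norm_nonneg _) ((norm_nonneg _).trans (hM x))
          _ = _ := by ring
      · rw [indicator_of_notMem hxB, t4 x fun h => hxB (hs h)]; simp
    · filter_upwards [good] with x hx
      by_cases hxB : x ∈ ball z ρ
      · exact ((ContinuousLinearMap.apply ℝ (Eu p) e).continuous.tendsto _ |>.comp
          (dT_tend ha G u g x (hx hxB) hδ).2).const_smul _
      · simp [t4 x fun h => hxB (hs h)]
  refine tendsto_nhds_unique l1 (l2.neg.congr fun k => ?_)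
  rw [key k]
  have := (dT_c1 ha hG u g (δ0 k)).2
  congr 1
  refine integral_congr_ae (ae_of_all _ fun x => ?_)
  change φ x • dT a G u g (δ k) x e = φ x • dG (fun q => retr a (δ k, G q)) u g x e
  rw [this]

/-- interpolation of `u` with a constant -/
def wmap {n p : ℕ} (χ : Eu n → ℝ) (c : Eu p) (q : Eu n × Eu p) : Eu p := q.2 + χ q.1 • (c - q.2)

theorem wmap_facts {n p : ℕ} {χ : Eu n → ℝ} (hχ : ContDiff ℝ ∞ χ) (c : Eu p) :
    ContDiff ℝ 1 (wmap χ c) ∧ ∀ (u : Eu n → Eu p) (g : Eu n → (Eu n →L[ℝ] Eu p)) x e,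
      dG (wmap χ c) u g x e = (1 - χ x) • g x e + fderiv ℝ χ x e • (c - u x) := by
  have hχ1 : ContDiff ℝ 1 χ := hχ.of_le (by simp)
  refine ⟨contDiff_snd.add ((hχ1.comp contDiff_fst).smul (contDiff_const.sub contDiff_snd)), ?_⟩
  intro u g x e
  have h1 : HasFDerivAt (fun q : Eu n × Eu p => χ q.1) _ (x, u x) :=
    ((hχ1.differentiable (by norm_num) x).hasFDerivAt).comp (x, u x) hasFDerivAt_fst
  have h2 := hasFDerivAt_snd.add (h1.smul ((hasFDerivAt_const c (x, u x)).sub hasFDerivAt_snd))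
  have := h2.fderiv
  change fderiv ℝ (wmap χ c) (x, u x) (e, g x e) = _
  change fderiv ℝ (wmap χ c) (x, u x) = _ at this
  rw [this]
  simp [sub_smul]; abel

theorem hkl {n p : ℕ} (hp : 3 ≤ p) : ∃ C : ℝ, 0 ≤ C ∧ ∀ (K : Kern n) (y : Eu n) (R : ℝ)
    (u : Eu n → Eu p) (g : Eu n → (Eu n →L[ℝ] Eu p)), LocMin y R u g → ∀ (z : Eu n) (s ρ : ℝ),
    0 < s → s < ρ → closedBall z ρ ⊆ ball y R → ∀ (χ : Eu n → ℝ) (c : Eu p), ContDiff ℝ ∞ χ →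
    (∀ x, 0 ≤ χ x ∧ χ x ≤ 1) → (∀ x, x ∉ ball z s → χ x = 0 ∧ fderiv ℝ χ x = 0) → ‖c‖ ≤ 1 →
    IntegrableOn (fun x => ‖dG (wmap χ c) u g x‖ ^ 2) (ball z s) ∧
    ∫ x in ball z s, en (g x) ≤ C * ∫ x in ball z s, ‖dG (wmap χ c) u g x‖ ^ 2 := by
  obtain ⟨C, hC⟩ := moment hp
  refine ⟨36 * n * C, by positivity, ?_⟩
  intro K y R u g H z s ρ s0 sρ hz χ c hχ h01 hoff hc
  obtain ⟨hW, hD⟩ := wmap_facts hχ c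
  obtain ⟨G, hG⟩ : ∃ G, G = wmap χ c := ⟨_, rfl⟩
  rw [← hG] at hW hD ⊢
  have hB : ball z ρ ⊆ ball y R := ball_subset_closedBall.trans hz
  have hsρ : ball z s ⊆ ball z ρ := ball_subset_ball sρ.le
  have fin : ∀ r, IsFiniteMeasure (volume.restrict (ball z r)) := fun r =>
    ⟨by rw [Measure.restrict_apply_univ]; exact measure_ball_lt_top⟩
  have := fin s
  have := fin ρ
  obtain ⟨mG, mD⟩ := dG_meas hW H.hu.1 H.hg.1
  have G1 : ∀ᵐ x, ‖G (x, u x)‖ ≤ 1 := by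
    filter_upwards [H.ub] with x hx
    have e : G (x, u x) = (1 - χ x) • u x + χ x • c := by rw [hG, wmap]; module
    rw [e]
    refine (norm_add_le _ _).trans ?_
    rw [norm_smul, norm_smul, Real.norm_eq_abs, Real.norm_eq_abs, abs_of_nonneg (h01 x).1,
      abs_of_nonneg (sub_nonneg.2 (h01 x).2)]
    nlinarith [h01 x]
  have Goff : ∀ x, x ∉ ball z s → G (x, u x) = u x ∧ dG G u g x = g x := by
    intro x hx
    obtain ⟨h1, h2⟩ := hoff x hx
    refine ⟨by rw [hG, wmap]; simp [h1], ?_⟩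
    ext1 e; rw [hD, h1, h2]; simp
  have DL : IntegrableOn (fun x => ‖dG G u g x‖ ^ 2) (ball z s) := by
    obtain ⟨M, M0, hM⟩ := fd_bound hW z s
    have : IntegrableOn (fun x => M ^ 2 * (2 + 2 * ‖g x‖ ^ 2)) (ball z s) :=
      (Integrable.const_mul (iadd (integrable_const _)
        ((H.hg.integrable_norm_pow (by norm_num)).const_mul 2).integrableOn) _)
    refine Integrable.mono' this (mD.norm.pow 2).restrict ?_
    filter_upwards [ae_restrict_of_ae H.ub, ae_restrict_mem measurableSet_ball] with x h1 h2
    have := dG_norm (u := u) (g := g) M0 (hM x (ball_subset_closedBall h2) _ h1)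
    rw [Real.norm_eq_abs, abs_of_nonneg (by positivity)]
    calc _ ≤ (M * (1 + ‖g x‖)) ^ 2 := by gcongr
      _ ≤ _ := by rw [mul_pow]; gcongr; nlinarith [sq_nonneg (1 - ‖g x‖)]
  refine ⟨DL, ?_⟩
  obtain ⟨a, ha, hne, hle⟩ := hC n (volume.restrict (ball z s)) (fun x => G (x, u x))
    (fun x => ‖dG G u g x‖ₑ ^ 2) mG.restrict (mD.enorm.pow_const 2).restrict (ae_restrict_of_ae G1)
  have good : ∀ᵐ x, x ∈ ball z ρ → G (x, u x) ≠ a := by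
    filter_upwards [(ae_restrict_iff' measurableSet_ball).1 hne, H.u1] with x h1 h2 hx he
    by_cases hxs : x ∈ ball z s
    · exact h1 hxs he
    · rw [(Goff x hxs).1] at he
      have := h2 (hB hx)
      rw [he] at this; linarith
  obtain ⟨P, hP⟩ : ∃ P : Eu n → ℝ, P = fun x => ‖G (x, u x) - a‖⁻¹ * ‖dG G u g x‖ := ⟨_, rfl⟩
  have mP : AEStronglyMeasurable P := by
    rw [hP]; exact ((mG.sub aestronglyMeasurable_const).norm.aemeasurable.inv.aestronglyMeasurable).mul mD.norm
  have DLe : ∫⁻ x in ball z s, ‖dG G u g x‖ₑ ^ 2 = ENNReal.ofReal (∫ x in ball z s, ‖dG G u g x‖ ^ 2) := by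
    rw [ofReal_integral_eq_lintegral_ofReal DL (ae_of_all _ fun x => by positivity)]
    refine lintegral_congr fun x => ?_
    rw [ENNReal.ofReal_pow (norm_nonneg _), ofReal_norm]
  have Pe : ∫⁻ x in ball z s, ENNReal.ofReal (P x ^ 2)
      ≤ ENNReal.ofReal (C * ∫ x in ball z s, ‖dG G u g x‖ ^ 2) := by
    rw [ENNReal.ofReal_mul (by positivity), ENNReal.ofReal_coe_nnreal, ← DLe]
    refine le_trans (lintegral_mono_ae ?_) hle
    filter_upwards [hne] with x hx
    have h0 : 0 < ‖G (x, u x) - a‖ := norm_pos_iff.2 (sub_ne_zero.2 hx)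
    rw [hP]; simp only
    rw [mul_pow, ENNReal.ofReal_mul (by positivity), ENNReal.ofReal_pow (norm_nonneg _), inv_pow,
      ENNReal.ofReal_inv_of_pos (by positivity), ENNReal.ofReal_pow (norm_nonneg _),
      ofReal_norm, ofReal_norm]
  have Ps : IntegrableOn (fun x => P x ^ 2) (ball z s) := by
    refine ⟨(mP.pow 2).restrict, ?_⟩
    rw [hasFiniteIntegral_iff_ofReal (ae_of_all _ fun x => sq_nonneg _)]
    exact Pe.trans_lt ENNReal.ofReal_lt_top
  have Ple : ∫ x in ball z s, P x ^ 2 ≤ C * ∫ x in ball z s, ‖dG G u g x‖ ^ 2 := by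
    have h0 : 0 ≤ C * ∫ x in ball z s, ‖dG G u g x‖ ^ 2 :=
      mul_nonneg C.2 (integral_nonneg fun x => by positivity)
    rw [← ENNReal.ofReal_le_ofReal_iff h0,
      ofReal_integral_eq_lintegral_ofReal Ps (ae_of_all _ fun x => sq_nonneg _)]
    exact Pe
  have Pρ : IntegrableOn (fun x => P x ^ 2) (ball z ρ) := by
    rw [← sdiff_union_of_subset hsρ]
    refine IntegrableOn.union ?_ Ps
    have : IntegrableOn (fun x => 4 * ‖g x‖ ^ 2) (ball z ρ \ ball z s) :=
      ((H.hg.integrable_norm_pow (by norm_num)).const_mul 4).integrableOn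
    refine Integrable.mono' this (mP.pow 2).restrict ?_
    filter_upwards [ae_restrict_of_ae H.u1, ae_restrict_mem (measurableSet_ball.diff measurableSet_ball)]
      with x h1 h2
    rw [Real.norm_eq_abs, abs_of_nonneg (by positivity), hP]
    simp only [(Goff x h2.2).1, (Goff x h2.2).2]
    have h3 : 1/2 ≤ ‖u x - a‖ := by
      have := norm_sub_norm_le (u x) a
      rw [h1 (hB h2.1)] at this; linarith
    have h4 : ‖u x - a‖⁻¹ ≤ 2 := by
      rw [inv_le_comm₀ (by linarith) (by norm_num)]; linarith
    rw [mul_pow]; gcongr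
    nlinarith [inv_nonneg.2 (norm_nonneg (u x - a))]
  have P1 : IntegrableOn P (ball z ρ) := by
    refine Integrable.mono' (iadd (integrable_const (1:ℝ)) Pρ) mP.restrict (ae_of_all _ fun x => ?_)
    rw [Real.norm_eq_abs, abs_le]; constructor <;> nlinarith [sq_nonneg (P x - 1), sq_nonneg (P x + 1)]
  obtain ⟨mw, mT, ibp⟩ := retr_ibp K H hW ha hB good (hP ▸ P1)
  classical
  let w : Eu n → Eu p := (ball z s).piecewise (fun x => retr a (0, G (x, u x))) u
  let h : Eu n → (Eu n →L[ℝ] Eu p) := (ball z s).piecewise (dT a G u g 0) g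
  have wh : ∀ᵐ x, x ∈ ball z ρ → w x = retr a (0, G (x, u x)) ∧ h x = dT a G u g 0 x := by
    filter_upwards [H.u1, H.ug K] with x h1 h2 hx
    by_cases hxs : x ∈ ball z s
    · simp [w, h, hxs]
    · simp only [w, h, piecewise_eq_of_notMem _ _ _ hxs, (Goff x hxs).1]
      refine ⟨(retr_id ha (h1 (hB hx))).symm, ?_⟩
      ext1 e
      change _ = fderiv ℝ (retr a) (0, G (x, u x)) (0, dG G u g x e)
      rw [(Goff x hxs).1, (Goff x hxs).2, retr_tan ha (h1 (hB hx)) (h2 (hB hx) e)]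
  have hT : ∀ᵐ x, x ∈ ball z s → ‖dT a G u g 0 x‖ ^ 2 ≤ 36 * P x ^ 2 := by
    filter_upwards [good] with x hx hxs
    have := dT_le ha G u g 0 x (hx (hsρ hxs))
    rw [hP]
    calc _ ≤ (6 * (‖G (x, u x) - a‖⁻¹ * ‖dG G u g x‖)) ^ 2 := by gcongr
      _ = _ := by ring
  have mh : AEStronglyMeasurable h := AEStronglyMeasurable.piecewise measurableSet_ball
    (mT.mono_measure (Measure.restrict_mono hsρ le_rfl)) H.hg.1.restrict
  have hL : Integrable (fun x => ‖h x‖ ^ 2) := by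
    have : Integrable (fun x => (ball z s).indicator (fun x => 36 * P x ^ 2) x + ‖g x‖ ^ 2) :=
      iadd ((integrable_indicator_iff measurableSet_ball).2 (Ps.const_mul _))
        (H.hg.integrable_norm_pow (by norm_num))
    refine Integrable.mono' this (mh.norm.pow 2) ?_
    filter_upwards [hT] with x hx
    rw [Real.norm_eq_abs, abs_of_nonneg (by positivity)]
    by_cases hxs : x ∈ ball z s
    · simp only [h, piecewise_eq_of_mem _ _ _ hxs, indicator_of_mem hxs]
      nlinarith [hx hxs, sq_nonneg ‖g x‖]
    · simp only [h, piecewise_eq_of_notMem _ _ _ hxs, indicator_of_notMem hxs]; simp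
  have min := H.min z ρ s s0 sρ hz w h
    (AEStronglyMeasurable.piecewise measurableSet_ball
      (mw.mono_measure (Measure.restrict_mono hsρ le_rfl)) H.hu.1.restrict) mh
    (by filter_upwards [wh, good] with x h1 h2 hx
        rw [(h1 hx).1, retr_norm ha (h2 hx)])
    (fun x hx => by simp only [w, h, piecewise_eq_of_notMem _ _ _ hx, and_self])
    hL.integrableOn
    (by intro φ hφ hc hs e
        obtain ⟨t1, t2, t3, t4, t5⟩ := test_facts hφ hc e
        rw [integral_congr_ae (g := fun x => (fderiv ℝ φ x e) • retr a (0, G (x, u x))), ibp φ hφ hc hs e]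
        · congr 1
          refine integral_congr_ae ?_
          filter_upwards [wh] with x hx
          by_cases hxB : x ∈ ball z ρ
          · rw [(hx hxB).2]
          · rw [t4 x fun h => hxB (hs h)]; simp
        · filter_upwards [wh] with x hx
          by_cases hxB : x ∈ ball z ρ
          · rw [(hx hxB).1]
          · rw [t5 x fun h => hxB (hs h)]; simp)
  have hen : Integrable (fun x => en (h x)) := by
    refine Integrable.mono' (hL.const_mul n) (en_cont.comp_aestronglyMeasurable mh) (ae_of_all _ fun x => ?_)
    rw [Real.norm_eq_abs, abs_of_nonneg (en_nonneg _)]; exact en_le _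
  have split : ∀ f : Eu n → ℝ, Integrable f →
      ∫ x in ball z ρ, f x = (∫ x in ball z s, f x) + ∫ x in ball z ρ \ ball z s, f x := by
    intro f hf
    have := setIntegral_sdiff measurableSet_ball (f := f) hf.integrableOn hsρ (μ := volume)
    rw [this]; ring
  rw [split _ H.en_int, split _ hen, setIntegral_congr_fun (f := fun x => en (h x)) (g := fun x => en (g x))
    (measurableSet_ball.diff measurableSet_ball) (fun x hx => by
      simp only [h, piecewise_eq_of_notMem _ _ _ hx.2])] at min
  refine (le_of_add_le_add_right min).trans ?_
  calc ∫ x in ball z s, en (h x) ≤ ∫ x in ball z s, (n * 36) * P x ^ 2 := by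
        refine integral_mono_ae hen.integrableOn (Ps.const_mul _) ?_
        filter_upwards [ae_restrict_of_ae hT, ae_restrict_mem measurableSet_ball] with x h1 h2
        simp only [h, piecewise_eq_of_mem _ _ _ h2]
        have := h1 h2
        calc _ ≤ n * ‖dT a G u g 0 x‖ ^ 2 := en_le _
          _ ≤ n * (36 * P x ^ 2) := by gcongr
          _ = _ := by ring
    _ ≤ _ := by
      rw [integral_const_mul]
      calc _ ≤ (n * 36 : ℝ) * (C * ∫ x in ball z s, ‖dG G u g x‖ ^ 2) := by gcongr
        _ = _ := by ring

theorem LocMin.uc_int {n p : ℕ} {y : Eu n} {R : ℝ} {u : Eu n → Eu p}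
    {g : Eu n → (Eu n →L[ℝ] Eu p)} (H : LocMin y R u g) (c : Eu p) (z : Eu n) (r : ℝ) :
    IntegrableOn (fun x => ‖u x - c‖ ^ 2) (ball z r) := by
  refine Measure.integrableOn_of_bounded (M := (1 + ‖c‖) ^ 2) measure_ball_lt_top.ne
    ((H.hu.1.sub aestronglyMeasurable_const).norm.pow 2) (ae_restrict_of_ae ?_)
  filter_upwards [H.ub] with x hx
  rw [Real.norm_eq_abs, abs_of_nonneg (by positivity)]
  gcongr
  exact (norm_sub_le _ _).trans (by linarith)

theorem ball_mono {n : ℕ} {f : Eu n → ℝ} {s t : Set (Eu n)} (hf : IntegrableOn f t) (h0 : ∀ x, 0 ≤ f x)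
    (h : s ⊆ t) : ∫ x in s, f x ≤ ∫ x in t, f x :=
  setIntegral_mono_set hf (ae_of_all _ h0) (LE.le.eventuallyLE h)

theorem cacc_step {n p : ℕ} (hp : 3 ≤ p) : ∃ γ : ℝ, 0 ≤ γ ∧ γ < 1 ∧ ∀ t s : ℝ, 0 < t → t < s →
    ∃ C : ℝ, 0 ≤ C ∧ ∀ (_ : Kern n) (y : Eu n) (R : ℝ)
    (u : Eu n → Eu p) (g : Eu n → (Eu n →L[ℝ] Eu p)), LocMin y R u g → ∀ (z : Eu n) (r : ℝ) (c : Eu p),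
    0 < r → closedBall z (s * r) ⊆ ball y R → ‖c‖ ≤ 1 →
    ∫ x in ball z (t * r), en (g x) ≤ γ * (∫ x in ball z (s * r), en (g x)) +
      C / r ^ 2 * ∫ x in ball z (s * r), ‖u x - c‖ ^ 2 := by
  obtain ⟨C0, C00, hC0⟩ := hkl (n := n) hp
  refine ⟨2 * C0 / (1 + 2 * C0), by positivity, by rw [div_lt_one (by positivity)]; linarith, ?_⟩
  intro t s t0 ts
  let f : ContDiffBump (0 : Eu n) := ⟨t, (t + s) / 2, t0, by linarith⟩
  have hfc : ContDiff ℝ ∞ f := f.contDiff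
  obtain ⟨M, hM⟩ := (hfc.continuous_fderiv (by simp)).bounded_above_of_compact_support
    (f.hasCompactSupport.fderiv ℝ)
  have M0 : 0 ≤ M := (norm_nonneg _).trans (hM 0)
  refine ⟨2 * C0 * M ^ 2, by positivity, ?_⟩
  intro K y R u g H z r c r0 hz hc
  obtain ⟨m, hm⟩ : ∃ m, m = (t + s) / 2 := ⟨_, rfl⟩
  have tm : t < m := by linarith
  have ms : m < s := by linarith
  let χ : Eu n → ℝ := fun x => f (r⁻¹ • (x - z))
  have hχ : ContDiff ℝ ∞ χ := hfc.comp (contDiff_const_smul _ |>.comp (contDiff_id.sub contDiff_const))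
  have χd : ∀ x, ‖fderiv ℝ χ x‖ ≤ M / r := by
    intro x
    have h1 : HasFDerivAt (fun x : Eu n => r⁻¹ • (x - z)) (r⁻¹ • ContinuousLinearMap.id ℝ (Eu n)) x :=
      ((hasFDerivAt_id x).sub_const z).const_smul r⁻¹
    have : HasFDerivAt χ _ x := HasFDerivAt.comp (g := f) x
      (hfc.differentiable (by simp) (r⁻¹ • (x - z))).hasFDerivAt h1
    rw [this.fderiv]
    refine (ContinuousLinearMap.opNorm_comp_le _ _).trans ?_
    rw [norm_smul, norm_inv, Real.norm_eq_abs, abs_of_pos r0, div_eq_mul_inv]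
    gcongr
    · exact hM _
    · exact mul_le_of_le_one_right (by positivity) ContinuousLinearMap.norm_id_le
  have χ01 : ∀ x, 0 ≤ χ x ∧ χ x ≤ 1 := fun x => ⟨f.nonneg, f.le_one⟩
  have nr : ∀ x, ‖r⁻¹ • (x - z)‖ = dist x z / r := by
    intro x; rw [norm_smul, norm_inv, Real.norm_eq_abs, abs_of_pos r0, dist_eq_norm]; ring
  have χoff : ∀ x, x ∉ ball z (m * r) → χ x = 0 ∧ fderiv ℝ χ x = 0 := by
    intro x hx
    have h0 : χ x = 0 := by
      refine f.zero_of_le_dist ?_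
      rw [dist_zero_right, nr, le_div_iff₀ r0]
      simpa [hm] using hx
    refine ⟨h0, IsLocalMin.fderiv_eq_zero (Eventually.of_forall fun w => ?_)⟩
    rw [h0]; exact (χ01 w).1
  have χon : ∀ x ∈ ball z (t * r), χ x = 1 := by
    intro x hx
    refine f.one_of_mem_closedBall ?_
    rw [mem_closedBall, dist_zero_right, nr, div_le_iff₀ r0]
    exact (mem_ball.1 hx).le
  obtain ⟨iD, hle⟩ := hC0 K y R u g H z (m * r) (s * r) (mul_pos (t0.trans tm) r0)
    (by gcongr) hz χ c hχ χ01 χoff hc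
  have sub : ball z (t * r) ⊆ ball z (m * r) := ball_subset_ball (by gcongr)
  have sub2 : ball z (m * r) ⊆ ball z (s * r) := ball_subset_ball (by gcongr)
  have iE := H.en_int
  have iU := H.uc_int c z (m * r)
  have iS : IntegrableOn (fun x => ((ball z (t * r)).indicator (fun x => en (g x)) x)) (ball z (m * r)) :=
    (iE.indicator measurableSet_ball).integrableOn
  have iES : IntegrableOn (fun x => 2 * (en (g x) - (ball z (t * r)).indicator (fun x => en (g x)) x))
    (ball z (m * r)) := (iE.integrableOn.sub iS).const_mul 2
  have est : ∫ x in ball z (m * r), ‖dG (wmap χ c) u g x‖ ^ 2 ≤ 2 * ((∫ x in ball z (m * r), en (g x)) -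
      ∫ x in ball z (t * r), en (g x)) + 2 * (M / r) ^ 2 * ∫ x in ball z (m * r), ‖u x - c‖ ^ 2 := by
    have e1 : ∫ x in ball z (t * r), en (g x) =
        ∫ x in ball z (m * r), (ball z (t * r)).indicator (fun x => en (g x)) x := by
      rw [setIntegral_indicator measurableSet_ball, inter_eq_right.2 sub]
    rw [e1, ← integral_sub iE.integrableOn iS, ← integral_const_mul, ← integral_const_mul,
      ← integral_add iES (iU.const_mul _)]
    refine integral_mono iD (iadd iES (iU.const_mul _)) fun x => ?_
    simp only
    have hn : ‖dG (wmap χ c) u g x‖ ≤ (1 - χ x) * ‖g x‖ + M / r * ‖u x - c‖ := by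
      have h1 := sub_nonneg.2 (χ01 x).2
      refine ContinuousLinearMap.opNorm_le_bound _ (by positivity) fun e => ?_
      rw [(wmap_facts hχ c).2]
      refine (norm_add_le _ _).trans ?_
      rw [norm_smul, norm_smul, Real.norm_eq_abs, abs_of_nonneg h1, norm_sub_rev c, add_mul]
      have h2 := (g x).le_opNorm e
      have h3 := (fderiv ℝ χ x).le_of_opNorm_le (χd x) e
      calc _ ≤ (1 - χ x) * (‖g x‖ * ‖e‖) + M / r * ‖e‖ * ‖u x - c‖ := by gcongr
        _ = _ := by ring
    have h2 : ((1 - χ x) * ‖g x‖) ^ 2 ≤ en (g x) - (ball z (t * r)).indicator (fun x => en (g x)) x := by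
      by_cases hx : x ∈ ball z (t * r)
      · rw [indicator_of_mem hx, χon x hx]; simp
      · rw [indicator_of_notMem hx, sub_zero]
        refine le_trans ?_ (le_en _)
        have := sub_nonneg.2 (χ01 x).2
        gcongr
        exact mul_le_of_le_one_left (norm_nonneg _) (by linarith [χ01 x])
    calc _ ≤ ((1 - χ x) * ‖g x‖ + M / r * ‖u x - c‖) ^ 2 := by gcongr
      _ ≤ 2 * ((1 - χ x) * ‖g x‖) ^ 2 + 2 * (M / r * ‖u x - c‖) ^ 2 := by
        nlinarith [sq_nonneg ((1 - χ x) * ‖g x‖ - M / r * ‖u x - c‖)]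
      _ ≤ _ := by rw [mul_pow (M / r), ← mul_assoc 2 ((M / r) ^ 2)]; gcongr
  have mono1 := ball_mono iE.integrableOn (fun x => en_nonneg (g x)) sub
  have mono2 := ball_mono iE.integrableOn (fun x => en_nonneg (g x)) sub2
  have mono3 := ball_mono (H.uc_int c z (s * r)) (fun x => by positivity) sub2
  have J0 : 0 ≤ ∫ x in ball z (s * r), ‖u x - c‖ ^ 2 := integral_nonneg fun x => by positivity
  generalize ∫ x in ball z (t * r), en (g x) = It at *
  generalize ∫ x in ball z (m * r), en (g x) = Im at *
  generalize ∫ x in ball z (s * r), en (g x) = Is at *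
  generalize ∫ x in ball z (s * r), ‖u x - c‖ ^ 2 = Js at *
  generalize ∫ x in ball z (m * r), ‖u x - c‖ ^ 2 = Jm at *
  have q0 : 0 ≤ (M / r) ^ 2 := by positivity
  have k1 : (1 + 2 * C0) * It ≤ 2 * C0 * Is + 2 * C0 * (M / r) ^ 2 * Js := by
    have := mul_le_mul_of_nonneg_left est C00
    have := mul_le_mul_of_nonneg_left mono3 (mul_nonneg C00 q0)
    nlinarith
  have e2 : 2 * C0 * M ^ 2 / r ^ 2 = 2 * C0 * (M / r) ^ 2 := by rw [div_pow]; ring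
  rw [e2]
  have k2 : It ≤ (2 * C0 * Is + 2 * C0 * (M / r) ^ 2 * Js) / (1 + 2 * C0) := by
    rw [le_div_iff₀ (by positivity)]; linarith
  refine k2.trans ?_
  rw [add_div, div_mul_eq_mul_div]
  gcongr
  exact div_le_self (by positivity) (by linarith)

theorem cacc {n p : ℕ} (hp : 3 ≤ p) {ε t s : ℝ} (hε : 0 < ε) (ht : 0 < t) (hts : t < s) :
    ∃ C : ℝ, 0 ≤ C ∧ ∀ (_ : Kern n) (y : Eu n) (R : ℝ)
    (u : Eu n → Eu p) (g : Eu n → (Eu n →L[ℝ] Eu p)), LocMin y R u g → ∀ (z : Eu n) (r : ℝ) (c : Eu p),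
    0 < r → closedBall z (s * r) ⊆ ball y R → ‖c‖ ≤ 1 →
    ∫ x in ball z (t * r), en (g x) ≤ ε * (∫ x in ball z (s * r), en (g x)) +
      C / r ^ 2 * ∫ x in ball z (s * r), ‖u x - c‖ ^ 2 := by
  obtain ⟨γ, γ0, γ1, hγ⟩ := cacc_step (n := n) hp
  have main : ∀ m : ℕ, ∀ t s : ℝ, 0 < t → t < s → ∃ C : ℝ, 0 ≤ C ∧ ∀ (_ : Kern n) (y : Eu n) (R : ℝ)
    (u : Eu n → Eu p) (g : Eu n → (Eu n →L[ℝ] Eu p)), LocMin y R u g → ∀ (z : Eu n) (r : ℝ) (c : Eu p),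
    0 < r → closedBall z (s * r) ⊆ ball y R → ‖c‖ ≤ 1 →
    ∫ x in ball z (t * r), en (g x) ≤ γ ^ m * (∫ x in ball z (s * r), en (g x)) +
      C / r ^ 2 * ∫ x in ball z (s * r), ‖u x - c‖ ^ 2 := by
    intro m
    induction m with
    | zero =>
      intro t s t0 ts
      refine ⟨0, le_rfl, fun K y R u g H z r c r0 _ _ => ?_⟩
      have := ball_mono H.en_int.integrableOn (fun x => en_nonneg (g x))
        (ball_subset_ball (by gcongr : t * r ≤ s * r) : ball z (t * r) ⊆ _)
      simpa using this
    | succ m ih =>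
      intro t s t0 ts
      obtain ⟨C1, C10, h1⟩ := ih t ((t + s) / 2) t0 (by linarith)
      obtain ⟨C2, C20, h2⟩ := hγ ((t + s) / 2) s (by linarith) (by linarith)
      refine ⟨C1 + γ ^ m * C2, by positivity, fun K y R u g H z r c r0 hz hc => ?_⟩
      have hl : (t + s) / 2 * r ≤ s * r := by gcongr; linarith
      have k1 := h1 K y R u g H z r c r0 ((closedBall_subset_closedBall hl).trans hz) hc
      have k2 := h2 K y R u g H z r c r0 hz hc
      have k3 := ball_mono (H.uc_int c z (s * r)) (fun x => by positivity) (ball_subset_ball hl)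
      refine k1.trans ((add_le_add (mul_le_mul_of_nonneg_left k2 (by positivity))
        (mul_le_mul_of_nonneg_left k3 (by positivity))).trans (le_of_eq ?_))
      ring
  obtain ⟨m, hm⟩ := exists_pow_lt_of_lt_one hε γ1
  obtain ⟨C, C0, hC⟩ := main m t s ht hts
  refine ⟨C, C0, fun K y R u g H z r c r0 hz hc => (hC K y R u g H z r c r0 hz hc).trans ?_⟩
  gcongr
  exact integral_nonneg fun x => en_nonneg _

theorem LocMin.mol_d {n p : ℕ} (K : Kern n) {y : Eu n} {R : ℝ} (hR : 0 < R) {u : Eu n → Eu p}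
    {g : Eu n → (Eu n →L[ℝ] Eu p)} (H : LocMin y R u g) {s : ℝ} (hs : 0 < s) {x : Eu n}
    (hx : ball x s ⊆ ball y R) :
    HasDerivAt (fun s => K.mol s u x)
      (-(((s ^ n)⁻¹ * s) • ∫ w, K.psi s x w • en (g w) • u w)) s := by
  refine (K.mol_deriv hs H.W.iu x).congr_deriv ?_
  obtain ⟨h1, h2, h3⟩ := K.psi_test hs x
  rw [H.pde K hR h1 h2 (h3.trans hx), smul_neg]

theorem LocMin.mol_d_le {n p : ℕ} (K : Kern n) {C : ℝ} (hC : ∀ x, |K.Ψ x| ≤ C) {y : Eu n} {R : ℝ}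
    {u : Eu n → Eu p} {g : Eu n → (Eu n →L[ℝ] Eu p)} (H : LocMin y R u g) {s : ℝ} (hs : 0 < s)
    (x : Eu n) : ‖∫ w, K.psi s x w • en (g w) • u w‖ ≤ C * ∫ w in ball x s, en (g w) := by
  rw [← integral_const_mul, ← integral_indicator measurableSet_ball]
  refine norm_integral_le_of_norm_le ((integrable_indicator_iff measurableSet_ball).2
    (H.en_int.integrableOn.const_mul C)) ?_
  filter_upwards [H.ub] with w hw
  have hC0 : 0 ≤ C := (abs_nonneg _).trans (hC 0)
  by_cases h : w ∈ ball x s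
  · rw [indicator_of_mem h, norm_smul, norm_smul, Real.norm_eq_abs, Real.norm_eq_abs,
      abs_of_nonneg (en_nonneg _)]
    calc _ ≤ C * (en (g w) * 1) := by
          have := en_nonneg (g w)
          gcongr
          exact hC _
      _ = _ := by ring
  · rw [indicator_of_notMem h, image_eq_zero_of_notMem_tsupport
      (fun h' => h ((K.psi_test hs x).2.2 h')), zero_smul, norm_zero]

theorem LocMin.mol_g_le {n p : ℕ} (K : Kern n) {C : ℝ} (hC : ∀ x, |K.η x| ≤ C) {y : Eu n} {R : ℝ}
    {u : Eu n → Eu p} {g : Eu n → (Eu n →L[ℝ] Eu p)} (H : LocMin y R u g) {s : ℝ} (hs : 0 < s)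
    (x : Eu n) : ‖K.mol s g x‖ ^ 2 ≤ (s ^ n)⁻¹ * C * ∫ w in ball x s, en (g w) := by
  have hC0 : 0 ≤ C := (abs_nonneg _).trans (hC 0)
  obtain ⟨k1, k2, k3⟩ := K.ks_test hs x
  have kpos : ∀ w, 0 ≤ K.ks s (x - w) := fun w =>
    mul_nonneg (by positivity) (K.η_nonneg _)
  have kle : ∀ w, K.ks s (x - w) ≤ (s ^ n)⁻¹ * C := fun w =>
    mul_le_mul_of_nonneg_left ((le_abs_self _).trans (hC _)) (by positivity)
  have k1' : ∫ w, K.ks s (x - w) = 1 := by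
    have := K.mol_const hs (1:ℝ) x
    simpa [Kern.mol] using this
  have ik : Integrable (fun w => K.ks s (x - w)) := k1.continuous.integrable_of_hasCompactSupport k2
  have ie : Integrable (fun w => K.ks s (x - w) * en (g w)) := bdd_smul_int k1.continuous k2 H.en_int
  have Q : ∫ w, K.ks s (x - w) * en (g w) ≤ (s ^ n)⁻¹ * C * ∫ w in ball x s, en (g w) := by
    rw [← integral_const_mul, ← integral_indicator measurableSet_ball]
    refine integral_mono ie ((integrable_indicator_iff measurableSet_ball).2
      (H.en_int.integrableOn.const_mul _)) fun w => ?_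
    simp only
    by_cases h : w ∈ ball x s
    · rw [indicator_of_mem h]; exact mul_le_mul_of_nonneg_right (kle w) (en_nonneg _)
    · rw [indicator_of_notMem h, image_eq_zero_of_notMem_tsupport (f := fun w => K.ks s (x - w))
        (fun h' => h (k3 h')), zero_mul]
  refine le_trans ?_ Q
  obtain ⟨m, hm⟩ : ∃ m, m = ‖K.mol s g x‖ := ⟨_, rfl⟩
  rw [← hm]
  have m0 : 0 ≤ m := hm ▸ norm_nonneg _
  rcases m0.eq_or_lt with h | h
  · rw [← h]; simp only [ne_eq, OfNat.ofNat_ne_zero, not_false_eq_true, zero_pow]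
    exact integral_nonneg fun w => mul_nonneg (kpos w) (en_nonneg _)
  have : m ≤ ∫ w, (m / 2 * K.ks s (x - w) + (2 * m)⁻¹ * (K.ks s (x - w) * en (g w))) := by
    rw [hm]
    refine norm_integral_le_of_norm_le (iadd (ik.const_mul _) (ie.const_mul _)) (ae_of_all _ fun w => ?_)
    rw [← hm, norm_smul, Real.norm_eq_abs, abs_of_nonneg (kpos w)]
    have h1 : ‖g w‖ ≤ m / 2 + (2 * m)⁻¹ * en (g w) := by
      have := le_en (g w)
      have h2 : m / 2 + (2 * m)⁻¹ * en (g w) = (m ^ 2 + en (g w)) / (2 * m) := by field_simp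
      rw [h2, le_div_iff₀ (by positivity)]
      nlinarith [sq_nonneg (m - ‖g w‖)]
    calc _ ≤ K.ks s (x - w) * (m / 2 + (2 * m)⁻¹ * en (g w)) := by
          gcongr
          exact kpos w
      _ = _ := by ring
  rw [integral_add (ik.const_mul _) (ie.const_mul _), integral_const_mul, integral_const_mul, k1'] at this
  have h2 : m / 2 * 1 + (2 * m)⁻¹ * ∫ w, K.ks s (x - w) * en (g w) =
    (m ^ 2 + ∫ w, K.ks s (x - w) * en (g w)) / (2 * m) := by field_simp
  rw [h2, le_div_iff₀ (by positivity)] at this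
  nlinarith

theorem vol_ball {n : ℕ} (z : Eu n) {r : ℝ} (hr : 0 < r) :
    (volume (ball z r)).toReal = r ^ n * (volume (ball (0 : Eu n) 1)).toReal := by
  have := Measure.addHaar_ball_of_pos (volume : Measure (Eu n)) z hr
  rw [this, ENNReal.toReal_mul, ENNReal.toReal_ofReal (by positivity)]
  simp [finrank_euclideanSpace]

theorem LocMin.osc {n p : ℕ} (K : Kern n) {C : ℝ} (hC1 : 1 ≤ C) (hC : ∀ x, |K.Ψ x| ≤ C)
    (hC' : ∀ x, |K.η x| ≤ C) {y : Eu n} {R : ℝ} (hR : 0 < R)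
    {u : Eu n → Eu p} {g : Eu n → (Eu n →L[ℝ] Eu p)} (H : LocMin y R u g) {r θ κ : ℝ} {z : Eu n}
    (hr : 0 < r) (hz : ball z r ⊆ ball y R) (hθ : 0 < θ) (hθ1 : θ ≤ 1/4) (hκ : 0 < κ) (hκ1 : κ ≤ 1/4) :
    ∫ x in ball z (θ * r), ‖u x - K.mol (r / 2) u z‖ ^ 2 ≤
      3 * ((κ * r) ^ 2 * (∫ x in ball z r, en (g x)) + (θ * r) ^ n * (volume (ball (0 : Eu n) 1)).toReal *
        ((((κ * r) ^ n)⁻¹ * r ^ 2 * C * (∫ x in ball z r, en (g x))) ^ 2 +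
          (θ * r) ^ 2 * (((r / 2) ^ n)⁻¹ * C * (∫ x in ball z r, en (g x))))) := by
  obtain ⟨I, hI⟩ : ∃ I, I = ∫ x in ball z r, en (g x) := ⟨_, rfl⟩
  rw [← hI]
  have I0 : 0 ≤ I := hI ▸ integral_nonneg fun x => en_nonneg _
  have hκr : 0 < κ * r := by positivity
  have inc : ∀ x ∈ ball z (θ * r), ∀ s ≤ r / 2, ball x s ⊆ ball z r := by
    intro x hx s hs
    refine ball_subset_ball' ?_
    have := mem_ball.1 hx
    nlinarith
  have mu : ∀ x ∈ ball z (θ * r), ∀ s ≤ r / 2, ∫ w in ball x s, en (g w) ≤ I := fun x hx s hs =>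
    hI ▸ ball_mono H.en_int.integrableOn (fun x => en_nonneg _) (inc x hx s hs)
  have zin : z ∈ ball z (θ * r) := mem_ball_self (by positivity)
  have t2 : ∀ x ∈ ball z (θ * r), ‖K.mol (κ * r) u x - K.mol (r / 2) u x‖ ≤
      ((κ * r) ^ n)⁻¹ * r ^ 2 * C * I := by
    intro x hx
    have := Convex.norm_image_sub_le_of_norm_hasDerivWithin_le (f := fun s => K.mol s u x)
      (f' := fun s => (-(((s ^ n)⁻¹ * s) • ∫ w, K.psi s x w • en (g w) • u w)))
      (s := Icc (κ * r) (r / 2)) (C := ((κ * r) ^ n)⁻¹ * r * (C * I)) (x := r / 2) (y := κ * r)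
      (fun s hs => (H.mol_d K hR (hκr.trans_le hs.1) ((inc x hx s hs.2).trans hz)).hasDerivWithinAt)
      (fun s hs => by
        have s0 : 0 < s := hκr.trans_le hs.1
        rw [norm_neg, norm_smul, Real.norm_eq_abs, abs_of_nonneg (by positivity)]
        have h1 := H.mol_d_le K hC s0 x
        have h2 := mu x hx s hs.2
        have h3 : ‖∫ w, K.psi s x w • en (g w) • u w‖ ≤ C * I := h1.trans (by gcongr)
        have h4 := hs.1
        have h5 : s ≤ r := by linarith [hs.2]
        gcongr) (convex_Icc _ _) (right_mem_Icc.2 (by nlinarith)) (left_mem_Icc.2 (by nlinarith))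
    refine this.trans ?_
    have : ‖κ * r - r / 2‖ ≤ r := by
      rw [Real.norm_eq_abs, abs_le]; constructor <;> nlinarith
    calc _ ≤ ((κ * r) ^ n)⁻¹ * r * (C * I) * r := by gcongr
      _ = _ := by ring
  have t3 : ∀ x ∈ ball z (θ * r), ‖K.mol (r / 2) u x - K.mol (r / 2) u z‖ ^ 2 ≤
      (θ * r) ^ 2 * (((r / 2) ^ n)⁻¹ * C * I) := by
    intro x hx
    have hd := (K.mol_contDiff (half_pos hr) H.W.iu.locallyIntegrable).differentiable (by simp)
    have := Convex.norm_image_sub_le_of_norm_fderiv_le (𝕜 := ℝ) (f := K.mol (r / 2) u)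
      (s := ball z (θ * r)) (C := √(((r / 2) ^ n)⁻¹ * C * I)) (x := z) (y := x) (fun w _ => hd w)
      (fun w hw => by
        rw [K.mol_grad H.W (half_pos hr) ((inc w hw _ le_rfl).trans hz)]
        refine Real.le_sqrt_of_sq_le ((H.mol_g_le K hC' (half_pos hr) w).trans ?_)
        have := mu w hw _ le_rfl
        gcongr) (convex_ball _ _) zin hx
    calc _ ≤ (√(((r / 2) ^ n)⁻¹ * C * I) * (θ * r)) ^ 2 := by
          gcongr
          refine this.trans ?_
          gcongr
          rw [← dist_eq_norm]; exact (mem_ball.1 hx).le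
      _ = _ := by rw [mul_pow, Real.sq_sqrt (by positivity)]; ring
  have mm := K.mol_meas hκr H.W.iu
  have i1 : Integrable (fun x => ‖K.mol (κ * r) u x - u x‖ ^ 2) :=
    ((K.mol_memLp hκr H.W.iu H.hu).sub H.hu).integrable_norm_pow (by norm_num)
  have t1 : ∫ x in ball z (θ * r), ‖K.mol (κ * r) u x - u x‖ ^ 2 ≤ (κ * r) ^ 2 * I := by
    have h := K.mol_close H.W H.hu hκr (a := θ * r) (b := r) (by nlinarith) hz
    rw [← ENNReal.ofReal_le_ofReal_iff (by positivity),
      ofReal_integral_eq_lintegral_ofReal i1.integrableOn (ae_of_all _ fun x => by positivity),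
      ENNReal.ofReal_mul (by positivity), ENNReal.ofReal_pow hκr.le, hI,
      ofReal_integral_eq_lintegral_ofReal H.en_int.integrableOn (ae_of_all _ fun x => en_nonneg _)]
    refine le_trans (le_of_eq ?_) (h.trans ?_)
    · refine lintegral_congr fun x => ?_
      rw [ENNReal.ofReal_pow (norm_nonneg _), ofReal_norm]
    · gcongr with x
      rw [← ofReal_norm, ← ENNReal.ofReal_pow (norm_nonneg _)]
      exact ENNReal.ofReal_le_ofReal (le_en _)
  obtain ⟨D, hD⟩ : ∃ D, D = (((κ * r) ^ n)⁻¹ * r ^ 2 * C * I) ^ 2 + (θ * r) ^ 2 * (((r / 2) ^ n)⁻¹ * C * I) :=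
    ⟨_, rfl⟩
  rw [← hD]
  have fin : IsFiniteMeasure (volume.restrict (ball z (θ * r))) :=
    ⟨by rw [Measure.restrict_apply_univ]; exact measure_ball_lt_top⟩
  calc _ ≤ ∫ x in ball z (θ * r), (3 * ‖K.mol (κ * r) u x - u x‖ ^ 2 + 3 * D) := by
        refine setIntegral_mono_on (H.uc_int _ z _) (iadd (i1.const_mul 3).integrableOn
          (integrable_const _)) measurableSet_ball fun x hx => ?_
        have e : u x - K.mol (r / 2) u z = -(K.mol (κ * r) u x - u x) +
          (K.mol (κ * r) u x - K.mol (r / 2) u x) + (K.mol (r / 2) u x - K.mol (r / 2) u z) := by abel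
        have h1 := norm_add₃_le (a := -(K.mol (κ * r) u x - u x))
          (b := (K.mol (κ * r) u x - K.mol (r / 2) u x)) (c := (K.mol (r / 2) u x - K.mol (r / 2) u z))
        rw [← e, norm_neg] at h1
        have h2 : ‖K.mol (κ * r) u x - K.mol (r / 2) u x‖ ^ 2 ≤ (((κ * r) ^ n)⁻¹ * r ^ 2 * C * I) ^ 2 := by
          gcongr; exact t2 x hx
        have h3 := t3 x hx
        rw [hD]
        generalize ‖K.mol (κ * r) u x - u x‖ = A1 at *
        generalize ‖K.mol (κ * r) u x - K.mol (r / 2) u x‖ = A2 at *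
        generalize ‖K.mol (r / 2) u x - K.mol (r / 2) u z‖ = A3 at *
        have := pow_le_pow_left₀ (norm_nonneg _) h1 2
        nlinarith [sq_nonneg (A1 - A2), sq_nonneg (A2 - A3), sq_nonneg (A1 - A3)]
    _ ≤ _ := by
      rw [integral_add (i1.const_mul 3).integrableOn (integrable_const _), integral_const_mul,
        setIntegral_const, Measure.real, vol_ball z (by positivity), smul_eq_mul]
      nlinarith

theorem en_int0 {n p : ℕ} (g : Eu n → (Eu n →L[ℝ] Eu p)) (s : Set (Eu n)) : 0 ≤ ∫ x in s, en (g x) :=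
  integral_nonneg fun x => en_nonneg (g x)

theorem step_alg {a b X Y T r m C1 C v κ I : ℝ} (ha : 0 < a) (hb : 0 < b) (hX : 0 < X) (hY : 0 < Y)
    (hT : 0 < T) (hr : 0 < r) :
    a * b * ((a * 2)⁻¹ * m + C1 / (r ^ 2 / (2 * T) ^ 2) * (3 * (κ ^ 2 * r ^ 2 * I + X / b * v *
      (((Y * X)⁻¹ * r ^ 2 * C * I) ^ 2 + r ^ 2 / T ^ 2 * ((X / a)⁻¹ * C * I))))) = b * m / 2 +
      (12 * a * b * T ^ 2 * C1 * κ ^ 2 * I +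
       12 * a * C1 * v * C ^ 2 * T ^ 2 * (Y⁻¹) ^ 2 * (r ^ 2 * I * X⁻¹) * I + 12 * a * C1 * v * a * C * I) := by
  field_simp
  ring

theorem one_step {n p : ℕ} (hp : 3 ≤ p) (K : Kern n) : ∃ A : ℝ, 0 ≤ A ∧ ∀ T0 : ℝ, 1 ≤ T0 → ∃ ε : ℝ, 0 < ε ∧
    ∀ (y : Eu n) (R : ℝ) (u : Eu n → Eu p) (g : Eu n → (Eu n →L[ℝ] Eu p)), 0 < R → LocMin y R u g →
    ∀ (z : Eu n) (r : ℝ), 0 < r → closedBall z r ⊆ ball y R →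
    r ^ 2 * (∫ x in ball z r, en (g x)) ≤ ε * r ^ n → ∀ T, 4 ≤ T → T ≤ T0 →
    (2 * T) ^ n * (∫ x in ball z (r / (2 * T)), en (g x)) ≤
      T ^ n * (∫ x in ball z (r / T), en (g x)) / 2 + (A + 2) * ∫ x in ball z r, en (g x) := by
  obtain ⟨C1, C10, hc⟩ := cacc (n := n) hp (ε := (2 ^ (n + 1))⁻¹) (t := 1) (s := 2) (by positivity)
    one_pos (by norm_num)
  obtain ⟨C, hC1, hη, hΨ, -⟩ := K.bounds
  obtain ⟨v0, hv0⟩ : ∃ v0, v0 = (volume (ball (0 : Eu n) 1)).toReal := ⟨_, rfl⟩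
  have v1p : 0 ≤ v0 := hv0 ▸ ENNReal.toReal_nonneg
  have C0 : 0 < C := by linarith
  refine ⟨12 * 2 ^ n * C1 * v0 * 2 ^ n * C, by positivity, fun T0 hT0 => ?_⟩
  have T00 : 0 < T0 := by linarith
  obtain ⟨Q, hQ⟩ : ∃ Q, Q = 12 * 2 ^ n * T0 ^ n * T0 ^ 2 * (C1 + 1) := ⟨_, rfl⟩
  have Q1 : 1 ≤ Q := by
    have h1 : (1 : ℝ) ≤ 2 ^ n := one_le_pow₀ (by norm_num)
    have h2 : (1 : ℝ) ≤ T0 ^ n := one_le_pow₀ hT0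
    have h3 : (1 : ℝ) ≤ T0 ^ 2 := one_le_pow₀ hT0
    have h4 := one_le_mul_of_one_le_of_one_le (one_le_mul_of_one_le_of_one_le h1 h2) h3
    rw [hQ]; nlinarith
  obtain ⟨κ, hκ⟩ : ∃ κ, κ = (4 * Q)⁻¹ := ⟨_, rfl⟩
  have κ0 : 0 < κ := by rw [hκ]; positivity
  have κ1 : κ ≤ 1 / 4 := by rw [hκ, inv_le_comm₀ (by positivity) (by norm_num)]; linarith
  have κQ : Q * κ ^ 2 ≤ 1 := by
    have : Q * κ = 1 / 4 := by rw [hκ]; field_simp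
    nlinarith
  obtain ⟨P, hP⟩ : ∃ P, P = 12 * 2 ^ n * C1 * v0 * C ^ 2 * T0 ^ 2 * ((κ ^ n)⁻¹) ^ 2 := ⟨_, rfl⟩
  have P0 : 0 ≤ P := by rw [hP]; positivity
  refine ⟨(P + 1)⁻¹, by positivity, fun y R u g hR H z r hr hz hsm T hT hTT => ?_⟩
  have Tp : 0 < T := by linarith
  have hz' : ball z r ⊆ ball y R := ball_subset_closedBall.trans hz
  have ho := H.osc K hC1 hΨ hη hR hr hz' (θ := T⁻¹) (κ := κ) (by positivity)
    (by rw [inv_le_comm₀ Tp (by norm_num)]; linarith) κ0 κ1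
  have hca := hc K y R u g H z (r / (2 * T)) (K.mol (r / 2) u z) (by positivity)
    ((closedBall_subset_closedBall (by
      rw [mul_div_assoc', div_le_iff₀ (by positivity)]; nlinarith)).trans hz)
    (K.mol_norm_le (half_pos hr) H.W.iu H.ub z)
  rw [one_mul, show 2 * (r / (2 * T)) = r / T by field_simp] at hca
  rw [show T⁻¹ * r = r / T by field_simp, ← hv0] at ho
  obtain ⟨I, hI⟩ : ∃ I, I = ∫ x in ball z r, en (g x) := ⟨_, rfl⟩
  have I0 : 0 ≤ I := hI ▸ integral_nonneg fun x => en_nonneg _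
  rw [← hI] at ho hsm ⊢
  have h := hca.trans (add_le_add le_rfl (mul_le_mul_of_nonneg_left ho (by positivity)))
  generalize (∫ x in ball z (r / T), en (g x)) = m at h ⊢
  refine (mul_le_mul_of_nonneg_left h (by positivity)).trans ?_
  have e1 : (2 * T) ^ n * ((2 ^ (n + 1))⁻¹ * m + C1 / (r / (2 * T)) ^ 2 *
      (3 * ((κ * r) ^ 2 * I + (r / T) ^ n * v0 * ((((κ * r) ^ n)⁻¹ * r ^ 2 * C * I) ^ 2 +
      (r / T) ^ 2 * (((r / 2) ^ n)⁻¹ * C * I))))) = T ^ n * m / 2 +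
      (12 * 2 ^ n * T ^ n * T ^ 2 * C1 * κ ^ 2 * I +
       12 * 2 ^ n * C1 * v0 * C ^ 2 * T ^ 2 * ((κ ^ n)⁻¹) ^ 2 * (r ^ 2 * I * (r ^ n)⁻¹) * I +
       12 * 2 ^ n * C1 * v0 * 2 ^ n * C * I) := by
    rw [mul_pow 2 T n, mul_pow κ r 2, mul_pow κ r n, div_pow r T, div_pow r T, div_pow r (2 * T), div_pow r 2, pow_succ]
    exact step_alg (by positivity) (by positivity) (by positivity) (by positivity) Tp hr
  rw [e1]
  have a1 : 12 * 2 ^ n * T ^ n * T ^ 2 * C1 * κ ^ 2 * I ≤ I := by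
    have : 12 * 2 ^ n * T ^ n * T ^ 2 * C1 * κ ^ 2 ≤ 1 := by
      refine le_trans ?_ κQ
      rw [hQ]; gcongr; linarith
    exact mul_le_of_le_one_left I0 this
  have a2 : 12 * 2 ^ n * C1 * v0 * C ^ 2 * T ^ 2 * ((κ ^ n)⁻¹) ^ 2 * (r ^ 2 * I * (r ^ n)⁻¹) * I ≤ I := by
    have h1 : r ^ 2 * I * (r ^ n)⁻¹ ≤ (P + 1)⁻¹ := by
      rw [← div_eq_mul_inv, div_le_iff₀ (by positivity)]; exact hsm
    have h2 : 12 * 2 ^ n * C1 * v0 * C ^ 2 * T ^ 2 * ((κ ^ n)⁻¹) ^ 2 ≤ P := by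
      rw [hP]; gcongr
    have : 12 * 2 ^ n * C1 * v0 * C ^ 2 * T ^ 2 * ((κ ^ n)⁻¹) ^ 2 * (r ^ 2 * I * (r ^ n)⁻¹) ≤ 1 := by
      calc _ ≤ P * (P + 1)⁻¹ := by gcongr
        _ ≤ 1 := by rw [← div_eq_mul_inv, div_le_one (by positivity)]; linarith
    exact mul_le_of_le_one_left I0 this
  linarith

theorem decay_step {n p : ℕ} (hp : 3 ≤ p) (K : Kern n) : ∃ M : ℕ, 0 < M ∧ ∃ ε : ℝ, 0 < ε ∧
    ∀ (y : Eu n) (R : ℝ) (u : Eu n → Eu p) (g : Eu n → (Eu n →L[ℝ] Eu p)), 0 < R → LocMin y R u g →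
    ∀ (z : Eu n) (r : ℝ), 0 < r → closedBall z r ⊆ ball y R →
    r ^ 2 * (∫ x in ball z r, en (g x)) ≤ ε * r ^ n →
    (4 ^ M) ^ n * (∫ x in ball z (r / 4 ^ M), en (g x)) ≤ 2 ^ M * ∫ x in ball z r, en (g x) := by
  obtain ⟨A, A0, h⟩ := one_step (n := n) (p := p) hp K
  obtain ⟨B, hB⟩ : ∃ B : ℝ, B = 4 ^ n + 2 * (A + 2) := ⟨_, rfl⟩
  obtain ⟨M, hM⟩ := pow_unbounded_of_one_lt B (one_lt_two : (1 : ℝ) < 2)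
  obtain ⟨ε, ε0, h⟩ := h (4 ^ (M + 1)) (one_le_pow₀ (by norm_num))
  refine ⟨M + 1, by omega, ε, ε0, fun y R u g hR H z r hr hz hsm => ?_⟩
  have h := h y R u g hR H z r hr hz hsm
  obtain ⟨I, hI⟩ : ∃ I, I = ∫ x in ball z r, en (g x) := ⟨_, rfl⟩
  have I0 : 0 ≤ I := hI ▸ integral_nonneg fun x => en_nonneg _
  rw [← hI] at h hsm ⊢
  have key : ∀ k : ℕ, k ≤ 2 * M → (2 ^ (k + 2)) ^ n * (∫ x in ball z (r / 2 ^ (k + 2)), en (g x)) ≤ B * I := by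
    intro k
    induction k with
    | zero =>
      intro _
      have h1 : ∫ x in ball z (r / 2 ^ (0 + 2)), en (g x) ≤ I := hI ▸ ball_mono H.en_int.integrableOn
        (fun x => en_nonneg _) (ball_subset_ball (div_le_self hr.le (by norm_num)))
      calc _ ≤ (2 ^ (0 + 2)) ^ n * I := by gcongr
        _ ≤ _ := by rw [hB]; norm_num; nlinarith
    | succ k ih =>
      intro hk
      have h1 := h (2 ^ (k + 2)) (by rw [pow_add]; have : (1 : ℝ) ≤ 2 ^ k := one_le_pow₀ (by norm_num)
                                     linarith)
        (by rw [show (4 : ℝ) = 2 ^ 2 by norm_num, ← pow_mul]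
            exact pow_le_pow_right₀ (by norm_num) (by omega))
      rw [← pow_succ'] at h1
      have := ih (by omega)
      rw [show k + 1 + 2 = k + 2 + 1 by ring]
      have h4 : (0 : ℝ) ≤ 4 ^ n := by positivity
      nlinarith
  have h1 := key (2 * M) le_rfl
  rw [show 2 * M + 2 = 2 * (M + 1) by ring, pow_mul, show (2 : ℝ) ^ 2 = 4 by norm_num] at h1
  refine h1.trans ?_
  gcongr
  rw [pow_succ]
  have : (0 : ℝ) < 2 ^ M := by positivity
  linarith

theorem morrey3 {n p : ℕ} (hp : 3 ≤ p) (K : Kern n) {y : Eu n} {R : ℝ} (hR : 0 < R) {u : Eu n → Eu p}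
    {g : Eu n → (Eu n →L[ℝ] Eu p)} (H : LocMin y R u g)
    (hd : ∀ ε > 0, ∃ r > 0, r < R ∧ r ^ 2 * (∫ x in ball y r, en (g x)) ≤ ε * r ^ n) :
    ∃ r0 > 0, 2 * r0 < R ∧ ∃ Λ ≥ 0, ∀ z ∈ ball y r0, ∀ ρ, 0 < ρ → ρ ≤ r0 →
      √ρ * (∫ x in ball z ρ, en (g x)) ≤ Λ * ρ ^ n := by
  obtain ⟨M, M0, ε, ε0, h⟩ := decay_step (n := n) (p := p) hp K
  obtain ⟨r, r0, rR, hs⟩ := hd (ε / 2 ^ n) (by positivity)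
  have hy0 := en_int0 g (ball y r)
  have mono : ∀ a b : Set (Eu n), a ⊆ b → ∫ x in a, en (g x) ≤ ∫ x in b, en (g x) := fun a b hab =>
    ball_mono H.en_int.integrableOn (fun x => en_nonneg _) hab
  obtain ⟨s, hsr⟩ : ∃ s, r = 2 * s := ⟨r / 2, by ring⟩
  have s0 : 0 < s := by linarith
  subst hsr
  obtain ⟨F, hF⟩ : ∃ F, F = √s * (∫ x in ball y (2 * s), en (g x)) / s ^ n := ⟨_, rfl⟩
  have F0 : 0 ≤ F := by rw [hF]; positivity
  obtain ⟨τ, hτ⟩ : ∃ τ : ℝ, τ = (4 ^ M)⁻¹ := ⟨_, rfl⟩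
  have τ0 : 0 < τ := by rw [hτ]; positivity
  have τ1 : τ < 1 := by rw [hτ]; exact inv_lt_one_of_one_lt₀ (one_lt_pow₀ (by norm_num) M0.ne')
  have τ2 : √τ * 2 ^ M = 1 := by
    have : τ = ((2 ^ M)⁻¹) ^ 2 := by rw [hτ, inv_pow, ← pow_mul, mul_comm, pow_mul]; norm_num
    rw [this, Real.sqrt_sq (by positivity)]; field_simp
  have τ3 : τ ^ 2 * 2 ^ M ≤ 1 := by
    have : τ * 2 ^ M ≤ 1 := by
      rw [hτ, inv_mul_le_iff₀ (by positivity), mul_one]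
      exact pow_le_pow_left₀ (by norm_num) (by norm_num) _
    nlinarith
  refine ⟨s, s0, rR, F * (τ ^ n)⁻¹, by positivity, fun z hz ρ ρ0 ρs => ?_⟩
  have key : ∀ j : ℕ, (τ ^ j * s) ^ 2 * (∫ x in ball z (τ ^ j * s), en (g x)) ≤ ε * (τ ^ j * s) ^ n ∧
      √(τ ^ j * s) * (∫ x in ball z (τ ^ j * s), en (g x)) ≤ F * (τ ^ j * s) ^ n := by
    intro j
    induction j with
    | zero =>
      have h1 := mono (ball z s) (ball y (2 * s)) (ball_subset_ball' (by have := mem_ball.1 hz; linarith))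
      have h2 := en_int0 g (ball z s)
      rw [pow_zero, one_mul]
      constructor
      · rw [mul_pow, mul_pow 2 s n, ← mul_assoc, div_mul_cancel₀ _ (by positivity)] at hs
        refine le_trans ?_ hs
        gcongr
        nlinarith
      · rw [hF, div_mul_cancel₀ _ (by positivity)]
        gcongr
    | succ j ih =>
      obtain ⟨t, ht⟩ : ∃ t, t = τ ^ j * s := ⟨_, rfl⟩
      rw [show τ ^ (j + 1) * s = τ * t by rw [ht]; ring]
      rw [← ht] at ih
      have t0 : 0 < t := by rw [ht]; positivity
      have ts : t ≤ s := by rw [ht]; have := pow_le_one₀ τ0.le τ1.le (n := j); nlinarith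
      have h1 := h y R u g hR H z t t0 (closedBall_subset_ball' (by have := mem_ball.1 hz; linarith)) ih.1
      rw [show t / 4 ^ M = τ * t by rw [hτ]; field_simp] at h1
      have h2 : ∫ x in ball z (τ * t), en (g x) ≤ τ ^ n * 2 ^ M * ∫ x in ball z t, en (g x) := by
        rw [hτ, inv_pow, mul_assoc, le_inv_mul_iff₀ (by positivity), ← hτ]; exact h1
      have h3 := en_int0 g (ball z t)
      constructor
      · calc _ ≤ (τ * t) ^ 2 * (τ ^ n * 2 ^ M * ∫ x in ball z t, en (g x)) := by gcongr
          _ = (τ ^ 2 * 2 ^ M) * τ ^ n * (t ^ 2 * ∫ x in ball z t, en (g x)) := by ring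
          _ ≤ 1 * τ ^ n * (ε * t ^ n) := mul_le_mul (by gcongr) ih.1 (by positivity) (by positivity)
          _ = _ := by ring
      · calc _ ≤ √(τ * t) * (τ ^ n * 2 ^ M * ∫ x in ball z t, en (g x)) := by gcongr
          _ = (√τ * 2 ^ M) * τ ^ n * (√t * ∫ x in ball z t, en (g x)) := by
            rw [Real.sqrt_mul τ0.le]; ring
          _ ≤ 1 * τ ^ n * (F * t ^ n) := by rw [τ2]; exact mul_le_mul_of_nonneg_left ih.2 (by positivity)
          _ = _ := by ring
  obtain ⟨j, hj1, hj2⟩ := exists_nat_pow_near_of_lt_one (x := ρ / s) (by positivity)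
    (by rw [div_le_one s0]; exact ρs) τ0 τ1
  rw [lt_div_iff₀ s0] at hj1
  rw [div_le_iff₀ s0] at hj2
  have h0 := en_int0 g (ball z ρ)
  calc _ ≤ √(τ ^ j * s) * (∫ x in ball z (τ ^ j * s), en (g x)) := by
        exact mul_le_mul (by gcongr) (mono _ _ (ball_subset_ball hj2)) h0 (by positivity)
    _ ≤ F * (τ ^ j * s) ^ n := (key j).2
    _ = F * (τ ^ n)⁻¹ * (τ ^ (j + 1) * s) ^ n := by
      rw [pow_succ', mul_assoc τ, mul_pow τ]; field_simp
    _ ≤ _ := by gcongr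

theorem WGI.clm {n : ℕ} {V W : Type*} [NormedAddCommGroup V] [NormedSpace ℝ V] [CompleteSpace V]
    [NormedAddCommGroup W] [NormedSpace ℝ W] [CompleteSpace W] {U : Set (Eu n)} {u : Eu n → V}
    {g : Eu n → (Eu n →L[ℝ] V)} (H : WGI U u g) (L : V →L[ℝ] W) :
    WGI U (fun x => L (u x)) (fun x => L.comp (g x)) where
  iu := L.integrable_comp H.iu
  ig := ((ContinuousLinearMap.compL ℝ (Eu n) V W) L).integrable_comp H.ig
  ibp := by
    intro φ hφ hc hs e
    obtain ⟨f1, f2, -⟩ := test_facts hφ hc e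
    have h := congrArg L (H.ibp φ hφ hc hs e)
    rw [map_neg, ← L.integral_comp_comm (bdd_smul_int f1 f2 H.iu),
      ← L.integral_comp_comm (bdd_smul_int hφ.continuous hc (H.ig.apply_continuousLinearMap e))] at h
    simpa using h

theorem mem2_pair {α F G : Type*} [MeasurableSpace α] {μ : Measure α} [NormedAddCommGroup F]
    [NormedAddCommGroup G] {a : α → F} {b : α → G} (ha : MemLp a 2 μ) (hb : MemLp b 2 μ) {T : α → ℝ}
    (hT : AEStronglyMeasurable T μ) (h : ∀ x, ‖T x‖ ≤ ‖a x‖ * ‖b x‖) : Integrable T μ :=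
  (MemLp.integrable_mul (p := 2) (q := 2) ha.norm hb.norm).mono' hT (ae_of_all _ h)

theorem snd_facts {n : ℕ} {V : Type*} [NormedAddCommGroup V] [NormedSpace ℝ V] {φ : Eu n → V}
    (hφ : ContDiff ℝ ∞ φ) (x v w : Eu n) :
    HasFDerivAt (fun x => fderiv ℝ φ x v) ((fderiv ℝ (fderiv ℝ φ) x).flip v) x ∧
    fderiv ℝ (fun x => fderiv ℝ φ x v) x w = fderiv ℝ (fderiv ℝ φ) x w v ∧
    fderiv ℝ (fderiv ℝ φ) x v w = fderiv ℝ (fderiv ℝ φ) x w v := by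
  have h1 : HasFDerivAt (fun x => fderiv ℝ φ x v) ((fderiv ℝ (fderiv ℝ φ) x).flip v) x :=
    (((hφ.fderiv_right (m := ∞) (by simp)).differentiable (by simp) x).hasFDerivAt.clm_apply
      (hasFDerivAt_const v x)).congr_fderiv (by ext; simp)
  refine ⟨h1, by rw [h1.fderiv]; rfl, ?_⟩
  have h2 : ContDiff ℝ 2 φ := hφ.of_le (WithTop.coe_le_coe.2 (le_top : (2 : ℕ∞) ≤ ⊤))
  exact (h2.contDiffAt.isSymmSndFDerivAt (by simp)) v w

theorem closed2 {n : ℕ} (K : Kern n) {U : Set (Eu n)} (hU : IsOpen U) {a b : Eu n → ℝ}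
    {α β : Eu n → (Eu n →L[ℝ] ℝ)}
    (Ha : WGI U a α) (Hb : WGI U b β) (ha : MemLp a 2) (hα : MemLp α 2) (hβ : MemLp β 2)
    {ψ : Eu n → ℝ} (hψ : ContDiff ℝ ∞ ψ) (hc : HasCompactSupport ψ) (hs : tsupport ψ ⊆ U) (e f : Eu n) :
    Integrable (fun x => (fderiv ℝ ψ x e * β x f - fderiv ℝ ψ x f * β x e) * a x +
      ψ x * (β x f * α x e - β x e * α x f)) ∧
    ∫ x, ((fderiv ℝ ψ x e * β x f - fderiv ℝ ψ x f * β x e) * a x +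
      ψ x * (β x f * α x e - β x e * α x f)) = 0 := by
  obtain ⟨T, hT⟩ : ∃ T : Eu n → (Eu n →L[ℝ] ℝ) → ℝ, T = fun x B =>
    (fderiv ℝ ψ x e * B f - fderiv ℝ ψ x f * B e) * a x + ψ x * (B f * α x e - B e * α x f) := ⟨_, rfl⟩
  obtain ⟨C1, hC1⟩ := hψ.continuous.bounded_above_of_compact_support hc
  obtain ⟨C2, hC2⟩ := (hψ.continuous_fderiv (by simp)).bounded_above_of_compact_support (hc.fderiv ℝ)
  obtain ⟨c, hcd⟩ : ∃ c, c = 2 * (C1 + C2) * ‖e‖ * ‖f‖ := ⟨_, rfl⟩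
  have C10 : 0 ≤ C1 := (norm_nonneg _).trans (hC1 0)
  have C20 : 0 ≤ C2 := (norm_nonneg _).trans (hC2 0)
  have hA : MemLp (fun x => c * (‖a x‖ + ‖α x‖)) 2 := (ha.norm.add hα.norm).const_mul c
  have Tb : ∀ x B, ‖T x B‖ ≤ ‖c * (‖a x‖ + ‖α x‖)‖ * ‖B‖ := by
    intro x B
    have q : ∀ (A : Eu n →L[ℝ] ℝ) v, |A v| ≤ ‖A‖ * ‖v‖ := fun A v => A.le_opNorm v
    have m1 : ∀ (A A' : Eu n →L[ℝ] ℝ) v w, |A v * A' w| ≤ ‖A‖ * ‖v‖ * (‖A'‖ * ‖w‖) := fun A A' v w => by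
      rw [abs_mul]; exact mul_le_mul (q _ _) (q _ _) (abs_nonneg _) (by positivity)
    have m2 : ∀ (A A' : Eu n →L[ℝ] ℝ), |A e * A' f - A f * A' e| ≤ 2 * ‖A‖ * ‖A'‖ * ‖e‖ * ‖f‖ := fun A A' => by
      have h1 := abs_sub (A e * A' f) (A f * A' e)
      have h2 := m1 A A' e f
      have h3 := m1 A A' f e
      nlinarith
    rw [hT, Real.norm_eq_abs, Real.norm_of_nonneg (by rw [hcd]; positivity)]
    refine (abs_add_le _ _).trans ?_
    rw [abs_mul, abs_mul]
    have h1 := m2 (fderiv ℝ ψ x) B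
    have h2 := m2 (α x) B
    have e2 : B f * α x e - B e * α x f = α x e * B f - α x f * B e := by ring
    rw [e2]
    calc _ ≤ (2 * C2 * ‖B‖ * ‖e‖ * ‖f‖) * |a x| + C1 * (2 * ‖α x‖ * ‖B‖ * ‖e‖ * ‖f‖) := by
          gcongr
          · exact h1.trans (by gcongr; exact hC2 x)
          · exact hC1 x
      _ ≤ _ := by
        rw [hcd, Real.norm_eq_abs]
        have p1 : 0 ≤ C1 * ‖e‖ * ‖f‖ * ‖B‖ * |a x| := by positivity
        have p2 : 0 ≤ C2 * ‖e‖ * ‖f‖ * ‖B‖ * ‖α x‖ := by positivity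
        nlinarith
  have mT : ∀ B : Eu n → (Eu n →L[ℝ] ℝ), AEStronglyMeasurable B → AEStronglyMeasurable fun x => T x (B x) := by
    intro B hB
    have k1 := fun v => (hψ.continuous_fderiv (by simp)).aestronglyMeasurable (μ := volume).apply_continuousLinearMap v
    have k2 := hψ.continuous.aestronglyMeasurable (μ := volume)
    have k3 := fun v => hB.apply_continuousLinearMap v
    have k4 := fun v => hα.1.apply_continuousLinearMap v
    rw [hT]
    exact ((((k1 e).mul (k3 f)).sub ((k1 f).mul (k3 e))).mul ha.1).add
      (k2.mul (((k3 f).mul (k4 e)).sub ((k3 e).mul (k4 f))))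
  have iT : ∀ B : Eu n → (Eu n →L[ℝ] ℝ), MemLp B 2 → Integrable fun x => T x (B x) := fun B hB =>
    mem2_pair hA hB (mT B hB.1) fun x => Tb x (B x)
  have main : ∫ x, T x (β x) = 0 := by
    have lim := pair_tendsto hA (f := fun s x => K.mol s β x - β x) (l := 𝓝[>] (0 : ℝ))
      (by filter_upwards [self_mem_nhdsWithin] with s hs using (K.mol_meas hs Hb.ig).sub hβ.1)
      (K.mol_eLp_tendsto Hb.ig hβ) (T := fun s x => T x (K.mol s β x - β x))
      (Eventually.of_forall fun s => ae_of_all _ fun x => Tb x _)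
    obtain ⟨δ, δ0, hδ⟩ := hc.isCompact.exists_thickening_subset_open hU hs
    have ev : ∀ᶠ s in 𝓝[>] (0 : ℝ), ∫ x, T x (K.mol s β x - β x) = - ∫ x, T x (β x) := by
      filter_upwards [Ioo_mem_nhdsGT δ0] with s hs0
      have bs := K.mol_contDiff hs0.1 Hb.iu.locallyIntegrable
      obtain ⟨d, hd⟩ : ∃ d, d = K.mol s b := ⟨_, rfl⟩
      rw [← hd] at bs
      have z : ∫ x, T x (K.mol s β x) = 0 := by
        have cd : ∀ v, ContDiff ℝ ∞ fun x => fderiv ℝ d x v := fun v =>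
          (bs.fderiv_right (m := ∞) (by simp)).clm_apply contDiff_const
        have c1 : ∀ v, ContDiff ℝ ∞ fun x => ψ x * fderiv ℝ d x v := fun v => hψ.mul (cd v)
        have c2 : ∀ v, HasCompactSupport fun x => ψ x * fderiv ℝ d x v := fun v => hc.mul_right
        have c3 : ∀ v, tsupport (fun x => ψ x * fderiv ℝ d x v) ⊆ tsupport ψ := fun v => tsupport_mul_subset_left
        have i1 : ∀ v w, Integrable fun x => fderiv ℝ (fun x => ψ x * fderiv ℝ d x v) x w • a x := fun v w =>
          bdd_smul_int (test_facts (c1 v) (c2 v) w).1 (test_facts (c1 v) (c2 v) w).2.1 Ha.iu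
        have i2 : ∀ v w, Integrable fun x => (ψ x * fderiv ℝ d x v) • α x w := fun v w =>
          bdd_smul_int (c1 v).continuous (c2 v) (Ha.ig.apply_continuousLinearMap w)
        have key : ∀ v w, ∫ x, (fderiv ℝ (fun x => ψ x * fderiv ℝ d x v) x w • a x +
            (ψ x * fderiv ℝ d x v) • α x w) = 0 := fun v w => by
          rw [integral_add (i1 v w) (i2 v w), Ha.ibp _ (c1 v) (c2 v) ((c3 v).trans hs) w]; simp
        have := integral_sub (iadd (i1 f e) (i2 f e)) (iadd (i1 e f) (i2 e f))
        rw [key, key, sub_zero] at this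
        rw [← this]
        congr 1; funext x
        have pr : ∀ v w, fderiv ℝ (fun x => ψ x * fderiv ℝ d x v) x w =
            fderiv ℝ ψ x w * fderiv ℝ d x v + ψ x * fderiv ℝ (fderiv ℝ d) x w v := by
          intro v w
          rw [show fderiv ℝ (fun x => ψ x * fderiv ℝ d x v) x = _ from
            ((hψ.differentiable (by simp) x).hasFDerivAt.mul (snd_facts bs x v w).1).fderiv]
          simp; ring
        have sy : fderiv ℝ (fderiv ℝ d) x e f = fderiv ℝ (fderiv ℝ d) x f e :=
          (snd_facts bs x e f).2.2
        rw [pr, pr, sy]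
        by_cases hx : x ∈ tsupport ψ
        · have : ball x s ⊆ U := fun w hw => hδ (mem_thickening_iff.2 ⟨x, hx, (mem_ball.1 hw).trans hs0.2⟩)
          rw [← K.mol_grad Hb hs0.1 this, ← hd, hT]
          simp only [smul_eq_mul]; ring
        · have tf := test_facts hψ hc e
          rw [hT]; simp [tf.2.2.2.1 x hx, tf.2.2.2.2 x hx]
      rw [← zero_sub, ← z, ← integral_sub (iT _ (K.mol_memLp hs0.1 Hb.ig hβ)) (iT _ hβ)]
      congr 1; funext x
      rw [hT]; simp only [sub_apply]; ring
    have := tendsto_nhds_unique (lim.congr' ev) tendsto_const_nhds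
    linarith
  rw [hT] at main
  exact ⟨by have := iT β hβ; rwa [hT] at this, main⟩

/-- angular form -/
def om {n : ℕ} (u : Eu n → Eu 2) (g : Eu n → (Eu n →L[ℝ] Eu 2)) (e x : Eu n) : ℝ :=
  u x 0 * g x e 1 - u x 1 * g x e 0

section
variable {n : ℕ} (K : Kern n) {y : Eu n} {R : ℝ} {u : Eu n → Eu 2} {g : Eu n → (Eu n →L[ℝ] Eu 2)}
  (H : LocMin y R u g)
include H

theorem om_mem (e : Eu n) : MemLp (om u g e) 2 ∧ Integrable (om u g e) := by
  have mu : ∀ k, AEStronglyMeasurable fun x => u x k := fun k =>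
    (EuclideanSpace.proj (𝕜 := ℝ) k).continuous.comp_aestronglyMeasurable H.hu.1
  have mg : ∀ k, AEStronglyMeasurable fun x => g x e k := fun k =>
    (EuclideanSpace.proj (𝕜 := ℝ) k).continuous.comp_aestronglyMeasurable (H.hg.1.apply_continuousLinearMap e)
  have m : AEStronglyMeasurable (om u g e) := ((mu 0).mul (mg 1)).sub ((mu 1).mul (mg 0))
  have b : ∀ᵐ x, ‖om u g e x‖ ≤ 2 * ‖e‖ * ‖g x‖ := by
    filter_upwards [H.ub] with x hx
    have h1 : ∀ k, |u x k| ≤ 1 := fun k => (PiLp.norm_apply_le (u x) k).trans hx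
    have h2 : ∀ k, |g x e k| ≤ ‖g x‖ * ‖e‖ := fun k => (PiLp.norm_apply_le (g x e) k).trans ((g x).le_opNorm e)
    have h3 := abs_sub (u x 0 * g x e 1) (u x 1 * g x e 0)
    rw [abs_mul, abs_mul] at h3
    have h4 := mul_le_mul (h1 0) (h2 1) (abs_nonneg _) zero_le_one
    have h5 := mul_le_mul (h1 1) (h2 0) (abs_nonneg _) zero_le_one
    unfold om
    rw [Real.norm_eq_abs]; linarith
  exact ⟨(H.hg.norm.const_mul (2 * ‖e‖)).mono' m b, (H.W.ig.norm.const_mul (2 * ‖e‖)).mono' m b⟩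

variable {φ : Eu n → ℝ} (hφ : ContDiff ℝ ∞ φ) (hc : HasCompactSupport φ) (hs : tsupport φ ⊆ ball y R)
include K hφ hc hs

theorem om_closed (e f : Eu n) : ∫ x, (fderiv ℝ φ x e * om u g f x - fderiv ℝ φ x f * om u g e x) = 0 := by
  have mu := fun k => H.hu.continuousLinearMap_comp (EuclideanSpace.proj k : Eu 2 →L[ℝ] ℝ)
  have mg := fun k => H.hg.continuousLinearMap_comp ((ContinuousLinearMap.compL ℝ (Eu n) _ _)
    (EuclideanSpace.proj k : Eu 2 →L[ℝ] ℝ))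
  have A := fun k j : Fin 2 => closed2 K isOpen_ball (H.W.clm (EuclideanSpace.proj k : Eu 2 →L[ℝ] ℝ))
    (H.W.clm (EuclideanSpace.proj j : Eu 2 →L[ℝ] ℝ))
    (mu k) (mg k) (mg j) hφ hc hs e f
  have h := integral_sub (A 0 1).1 (A 1 0).1
  rw [(A 0 1).2, (A 1 0).2, sub_zero] at h
  rw [← h]
  refine integral_congr_ae ?_
  filter_upwards [H.u1, H.ug K] with x h1 h2
  by_cases hx : x ∈ tsupport φ
  · have e1 := (sum_facts (u x) (u x)).2
    rw [h1 (hs hx)] at e1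
    have e2 := h2 (hs hx) e
    have e3 := h2 (hs hx) f
    rw [← (sum_facts _ _).1] at e2 e3
    simp only [Fin.sum_univ_two] at e1 e2 e3
    have e4 : g x e 0 * g x f 1 - g x e 1 * g x f 0 = 0 := by
      linear_combination (-(g x e 0 * g x f 1 - g x e 1 * g x f 0)) * e1 + (u x 0 * g x f 1 - u x 1 * g x f 0) * e2 +
        (u x 1 * g x e 0 - u x 0 * g x e 1) * e3
    simp only [om, ContinuousLinearMap.comp_apply, show ∀ (k : Fin 2) (v : Eu 2), (EuclideanSpace.proj k : Eu 2 →L[ℝ] ℝ) v = v k from fun _ _ => rfl]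
    linear_combination (-2 * φ x) * e4
  · have tf := test_facts hφ hc e
    simp [tf.2.2.2.1 x hx, tf.2.2.2.2 x hx]

theorem om_coclosed (hR : 0 < R) : ∫ x, ∑ i, fderiv ℝ φ x (bv n i) * om u g (bv n i) x = 0 := by
  obtain ⟨σ, ⟨hσ, hσR⟩, hs'⟩ := exists_pos_lt_subset_ball hR hc.isClosed hs
  have z : ∀ x, x ∉ closedBall y σ → φ x = 0 ∧ fderiv ℝ φ x = 0 := fun x hx => by
    have hx : x ∉ tsupport φ := fun h => hx (ball_subset_closedBall (hs' h))
    have tf := test_facts hφ hc 0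
    exact ⟨tf.2.2.2.1 x hx, tf.2.2.2.2 x hx⟩
  have key := (H.vary K (skw_sk 0 1) (skw_cu 0 1) (a := fun q => φ q.1) ((hφ.of_le (by simp)).comp contDiff_fst) hσ
    (show σ < (σ + R) / 2 by linarith) (by linarith) (fun x hx v => (z x hx).1)).2
  have fd : ∀ (q d : Eu n × Eu 2), fderiv ℝ (fun q : Eu n × Eu 2 => φ q.1) q d = fderiv ℝ φ q.1 d.1 := by
    intro q d
    have h1 : HasFDerivAt (fun q : Eu n × Eu 2 => φ q.1)
        ((fderiv ℝ φ q.1).comp (ContinuousLinearMap.fst ℝ _ _)) q :=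
      ((hφ.differentiable (by simp)) q.1).hasFDerivAt.comp q hasFDerivAt_fst
    rw [h1.fderiv]; rfl
  simp only [fd, skw_inner] at key
  rw [← key, ← setIntegral_eq_integral_of_forall_compl_eq_zero (s := ball y ((σ + R) / 2))]
  · rfl
  · intro x hx
    have := (z x fun h => hx (closedBall_subset_ball (by linarith) h)).2
    simp [this]

theorem om_harm (hR : 0 < R) (e : Eu n) : ∫ x, lap φ x • om u g e x = 0 := by
  have c1 : ∀ v, ContDiff ℝ ∞ fun x => fderiv ℝ φ x v := fun v =>
    (hφ.fderiv_right (m := ∞) (by simp)).clm_apply contDiff_const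
  have tf := fun v => test_facts hφ hc v
  have s1 := fun v => (tf v).2.2.1.trans hs
  have it : ∀ v w f, Integrable fun x => fderiv ℝ (fun x => fderiv ℝ φ x v) x w * om u g f x := fun v w f =>
    bdd_smul_int (test_facts (c1 v) (tf v).2.1 w).1 (test_facts (c1 v) (tf v).2.1 w).2.1 (om_mem H f).2
  have cl := fun v f => om_closed K H (c1 v) (tf v).2.1 (s1 v) v f
  have co := om_coclosed K H (c1 e) (tf e).2.1 (s1 e) hR
  have := integral_finsetSum (μ := volume) Finset.univ fun i (_ : i ∈ Finset.univ) =>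
    (it (bv n i) (bv n i) e).sub (it (bv n i) e (bv n i))
  simp only [Pi.sub_apply, fun i => cl (bv n i) e, Finset.sum_const_zero, Finset.sum_sub_distrib] at this
  rw [integral_sub (integrable_finsetSum _ fun i _ => it _ _ _) (integrable_finsetSum _ fun i _ => it _ _ _)] at this
  have sy : ∀ x i, fderiv ℝ (fun x => fderiv ℝ φ x (bv n i)) x e = fderiv ℝ (fun x => fderiv ℝ φ x e) x (bv n i) := by
    intro x i
    rw [(snd_facts hφ x _ e).2.1, (snd_facts hφ x _ _).2.1]
    exact (snd_facts hφ x _ _).2.2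
  simp only [sy] at this
  rw [co, sub_zero] at this
  simpa only [lap, smul_eq_mul, Finset.sum_mul] using this
end

theorem morrey2 {n : ℕ} (K : Kern n) {y : Eu n} {R : ℝ} (hR : 0 < R) {u : Eu n → Eu 2}
    {g : Eu n → (Eu n →L[ℝ] Eu 2)} (H : LocMin y R u g) :
    ∃ r0 > 0, 2 * r0 < R ∧ ∃ Λ ≥ 0, ∀ z ∈ ball y r0, ∀ ρ, 0 < ρ → ρ ≤ r0 →
      √ρ * (∫ x in ball z ρ, en (g x)) ≤ Λ * ρ ^ n := by
  have cst : ∀ e : Eu n, ∃ L, ∀ᵐ x, x ∈ ball y (R / 2) → |om u g e x| ≤ L := by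
    intro e
    obtain ⟨m2, m1⟩ := om_mem H e
    obtain ⟨L, hL⟩ := (K.ks_smooth (R / 2)).continuous.bounded_above_of_compact_support (K.ks_cs (half_pos hR))
    refine ⟨L * ∫ x, ‖om u g e x‖, ?_⟩
    obtain ⟨s, s0, sl, hs⟩ := K.mol_seq m1 m2
    filter_upwards [hs] with x hx hxy
    have e1 : ∀ t, 0 < t → t ≤ R / 2 → K.mol t (om u g e) x = K.mol (R / 2) (om u g e) x := by
      intro t t0 tR
      have := Convex.norm_image_sub_le_of_norm_hasDerivWithin_le (f := fun s => K.mol s (om u g e) x)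
        (f' := fun s => (((s ^ n)⁻¹ * s) • ∫ y, lap (K.psi s x) y • om u g e y))
        (s := Icc t (R / 2)) (C := 0) (x := R / 2) (y := t)
        (fun s hs => (K.mol_deriv (t0.trans_le hs.1) m1 x).hasDerivWithinAt)
        (fun s hs => by
          obtain ⟨q1, q2, q3⟩ := K.psi_test (t0.trans_le hs.1) x
          rw [om_harm K H q1 q2 (q3.trans (ball_subset_ball' (by have := mem_ball.1 hxy; linarith [hs.2]))) hR e]
          simp) (convex_Icc _ _) (right_mem_Icc.2 tR) (left_mem_Icc.2 tR)
      rw [zero_mul, norm_le_zero_iff, sub_eq_zero] at this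
      exact this
    have e2 : om u g e x = K.mol (R / 2) (om u g e) x := by
      refine tendsto_nhds_unique hx (tendsto_const_nhds.congr' ?_)
      filter_upwards [sl (Ioo_mem_nhdsGT (half_pos hR))] with k hk
      exact (e1 _ hk.1 hk.2.le).symm
    rw [e2, Kern.mol, ← Real.norm_eq_abs, ← integral_const_mul]
    refine norm_integral_le_of_norm_le (m1.norm.const_mul L) (ae_of_all _ fun w => ?_)
    rw [norm_smul]; gcongr; exact hL _
  choose L hL using fun i : Fin n => cst (bv n i)
  obtain ⟨Q, hQ⟩ : ∃ Q, Q = ∑ i, L i ^ 2 := ⟨_, rfl⟩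
  have Q0 : 0 ≤ Q := by rw [hQ]; positivity
  have eb : ∀ᵐ x, x ∈ ball y (R / 2) → en (g x) ≤ Q := by
    filter_upwards [H.u1, H.ug K, ae_all_iff.2 hL] with x h1 h2 h3 hx
    have hx' := ball_subset_ball (show R / 2 ≤ R by linarith) hx
    rw [en, hQ]
    refine Finset.sum_le_sum fun i _ => ?_
    have e1 := (sum_facts (u x) (u x)).2
    rw [h1 hx'] at e1
    have e2 := h2 hx' (bv n i)
    rw [← (sum_facts _ _).1] at e2
    rw [← (sum_facts _ (u x)).2]
    simp only [Fin.sum_univ_two] at e1 e2 ⊢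
    have e3 : g x (bv n i) 0 ^ 2 + g x (bv n i) 1 ^ 2 = om u g (bv n i) x ^ 2 := by
      unfold om
      linear_combination (-(g x (bv n i) 0 ^ 2 + g x (bv n i) 1 ^ 2)) * e1 + (u x 0 * g x (bv n i) 0 + u x 1 * g x (bv n i) 1) * e2
    rw [e3]
    exact sq_le_sq' (abs_le.1 (h3 i hx)).1 (abs_le.1 (h3 i hx)).2
  refine ⟨R / 4, by positivity, by linarith, √R * Q * (volume (ball (0 : Eu n) 1)).toReal, by positivity,
    fun z hz ρ ρ0 ρR => ?_⟩
  have sub : ball z ρ ⊆ ball y (R / 2) := ball_subset_ball' (by have := mem_ball.1 hz; linarith)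
  have fin : IsFiniteMeasure (volume.restrict (ball z ρ)) :=
    ⟨by rw [Measure.restrict_apply_univ]; exact measure_ball_lt_top⟩
  have h1 : ∫ x in ball z ρ, en (g x) ≤ ∫ x in ball z ρ, Q := by
    refine setIntegral_mono_on_ae H.en_int.integrableOn (integrable_const _) measurableSet_ball ?_
    filter_upwards [eb] with x hx hxz using hx (sub hxz)
  rw [setIntegral_const, Measure.real, vol_ball z ρ0, smul_eq_mul] at h1
  have h2 : √ρ ≤ √R := Real.sqrt_le_sqrt (by linarith)
  calc _ ≤ √R * (ρ ^ n * (volume (ball (0 : Eu n) 1)).toReal * Q) :=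
        mul_le_mul h2 h1 (en_int0 g _) (by positivity)
    _ = _ := by ring

theorem lemQ {V : Type*} [NormedAddCommGroup V] [NormedSpace ℝ V] {F F' : ℝ → V} {r M : ℝ}
    (hF : ∀ s, 0 < s → s ≤ r → HasDerivAt F (F' s) s) (hM : ∀ s, 0 < s → s ≤ r → ‖F' s‖ ≤ M / √s)
    {a b : ℝ} (ha : 0 < a) (hab : a ≤ b) (hb : b ≤ r) : ‖F b - F a‖ ≤ 2 * M * √b := by
  have hM0 : 0 ≤ M := by
    have := (norm_nonneg _).trans (hM b (ha.trans_le hab) hb)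
    have h2 := Real.sqrt_pos.2 (ha.trans_le hab)
    by_contra hc
    exact absurd this (not_le.2 (div_neg_of_neg_of_pos (not_le.1 hc) h2))
  have := image_norm_le_of_norm_deriv_right_le_deriv_boundary' (f := fun s => F s - F a) (f' := F')
    (a := a) (b := b) (B := fun s => 2 * M * (√s - √a)) (B' := fun s => M / √s)
    (fun s hs => ((hF s (ha.trans_le hs.1) (hs.2.trans hb)).continuousAt.sub
      continuousAt_const).continuousWithinAt)
    (fun s hs => ((hF s (ha.trans_le hs.1) (hs.2.le.trans hb)).sub_const _).hasDerivWithinAt)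
    (by simp) (Continuous.continuousOn (by fun_prop))
    (fun s hs => by
      have h0 : 0 < s := ha.trans_le hs.1
      have := ((Real.hasDerivAt_sqrt h0.ne').sub_const (√a)).const_mul (2 * M)
      refine (this.congr_deriv ?_).hasDerivWithinAt
      have := Real.sqrt_pos.2 h0
      field_simp)
    (fun s hs => hM s (ha.trans_le hs.1) (hs.2.le.trans hb)) (right_mem_Icc.2 hab)
  refine this.trans ?_
  gcongr
  have := Real.sqrt_nonneg a
  linarith

theorem lemLim {W : Type*} [NormedAddCommGroup W] [CompleteSpace W] {φ : ℝ → W} {r c : ℝ} (hr : 0 < r)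
    (h : ∀ a b, 0 < a → a ≤ b → b ≤ r → ‖φ b - φ a‖ ≤ c * √b) :
    ∃ l, Tendsto φ (𝓝[>] 0) (𝓝 l) ∧ ∀ b, 0 < b → b ≤ r → ‖φ b - l‖ ≤ c * √b := by
  have hc : 0 ≤ c := by
    have := (norm_nonneg _).trans (h r r hr le_rfl le_rfl)
    exact nonneg_of_mul_nonneg_left this (Real.sqrt_pos.2 hr)
  have hca : Cauchy (map φ (𝓝[>] 0)) := by
    rw [Metric.cauchy_iff]
    refine ⟨inferInstance, fun ε hε => ?_⟩
    have ht : Tendsto (fun b => c * √b) (𝓝[>] (0:ℝ)) (𝓝 0) := by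
      have : Continuous (fun b => c * √b) := by fun_prop
      simpa using (this.tendsto 0).mono_left nhdsWithin_le_nhds
    have hS := (ht.eventually (gt_mem_nhds hε)).and (Ioo_mem_nhdsGT hr)
    refine ⟨φ '' {b | c * √b < ε ∧ b ∈ Ioo 0 r}, image_mem_map hS, ?_⟩
    rintro _ ⟨a, ha, rfl⟩ _ ⟨b, hb, rfl⟩
    rcases le_total a b with hab | hab
    · rw [dist_comm, dist_eq_norm]; exact (h a b ha.2.1 hab hb.2.2.le).trans_lt hb.1
    · rw [dist_eq_norm]; exact (h b a hb.2.1 hab ha.2.2.le).trans_lt ha.1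
  obtain ⟨l, hl⟩ := cauchy_map_iff_exists_tendsto.1 hca
  refine ⟨l, hl, fun b hb hbr => ?_⟩
  refine le_of_tendsto (tendsto_const_nhds.sub hl).norm ?_
  filter_upwards [Ioo_mem_nhdsGT hb] with a ha using h a b ha.1 ha.2.le hbr

theorem lemC1 {n : ℕ} {V : Type*} [NormedAddCommGroup V] [NormedSpace ℝ V] [CompleteSpace V]
    {f k : ℝ → Eu n → V} {r C : ℝ} (hr : 0 < r) (hC0 : 0 ≤ C) {B : Set (Eu n)} (hB : IsOpen B)
    (hf : ∀ s, 0 < s → ContDiff ℝ 1 (f s))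
    (hd : ∀ x ∈ B, ∀ s, 0 < s → s ≤ r → HasDerivAt (fun s => f s x) (k s x) s)
    (h1 : ∀ x ∈ B, ∀ s, 0 < s → s ≤ r → ‖k s x‖ ≤ C / √s)
    (h2 : ∀ x ∈ B, ∀ x' ∈ B, ∀ s, 0 < s → s ≤ r → ‖k s x - k s x'‖ ≤ C * ‖x - x'‖ / √s) :
    ∃ (F : Eu n → V) (G : Eu n → (Eu n →L[ℝ] V)), (∀ x ∈ B, HasFDerivAt F (G x) x) ∧
      ContinuousOn G B ∧ ∀ x ∈ B, Tendsto (fun s => f s x) (𝓝[>] 0) (𝓝 (F x)) ∧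
        Tendsto (fun s => fderiv ℝ (f s) x) (𝓝[>] 0) (𝓝 (G x)) := by
  have A1 : ∀ x ∈ B, ∀ a b, 0 < a → a ≤ b → b ≤ r → ‖f b x - f a x‖ ≤ 2 * C * √b :=
    fun x hx a b ha hab hb => lemQ (hd x hx) (h1 x hx) ha hab hb
  have A2 : ∀ x ∈ B, ∀ a b, 0 < a → a ≤ b → b ≤ r →
      ‖fderiv ℝ (f b) x - fderiv ℝ (f a) x‖ ≤ 2 * C * √b := by
    intro x hx a b ha hab hb
    have e1 := ((hf b (ha.trans_le hab)).differentiable one_ne_zero x).hasFDerivAt.fun_sub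
      ((hf a ha).differentiable one_ne_zero x).hasFDerivAt
    refine e1.le_of_lip' (by positivity) ?_
    filter_upwards [hB.mem_nhds hx] with x' hx'
    have := lemQ (F := fun s => f s x' - f s x) (F' := fun s => k s x' - k s x)
      (M := C * ‖x' - x‖) (r := r) (fun s hs hs' => (hd x' hx' s hs hs').fun_sub (hd x hx s hs hs'))
      (fun s hs hs' => h2 x' hx' x hx s hs hs') ha hab hb
    calc _ = ‖f b x' - f b x - (f a x' - f a x)‖ := by congr 1; abel
      _ ≤ _ := this
      _ = _ := by ring
  have B1 : ∀ x, ∃ l, x ∈ B → Tendsto (fun s => f s x) (𝓝[>] 0) (𝓝 l) := by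
    intro x
    by_cases hx : x ∈ B
    · obtain ⟨l, hl, -⟩ := lemLim hr (A1 x hx)
      exact ⟨l, fun _ => hl⟩
    · exact ⟨0, fun h => absurd h hx⟩
  have B2 : ∀ x, ∃ l, x ∈ B → (Tendsto (fun s => fderiv ℝ (f s) x) (𝓝[>] 0) (𝓝 l) ∧
      ∀ b, 0 < b → b ≤ r → ‖fderiv ℝ (f b) x - l‖ ≤ 2 * C * √b) := by
    intro x
    by_cases hx : x ∈ B
    · obtain ⟨l, hl⟩ := lemLim hr (A2 x hx)
      exact ⟨l, fun _ => hl⟩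
    · exact ⟨0, fun h => absurd h hx⟩
  choose F hF using B1
  choose G hG using B2
  have hU : TendstoUniformlyOn (fun s => fderiv ℝ (f s)) G (𝓝[>] 0) B := by
    rw [Metric.tendstoUniformlyOn_iff]
    intro ε hε
    have ht : Tendsto (fun b => 2 * C * √b) (𝓝[>] (0:ℝ)) (𝓝 0) := by
      have : Continuous (fun b => 2 * C * √b) := by fun_prop
      simpa using (this.tendsto 0).mono_left nhdsWithin_le_nhds
    filter_upwards [ht.eventually (gt_mem_nhds hε), Ioo_mem_nhdsGT hr] with b hb hb' x hx
    rw [dist_comm, dist_eq_norm]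
    exact ((hG x hx).2 b hb'.1 hb'.2.le).trans_lt hb
  refine ⟨F, G, fun x hx => ?_, ?_, fun x hx => ⟨hF x hx, (hG x hx).1⟩⟩
  · refine hasFDerivAt_of_tendstoUniformlyOnFilter (l := 𝓝[>] (0:ℝ)) (f := f)
      (f' := fun s => fderiv ℝ (f s)) (hU.tendstoUniformlyOnFilter.mono_right ?_) ?_ ?_
    · exact le_principal_iff.2 (hB.mem_nhds hx)
    · refine (eventually_prod_iff.2 ⟨fun s => 0 < s, self_mem_nhdsWithin, fun _ => True, by simp,
        fun {s} hs x _ => ((hf s hs).differentiable one_ne_zero x).hasFDerivAt⟩)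
    · filter_upwards [hB.mem_nhds hx] using hF
  · refine hU.continuousOn (Eventually.frequently ?_)
    filter_upwards [self_mem_nhdsWithin] with s hs
    exact ((hf s hs).continuous_fderiv one_ne_zero).continuousOn

/-- kernel estimates -/
theorem kb {n : ℕ} {Ξ : Eu n → ℝ}
    (hz : ∀ x, 3/4 ≤ ‖x‖ → Ξ x = 0) {s : ℝ} (hs : 0 < s) (x w : Eu n)
    (hw : w ∉ ball x s) : Ξ (s⁻¹ • (x - w)) = 0 := by
  apply hz
  rw [norm_smul, norm_inv, Real.norm_of_nonneg hs.le]
  rw [mem_ball, dist_comm, dist_eq_norm, not_lt] at hw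
  calc (3/4:ℝ) ≤ 1 := by norm_num
    _ = s⁻¹ * s := by field_simp
    _ ≤ _ := by gcongr

theorem kd {n : ℕ} {V : Type*} [NormedAddCommGroup V] [NormedSpace ℝ V] {Ξ : Eu n → ℝ} {C : ℝ}
    (hc : Continuous Ξ) (hC : ∀ x, |Ξ x| ≤ C) (hL : ∀ x y, |Ξ x - Ξ y| ≤ C * ‖x - y‖)
    (hz : ∀ x, 3/4 ≤ ‖x‖ → Ξ x = 0) {F : Eu n → V} (hF : Integrable F) {s : ℝ} (hs : 0 < s)
    (x x' : Eu n) :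
    Integrable (fun w => Ξ (s⁻¹ • (x - w)) • F w) ∧
    ‖∫ w, Ξ (s⁻¹ • (x - w)) • F w‖ ≤ C * ∫ w in ball x s, ‖F w‖ ∧
    ‖(∫ w, Ξ (s⁻¹ • (x - w)) • F w) - ∫ w, Ξ (s⁻¹ • (x' - w)) • F w‖ ≤
      C * ‖x - x'‖ / s * ((∫ w in ball x s, ‖F w‖) + ∫ w in ball x' s, ‖F w‖) := by
  have hi : ∀ x, Integrable (fun w => Ξ (s⁻¹ • (x - w)) • F w) := fun x =>
    hF.bdd_smul C (Continuous.aestronglyMeasurable (by fun_prop)) (Eventually.of_forall fun w => hC _)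
  have hI : ∀ x : Eu n, Integrable ((ball x s).indicator fun w => ‖F w‖) := fun x =>
    hF.norm.indicator measurableSet_ball
  have hC0 : 0 ≤ C := (abs_nonneg _).trans (hC 0)
  refine ⟨hi x, ?_, ?_⟩
  · rw [← integral_indicator measurableSet_ball, ← integral_const_mul]
    refine norm_integral_le_of_norm_le ((hI x).const_mul C) (Eventually.of_forall fun w => ?_)
    by_cases hw : w ∈ ball x s
    · rw [indicator_of_mem hw, norm_smul]; gcongr; exact hC _
    · rw [kb hz hs x w hw, indicator_of_notMem hw]; simp
  · rw [← integral_sub (hi x) (hi x'), ← integral_indicator measurableSet_ball,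
      ← integral_indicator measurableSet_ball, ← integral_add (hI x) (hI x'), ← integral_const_mul]
    refine norm_integral_le_of_norm_le (((hI x).add (hI x')).const_mul _)
      (Eventually.of_forall fun w => ?_)
    rw [← sub_smul, norm_smul]
    have e1 : ‖Ξ (s⁻¹ • (x - w)) - Ξ (s⁻¹ • (x' - w))‖ ≤ C * ‖x - x'‖ / s := by
      refine (hL _ _).trans_eq ?_
      rw [← smul_sub, sub_sub_sub_cancel_right, norm_smul, norm_inv, Real.norm_of_nonneg hs.le]
      field_simp
    by_cases hw : w ∈ ball x s
    · refine mul_le_mul e1 ?_ (norm_nonneg _) (by positivity)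
      rw [indicator_of_mem hw]
      exact le_add_of_nonneg_right (indicator_nonneg (fun _ _ => norm_nonneg _) _)
    · by_cases hw' : w ∈ ball x' s
      · refine mul_le_mul e1 ?_ (norm_nonneg _) (by positivity)
        rw [indicator_of_mem hw']
        exact le_add_of_nonneg_left (indicator_nonneg (fun _ _ => norm_nonneg _) _)
      · rw [kb hz hs x w hw, kb hz hs x' w hw', indicator_of_notMem hw,
          indicator_of_notMem hw']
        simp

theorem c1_of {n : ℕ} {V : Type*} [NormedAddCommGroup V] [NormedSpace ℝ V] {F : Eu n → V}
    {G : Eu n → (Eu n →L[ℝ] V)} {B : Set (Eu n)} (hB : IsOpen B) (h : ∀ x ∈ B, HasFDerivAt F (G x) x)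
    (hG : ContinuousOn G B) : ContDiffOn ℝ 1 F B := by
  rw [show (1 : WithTop ℕ∞) = 0 + 1 by simp, contDiffOn_succ_iff_fderiv_of_isOpen hB]
  exact ⟨fun x hx => (h x hx).differentiableAt.differentiableWithinAt, by simp,
    contDiffOn_zero.2 (hG.congr fun x hx => (h x hx).fderiv)⟩

theorem morrey {n p : ℕ} (hp : 2 ≤ p) (K : Kern n) {y : Eu n} {R : ℝ} (hR : 0 < R) {u : Eu n → Eu p}
    {g : Eu n → (Eu n →L[ℝ] Eu p)} (H : LocMin y R u g)
    (hd : ∀ ε > 0, ∃ r > 0, r < R ∧ r ^ 2 * (∫ x in ball y r, en (g x)) ≤ ε * r ^ n) :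
    ∃ r0 > 0, 2 * r0 < R ∧ ∃ Λ ≥ 0, ∀ z ∈ ball y r0, ∀ ρ, 0 < ρ → ρ ≤ r0 →
      √ρ * (∫ x in ball z ρ, en (g x)) ≤ Λ * ρ ^ n := by
  rcases hp.lt_or_eq with h | rfl
  · exact morrey3 h K hR H hd
  · exact morrey2 K hR H

theorem u_c1 {n p : ℕ} (K : Kern n) {y : Eu n} {R : ℝ} (hR : 0 < R) {u : Eu n → Eu p}
    {g : Eu n → (Eu n →L[ℝ] Eu p)} (H : LocMin y R u g) {r0 Λ : ℝ} (hr : 0 < r0) (hr2 : 2 * r0 < R)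
    (hΛ : 0 ≤ Λ) (hM : ∀ z ∈ ball y r0, ∀ ρ, 0 < ρ → ρ ≤ r0 →
      √ρ * (∫ x in ball z ρ, en (g x)) ≤ Λ * ρ ^ n) :
    ∃ F : Eu n → Eu p, ContDiffOn ℝ 1 F (ball y r0) ∧ (∀ᵐ x, x ∈ ball y r0 → u x = F x) ∧
      ∀ᵐ x, x ∈ ball y r0 → g x = fderiv ℝ F x := by
  obtain ⟨C, hC1, -, hCΨ, -, -, hCL, -⟩ := K.bounds
  have hC0 : 0 ≤ C := by linarith
  have hsub : ∀ x ∈ ball y r0, ∀ s, s ≤ r0 → ball x s ⊆ ball y R := fun x hx s hs =>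
    ball_subset_ball' (by rw [mem_ball] at hx; linarith)
  have hF : ∀ x ∈ ball y r0, ∀ s, 0 < s → s ≤ r0 →
      ∫ w in ball x s, ‖en (g w) • u w‖ ≤ Λ * s ^ n / √s := by
    intro x hx s hs hs'
    rw [le_div_iff₀ (Real.sqrt_pos.2 hs), mul_comm]
    refine le_trans ?_ (hM x hx s hs hs')
    refine mul_le_mul_of_nonneg_left ?_ (Real.sqrt_nonneg s)
    refine setIntegral_mono_ae H.eu_int.norm.integrableOn H.en_int.integrableOn ?_
    filter_upwards [H.ub] with w hw
    rw [norm_smul, Real.norm_of_nonneg (en_nonneg _)]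
    exact mul_le_of_le_one_right (en_nonneg _) hw
  obtain ⟨F, G, hFG, hG, hT⟩ := lemC1 (f := fun s => K.mol s u)
    (k := fun s x => -(((s ^ n)⁻¹ * s) • ∫ w, K.psi s x w • en (g w) • u w)) (r := r0)
    (C := C * Λ * (r0 + 2)) hr (by positivity) (isOpen_ball (x := y) (ε := r0))
    (fun s hs => (K.mol_contDiff hs H.W.iu.locallyIntegrable).of_le (by simp))
    (fun x hx s hs hs' => H.mol_d K hR hs (hsub x hx s hs'))
    (fun x hx s hs hs' => by
      have h1 := (kd K.Ψ_smooth.continuous hCΨ hCL K.Ψ_zero H.eu_int hs x x).2.1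
      have h2 := hF x hx s hs hs'
      have h3 := Real.sqrt_pos.2 hs
      rw [norm_neg, norm_smul, Real.norm_of_nonneg (by positivity)]
      calc _ ≤ (s ^ n)⁻¹ * s * (C * (Λ * s ^ n / √s)) := by
            refine mul_le_mul_of_nonneg_left (h1.trans (mul_le_mul_of_nonneg_left h2 hC0)) (by positivity)
        _ = C * Λ * s / √s := by field_simp
        _ ≤ _ := by gcongr; linarith)
    (fun x hx x' hx' s hs hs' => by
      have h1 := (kd K.Ψ_smooth.continuous hCΨ hCL K.Ψ_zero H.eu_int hs x x').2.2
      have h2 := hF x hx s hs hs'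
      have h2' := hF x' hx' s hs hs'
      have h3 := Real.sqrt_pos.2 hs
      rw [← neg_add', norm_neg, ← smul_neg, ← smul_add, norm_smul, Real.norm_of_nonneg (by positivity),
        ← sub_eq_add_neg]
      calc _ ≤ (s ^ n)⁻¹ * s * (C * ‖x - x'‖ / s * (Λ * s ^ n / √s + Λ * s ^ n / √s)) := by
            refine mul_le_mul_of_nonneg_left (h1.trans (mul_le_mul_of_nonneg_left
              (add_le_add h2 h2') (by positivity))) (by positivity)
        _ = C * Λ * 2 * ‖x - x'‖ / √s := by field_simp; ring
        _ ≤ _ := by gcongr; linarith)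
  refine ⟨F, c1_of isOpen_ball hFG hG, ?_, ?_⟩
  · obtain ⟨s, hs, hst, hae⟩ := K.mol_seq H.W.iu H.hu
    filter_upwards [hae] with x hx hxy
    exact tendsto_nhds_unique hx ((hT x hxy).1.comp hst)
  · obtain ⟨s, hs, hst, hae⟩ := K.mol_seq H.W.ig H.hg
    filter_upwards [hae] with x hx hxy
    rw [(hFG x hxy).fderiv]
    refine tendsto_nhds_unique hx (((hT x hxy).2.comp hst).congr' ?_)
    filter_upwards [hst.eventually (Ioo_mem_nhdsGT hr)] with k hk
    exact K.mol_grad H.W (hs k) (hsub x hxy _ hk.2.le)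

/-- weak solutions of the Poisson equation -/
def Sol {n : ℕ} {V : Type*} [NormedAddCommGroup V] [NormedSpace ℝ V] (U : Set (Eu n))
    (v f : Eu n → V) : Prop :=
  ∀ φ : Eu n → ℝ, ContDiff ℝ ∞ φ → HasCompactSupport φ → tsupport φ ⊆ U →
    ∫ x, lap φ x • v x = ∫ x, φ x • f x

theorem d_smooth {n : ℕ} {φ : Eu n → ℝ} (hφ : ContDiff ℝ ∞ φ) (e : Eu n) :
    ContDiff ℝ ∞ (fun x => fderiv ℝ φ x e) :=
  (hφ.fderiv_right (m := ∞) (by simp)).clm_apply contDiff_const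

theorem lap_facts {n : ℕ} {φ : Eu n → ℝ} (hφ : ContDiff ℝ ∞ φ) (hc : HasCompactSupport φ) :
    ContDiff ℝ ∞ (lap φ) ∧ tsupport (lap φ) ⊆ tsupport φ ∧ HasCompactSupport (lap φ) ∧
    ∀ e, (fun x => fderiv ℝ (lap φ) x e) = lap (fun x => fderiv ℝ φ x e) := by
  have h1 : ∀ i, ContDiff ℝ ∞ (fun z => fderiv ℝ φ z (bv n i)) := fun i => d_smooth hφ _
  have h2 : ∀ i, ContDiff ℝ ∞ (fun x => fderiv ℝ (fun z => fderiv ℝ φ z (bv n i)) x (bv n i)) :=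
    fun i => d_smooth (h1 i) _
  have h3 : tsupport (lap φ) ⊆ tsupport φ := by
    refine closure_minimal (fun x hx => ?_) isClosed_closure
    by_contra h
    refine hx ?_
    refine Finset.sum_eq_zero fun i _ => ?_
    have t1 := test_facts hφ hc (bv n i)
    rw [(test_facts (h1 i) t1.2.1 0).2.2.2.2 x (fun h' => h (t1.2.2.1 h'))]
    simp
  refine ⟨ContDiff.sum fun i _ => h2 i, h3, hc.mono' (subset_closure.trans h3), fun e => ?_⟩
  funext x
  have e0 : lap φ = fun x => ∑ i, fderiv ℝ (fun z => fderiv ℝ φ z (bv n i)) x (bv n i) := rfl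
  rw [e0, fderiv_fun_sum fun i _ => (h2 i).differentiable (by simp) x]
  simp only [sum_apply, lap]
  refine Finset.sum_congr rfl fun i _ => ?_
  have e1 : (fun z => fderiv ℝ (fun x => fderiv ℝ φ x e) z (bv n i)) =
      fun z => fderiv ℝ (fun x => fderiv ℝ φ x (bv n i)) z e := by
    funext z
    rw [(snd_facts hφ z e (bv n i)).2.1, (snd_facts hφ z (bv n i) e).2.1, (snd_facts hφ z e (bv n i)).2.2]
  rw [e1, (snd_facts (h1 i) x (bv n i) e).2.1, (snd_facts (h1 i) x e (bv n i)).2.1,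
    (snd_facts (h1 i) x e (bv n i)).2.2]

section
variable {n : ℕ} {V : Type*} [NormedAddCommGroup V] [NormedSpace ℝ V] {U : Set (Eu n)} {v f : Eu n → V}

theorem c1_facts (hU : IsOpen U) (hv : ContDiffOn ℝ 1 v U) :
    ContinuousOn v U ∧ ContinuousOn (fderiv ℝ v) U ∧ ∀ x ∈ U, DifferentiableAt ℝ v x :=
  ⟨hv.continuousOn, hv.continuousOn_fderiv_of_isOpen hU le_rfl,
    fun x hx => (hv.differentiableOn one_ne_zero x hx).differentiableAt (hU.mem_nhds hx)⟩

theorem ibpU (hU : IsOpen U) (hv : ContDiffOn ℝ 1 v U) {φ : Eu n → ℝ} (hφ : ContDiff ℝ ∞ φ)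
    (hc : HasCompactSupport φ) (hs : tsupport φ ⊆ U) (e : Eu n) :
    ∫ x, (fderiv ℝ φ x e) • v x = - ∫ x, φ x • fderiv ℝ v x e := by
  obtain ⟨c1, c2, d1⟩ := c1_facts hU hv
  have t := test_facts hφ hc e
  rw [integral_smul_fderiv_eq_neg_fderiv_smul_of_integrable, neg_neg]
  · exact int_test (c1.locallyIntegrableOn hU.measurableSet) t.1 t.2.1 (t.2.2.1.trans hs)
  · exact int_test ((c2.clm_apply continuousOn_const).locallyIntegrableOn hU.measurableSet)
      hφ.continuous hc hs
  · exact int_test (c1.locallyIntegrableOn hU.measurableSet) hφ.continuous hc hs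
  · exact fun x _ => hφ.differentiable (by simp) x
  · exact fun x hx => d1 x (hs hx)

theorem sol_de (hU : IsOpen U) (hv : ContDiffOn ℝ 1 v U) (hS : Sol U v f) {φ : Eu n → ℝ}
    (hφ : ContDiff ℝ ∞ φ) (hc : HasCompactSupport φ) (hs : tsupport φ ⊆ U) (e : Eu n) :
    ∫ x, lap φ x • fderiv ℝ v x e = - ∫ x, (fderiv ℝ φ x e) • f x := by
  obtain ⟨l1, l2, l3, l4⟩ := lap_facts hφ hc
  have t := test_facts hφ hc e
  have h1 := ibpU hU hv l1 l3 (l2.trans hs) e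
  have h2 := hS _ (d_smooth hφ e) t.2.1 (t.2.2.1.trans hs)
  rw [← l4 e, h1] at h2
  rw [← h2, neg_neg]

theorem ball_int {x : Eu n} {s M : ℝ} (hs : 0 < s) (h : ∀ w ∈ ball x s, ‖f w‖ ≤ M) :
    ∫ w in ball x s, ‖f w‖ ≤ M * (volume (ball (0 : Eu n) 1)).toReal * s ^ n := by
  have := norm_setIntegral_le_of_norm_le_const (μ := volume) (f := fun w => ‖f w‖) (C := M) (s := ball x s)
    measure_ball_lt_top (fun w hw => by simpa using h w hw)
  rw [Measure.real, vol_ball x hs] at this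
  refine (Real.le_norm_self _).trans (this.trans_eq (by ring))

theorem mol_cont [CompleteSpace V] (K : Kern n) {h : Eu n → V} (hh : Integrable h) {x : Eu n}
    (hx : ContinuousAt h x) : Tendsto (fun s => K.mol s h x) (𝓝[>] 0) (𝓝 (h x)) := by
  obtain ⟨C, hC1, hC, -⟩ := K.bounds
  rw [Metric.tendsto_nhds]
  intro ε hε
  obtain ⟨v0, hv0⟩ : ∃ v0, v0 = (volume (ball (0 : Eu n) 1)).toReal := ⟨_, rfl⟩
  have hv : 0 ≤ v0 := hv0 ▸ ENNReal.toReal_nonneg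
  obtain ⟨δ, hδ, hd⟩ := Metric.continuousAt_iff.1 hx (ε / (C * v0 + 1)) (by positivity)
  filter_upwards [Ioo_mem_nhdsGT hδ] with s hs
  have hs0 := hs.1
  have kz : ∀ w, w ∉ ball x s → K.ks s (x - w) = 0 := fun w hw => by
    rw [Kern.ks, kb K.η_zero hs0 x w hw, mul_zero]
  have kc : Continuous fun w => K.ks s (x - w) := (K.ks_test hs0 x).1.continuous
  have i1 : Integrable fun w => K.ks s (x - w) • h w := bdd_smul_int kc (K.ks_test hs0 x).2.1 hh
  have i2 : Integrable fun w => K.ks s (x - w) • h x :=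
    (kc.integrable_of_hasCompactSupport (K.ks_test hs0 x).2.1).smul_const _
  rw [dist_eq_norm]
  have e1 : K.mol s h x - h x = ∫ w, K.ks s (x - w) • (h w - h x) := by
    conv_lhs => rw [← K.mol_const hs0 (h x) x]
    rw [Kern.mol, Kern.mol, ← integral_sub i1 i2]
    simp only [smul_sub]
  rw [e1, ← setIntegral_eq_integral_of_forall_compl_eq_zero (s := ball x s)
    (fun w hw => by rw [kz w hw, zero_smul])]
  refine (norm_setIntegral_le_of_norm_le_const (C := (s ^ n)⁻¹ * C * (ε / (C * v0 + 1)))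
    measure_ball_lt_top fun w hw => ?_).trans_lt ?_
  · rw [norm_smul, Kern.ks, norm_mul, Real.norm_of_nonneg (r := (s ^ n)⁻¹) (by positivity)]
    gcongr
    · exact hC _
    · rw [← dist_eq_norm]; exact (hd ((mem_ball.1 hw).trans hs.2)).le
  · rw [Measure.real, vol_ball x hs0, ← hv0]
    have : (s ^ n)⁻¹ * C * (ε / (C * v0 + 1)) * (s ^ n * v0) = ε * (C * v0 / (C * v0 + 1)) := by
      field_simp
    rw [this]
    refine mul_lt_of_lt_one_right hε ?_
    rw [div_lt_one (by positivity)]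
    linarith

variable [CompleteSpace V]
theorem setup (K : Kern n) (hU : IsOpen U) (hv : ContDiffOn ℝ 1 v U) (hf : ContinuousOn f U)
    (hS : Sol U v f) {z : Eu n} {r : ℝ} (hz : closedBall z (2 * r) ⊆ U) (e : Eu n) :
    Integrable (cut (closedBall z (2 * r)) fun x => fderiv ℝ v x e) ∧
    Integrable (cut (closedBall z (2 * r)) f) ∧
    (∀ x ∈ ball z r, ∀ s, 0 < s → s ≤ r →
      HasDerivAt (fun s => K.mol s (cut (closedBall z (2 * r)) fun x => fderiv ℝ v x e) x)
        ((s ^ n)⁻¹ • ∫ w, (fderiv ℝ K.Ψ (s⁻¹ • (x - w)) e) • cut (closedBall z (2 * r)) f w) s) ∧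
    ∀ x ∈ ball z r, Tendsto (fun s => K.mol s (cut (closedBall z (2 * r)) fun x => fderiv ℝ v x e) x)
      (𝓝[>] 0) (𝓝 (fderiv ℝ v x e)) := by
  obtain ⟨c1, c2, d1⟩ := c1_facts hU hv
  have c3 : ContinuousOn (fun x => fderiv ℝ v x e) U := c2.clm_apply continuousOn_const
  have I1 := cut_int ((c3.mono hz).integrableOn_compact (isCompact_closedBall z (2 * r)) (μ := volume))
    measurableSet_closedBall
  have I2 := cut_int ((hf.mono hz).integrableOn_compact (isCompact_closedBall z (2 * r)) (μ := volume))
    measurableSet_closedBall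
  refine ⟨I1, I2, fun x hx s hs hsr => ?_, fun x hx => ?_⟩
  · obtain ⟨p1, p2, p3⟩ := K.psi_test hs x
    have hsub : ball x s ⊆ closedBall z (2 * r) := (ball_subset_ball' (by
      rw [mem_ball] at hx; linarith)).trans ball_subset_closedBall
    have l2 := (lap_facts p1 p2).2.1
    have t := test_facts p1 p2 e
    have := K.mol_deriv hs I1 x
    convert this using 1
    have e1 : ∀ w, lap (K.psi s x) w • cut (closedBall z (2 * r)) (fun x => fderiv ℝ v x e) w =
        lap (K.psi s x) w • fderiv ℝ v w e := by
      intro w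
      by_cases hw : w ∈ closedBall z (2 * r)
      · rw [cut_mem hw]
      · rw [image_eq_zero_of_notMem_tsupport fun h => hw (hsub (p3 (l2 h))), zero_smul, zero_smul]
    have e2 : ∀ w, (fderiv ℝ K.Ψ (s⁻¹ • (x - w)) e) • cut (closedBall z (2 * r)) f w =
        (-s) • (fderiv ℝ (K.psi s x) w e) • f w := by
      intro w
      by_cases hw : w ∈ closedBall z (2 * r)
      · rw [cut_mem hw, K.psi_fd, smul_smul]
        congr 1
        field_simp
      · rw [cut_notMem hw, t.2.2.2.2 w fun h => hw (hsub (p3 h))]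
        simp
    simp only [e1, e2]
    rw [sol_de hU hv hS p1 p2 (p3.trans (hsub.trans hz)) e, integral_smul, neg_smul, smul_neg,
      smul_neg, smul_smul]
  · have hx2 : ball z (2 * r) ∈ 𝓝 x := isOpen_ball.mem_nhds (ball_subset_ball (by
      have := dist_nonneg.trans_lt (mem_ball.1 hx); linarith) hx)
    have hev : (cut (closedBall z (2 * r)) fun x => fderiv ℝ v x e) =ᶠ[𝓝 x] fun x => fderiv ℝ v x e := by
      filter_upwards [hx2] with w hw using cut_mem (ball_subset_closedBall hw) _
    have hxU : x ∈ U := hz (ball_subset_closedBall (mem_of_mem_nhds hx2))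
    have := mol_cont K I1 ((c3.continuousAt (hU.mem_nhds hxU)).congr hev.symm)
    rwa [hev.self_of_nhds] at this
end

theorem phi_facts {n : ℕ} (K : Kern n) (e : Eu n) : ∃ C : ℝ, 0 ≤ C ∧
    Continuous (fun x => fderiv ℝ K.Ψ x e) ∧ (∀ x, |fderiv ℝ K.Ψ x e| ≤ C) ∧
    (∀ x y, |fderiv ℝ K.Ψ x e - fderiv ℝ K.Ψ y e| ≤ C * ‖x - y‖) ∧
    (∀ x, 3/4 ≤ ‖x‖ → fderiv ℝ K.Ψ x e = 0) ∧
    ∀ s : ℝ, 0 < s → ∀ x : Eu n, ∫ w, fderiv ℝ K.Ψ (s⁻¹ • (x - w)) e = 0 := by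
  obtain ⟨C, hC1, -, -, hD, -, -, hL⟩ := K.bounds
  refine ⟨C * ‖e‖, by positivity, (d_smooth K.Ψ_smooth e).continuous, fun x => ?_, fun x y => ?_,
    fun x hx => ?_, fun s hs x => ?_⟩
  · exact (ContinuousLinearMap.le_opNorm _ e).trans (mul_le_mul_of_nonneg_right (hD x) (norm_nonneg e))
  · rw [← sub_apply, ← Real.norm_eq_abs]
    refine (ContinuousLinearMap.le_opNorm _ e).trans ?_
    calc _ ≤ C * ‖x - y‖ * ‖e‖ := mul_le_mul_of_nonneg_right (hL x y) (norm_nonneg e)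
      _ = _ := by ring
  · rw [K.rel, K.η_zero x hx]; simp
  · obtain ⟨p1, p2, p3⟩ := K.psi_test hs x
    have := ibp_c1 (f := fun _ : Eu n => (1:ℝ)) contDiff_const (p1.of_le (by simp)) p2 e
    simp only [fderiv_fun_const, Pi.zero_apply, zero_apply,
      K.psi_fd, smul_eq_mul, mul_one, mul_zero, integral_zero, neg_zero] at this
    rw [integral_const_mul] at this
    have hne : -s⁻¹ ≠ 0 := neg_ne_zero.2 (inv_ne_zero hs.ne')
    exact (mul_eq_zero.1 this).resolve_left hne

section
variable {n : ℕ} {V : Type*} [NormedAddCommGroup V] [NormedSpace ℝ V] {U : Set (Eu n)} {v f : Eu n → V}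
  [CompleteSpace V]

theorem boot_hold (K : Kern n) (hU : IsOpen U) (hv : ContDiffOn ℝ 1 v U) (hf : ContinuousOn f U)
    (hS : Sol U v f) {z : Eu n} {r : ℝ} (hr : 0 < r) (hz : closedBall z (2 * r) ⊆ U) (e : Eu n) :
    ∃ A, 0 ≤ A ∧ ∀ x ∈ ball z r, ∀ x' ∈ ball z r,
      ‖fderiv ℝ v x e - fderiv ℝ v x' e‖ ≤ A * √‖x - x'‖ := by
  obtain ⟨I1, I2, hd, ht⟩ := setup K hU hv hf hS hz e
  obtain ⟨C, hC0, k1, k2, k3, k4, -⟩ := phi_facts K e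
  obtain ⟨M, hM⟩ := (isCompact_closedBall z (2 * r)).exists_bound_of_continuousOn (hf.mono hz)
  have hM' : ∀ w, ‖cut (closedBall z (2 * r)) f w‖ ≤ |M| := fun w => by
    by_cases hw : w ∈ closedBall z (2 * r)
    · rw [cut_mem hw]; exact (hM w hw).trans (le_abs_self M)
    · rw [cut_notMem hw]; simp
  obtain ⟨h, hh⟩ : ∃ h, h = cut (closedBall z (2 * r)) fun x => fderiv ℝ v x e := ⟨_, rfl⟩
  rw [← hh] at I1 hd ht
  have hsm := K.mol_contDiff hr I1.locallyIntegrable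
  obtain ⟨L, hL⟩ := (isCompact_closedBall z r).exists_bound_of_continuousOn
    (hsm.continuous_fderiv (by simp)).continuousOn
  obtain ⟨v0, hv0⟩ : ∃ v0, v0 = (volume (ball (0 : Eu n) 1)).toReal := ⟨_, rfl⟩
  have hv : 0 ≤ v0 := hv0 ▸ ENNReal.toReal_nonneg
  obtain ⟨A, hA⟩ : ∃ A, A = 2 * C * (|M| * v0) := ⟨_, rfl⟩
  have hA0 : 0 ≤ A := by rw [hA]; positivity
  refine ⟨|L| * √(2 * r) + 2 * A * √r, by positivity, fun x hx x' hx' => ?_⟩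
  obtain ⟨d, hd0⟩ : ∃ d, d = ‖x - x'‖ := ⟨_, rfl⟩
  have hdn : 0 ≤ d := hd0 ▸ norm_nonneg _
  rw [← hd0]
  have B0 : ∀ s, 0 < s → ∀ x : Eu n, ∫ w in ball x s, ‖cut (closedBall z (2 * r)) f w‖ ≤
      |M| * v0 * s ^ n := fun s hs x => hv0 ▸ ball_int hs fun w _ => hM' w
  have B1 : ∀ s : ℝ, 0 < s → ∀ x : Eu n, ‖(s ^ n)⁻¹ • ∫ w, (fderiv ℝ K.Ψ (s⁻¹ • (x - w)) e) •
      cut (closedBall z (2 * r)) f w‖ ≤ C * (|M| * v0) := fun s hs x => by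
    rw [norm_smul, Real.norm_of_nonneg (by positivity), inv_mul_le_iff₀ (by positivity)]
    exact ((kd k1 k2 k3 k4 I2 hs x x).2.1.trans (mul_le_mul_of_nonneg_left (B0 s hs x) hC0)).trans_eq
      (by ring)
  have key : ∀ a, 0 < a → a ≤ r → ‖(K.mol r h x - K.mol r h x') - (K.mol a h x - K.mol a h x')‖ ≤
      2 * (A * √d) * √r := by
    intro a ha har
    refine lemQ (F := fun s => K.mol s h x - K.mol s h x') (r := r)
      (fun s hs hsr => (hd x hx s hs hsr).fun_sub (hd x' hx' s hs hsr)) (fun s hs hsr => ?_) ha har le_rfl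
    rw [mul_div_assoc, ← Real.sqrt_div' _ hs.le]
    rcases le_total d s with hds | hds
    · have e1 : d / s ≤ √(d / s) := by
        refine Real.le_sqrt_of_sq_le ?_
        have : d / s ≤ 1 := (div_le_one hs).2 hds
        have : 0 ≤ d / s := by positivity
        nlinarith
      refine le_trans ?_ (mul_le_mul_of_nonneg_left e1 hA0)
      rw [← smul_sub, norm_smul, Real.norm_of_nonneg (by positivity), inv_mul_le_iff₀ (by positivity)]
      refine (kd k1 k2 k3 k4 I2 hs x x').2.2.trans ((mul_le_mul_of_nonneg_left
        (add_le_add (B0 s hs x) (B0 s hs x')) (by positivity)).trans_eq ?_)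
      rw [hA, hd0]; ring
    · have e1 : 1 ≤ √(d / s) := by rw [Real.one_le_sqrt, one_le_div hs]; exact hds
      refine le_trans ?_ (mul_le_mul_of_nonneg_left e1 hA0)
      refine (norm_sub_le _ _).trans ((add_le_add (B1 s hs x) (B1 s hs x')).trans_eq ?_)
      rw [hA]; ring
  have lim := le_of_tendsto ((tendsto_const_nhds (x := K.mol r h x - K.mol r h x')).sub
    ((ht x hx).sub (ht x' hx'))).norm (by
      filter_upwards [Ioo_mem_nhdsGT hr] with a ha using key a ha.1 ha.2.le)
  have lip : ‖K.mol r h x - K.mol r h x'‖ ≤ |L| * d := by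
    rw [hd0]
    exact (convex_closedBall z r).norm_image_sub_le_of_norm_fderiv_le (𝕜 := ℝ)
      (fun w _ => hsm.differentiable (by simp) w) (fun w hw => (hL w hw).trans (le_abs_self L))
      (ball_subset_closedBall hx') (ball_subset_closedBall hx)
  have d2 : d ≤ √(2 * r) * √d := by
    have h2 : d ≤ 2 * r := by
      rw [hd0, ← dist_eq_norm]
      have := dist_triangle_right x x' z
      rw [mem_ball] at hx hx'
      linarith
    calc d = √d * √d := (Real.mul_self_sqrt hdn).symm
      _ ≤ _ := by gcongr
  calc _ = ‖(K.mol r h x - K.mol r h x') - ((K.mol r h x - K.mol r h x') -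
        (fderiv ℝ v x e - fderiv ℝ v x' e))‖ := by rw [sub_sub_cancel]
    _ ≤ |L| * d + 2 * (A * √d) * √r := (norm_sub_le _ _).trans (add_le_add lip lim)
    _ ≤ |L| * (√(2 * r) * √d) + 2 * (A * √d) * √r := by gcongr
    _ = _ := by ring

theorem boot_c1 (K : Kern n) (hU : IsOpen U) (hv : ContDiffOn ℝ 1 v U) (hf : ContinuousOn f U)
    (hS : Sol U v f) {z : Eu n} {r : ℝ} (hr : 0 < r) (hz : closedBall z (2 * r) ⊆ U) {A : ℝ} (hA : 0 ≤ A)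
    (hH : ∀ x ∈ closedBall z (2 * r), ∀ x' ∈ closedBall z (2 * r), ‖f x - f x'‖ ≤ A * √‖x - x'‖)
    (e : Eu n) : ContDiffOn ℝ 1 (fun x => fderiv ℝ v x e) (ball z r) := by
  obtain ⟨I1, I2, hd, ht⟩ := setup K hU hv hf hS hz e
  obtain ⟨C, hC0, k1, k2, k3, k4, k5⟩ := phi_facts K e
  obtain ⟨v0, hv0⟩ : ∃ v0, v0 = (volume (ball (0 : Eu n) 1)).toReal := ⟨_, rfl⟩
  have hv : 0 ≤ v0 := hv0 ▸ ENNReal.toReal_nonneg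
  have hsub : ∀ x ∈ ball z r, ∀ s, s ≤ r → ball x s ⊆ closedBall z (2 * r) := fun x hx s hs =>
    (ball_subset_ball' (by rw [mem_ball] at hx; linarith)).trans ball_subset_closedBall
  have I3 : ∀ c : V, Integrable (cut (closedBall z (2 * r)) fun w => f w - c) := fun c =>
    cut_int (((hf.mono hz).sub continuousOn_const).integrableOn_compact
      (isCompact_closedBall z (2 * r)) (μ := volume)) measurableSet_closedBall
  have sh : ∀ x ∈ ball z r, ∀ s : ℝ, 0 < s → s ≤ r → ∀ c : V,
      ∫ w, (fderiv ℝ K.Ψ (s⁻¹ • (x - w)) e) • cut (closedBall z (2 * r)) f w =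
      ∫ w, (fderiv ℝ K.Ψ (s⁻¹ • (x - w)) e) • cut (closedBall z (2 * r)) (fun w => f w - c) w := by
    intro x hx s hs hsr c
    rw [← sub_eq_zero, ← integral_sub (kd k1 k2 k3 k4 I2 hs x x).1 (kd k1 k2 k3 k4 (I3 c) hs x x).1]
    rw [← zero_smul ℝ c, ← k5 s hs x, ← integral_smul_const]
    refine integral_congr_ae (Eventually.of_forall fun w => ?_)
    dsimp only
    by_cases hw : w ∈ ball x s
    · rw [cut_mem (hsub x hx s hsr hw), cut_mem (hsub x hx s hsr hw), ← smul_sub, sub_sub_cancel]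
    · rw [kb k4 hs x w hw]; simp
  have B0 : ∀ x ∈ ball z r, ∀ x' ∈ ball z r, ∀ s, 0 < s → s ≤ r → ‖x - x'‖ ≤ s →
      ∫ w in ball x' s, ‖cut (closedBall z (2 * r)) (fun w => f w - f x) w‖ ≤
        A * (2 * √s) * v0 * s ^ n := by
    intro x hx x' hx' s hs hsr hds
    refine hv0 ▸ ball_int hs fun w hw => ?_
    have h2 := hsub x' hx' s hsr hw
    rw [cut_mem h2]
    refine (hH w h2 x (hsub x hx r le_rfl (mem_ball_self hr))).trans ?_
    gcongr
    refine (Real.sqrt_le_left (by positivity)).2 ?_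
    rw [mul_pow, Real.sq_sqrt hs.le]
    rw [mem_ball, dist_eq_norm] at hw
    have := norm_sub_le_norm_sub_add_norm_sub w x' x
    rw [norm_sub_rev x' x] at this
    linarith
  have B1 : ∀ x ∈ ball z r, ∀ s : ℝ, 0 < s → s ≤ r → ‖(s ^ n)⁻¹ • ∫ w, (fderiv ℝ K.Ψ (s⁻¹ • (x - w)) e) •
      cut (closedBall z (2 * r)) f w‖ ≤ C * A * v0 * 2 * √s := fun x hx s hs hsr => by
    rw [sh x hx s hs hsr (f x), norm_smul, Real.norm_of_nonneg (by positivity),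
      inv_mul_le_iff₀ (by positivity)]
    exact ((kd k1 k2 k3 k4 (I3 (f x)) hs x x).2.1.trans (mul_le_mul_of_nonneg_left
      (B0 x hx x hx s hs hsr (by simpa using hs.le)) hC0)).trans_eq (by ring)
  have ss : ∀ s : ℝ, 0 < s → √s = s / √s := fun s hs => by
    rw [eq_div_iff (Real.sqrt_pos.2 hs).ne', Real.mul_self_sqrt hs.le]
  obtain ⟨F, G, hFG, hG, hT⟩ := lemC1 (f := fun s => K.mol s
      (cut (closedBall z (2 * r)) fun x => fderiv ℝ v x e))
    (k := fun s x => (s ^ n)⁻¹ • ∫ w, (fderiv ℝ K.Ψ (s⁻¹ • (x - w)) e) • cut (closedBall z (2 * r)) f w)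
    (r := r) (C := C * A * v0 * (2 * r + 4)) hr (by positivity) (isOpen_ball (x := z) (ε := r))
    (fun s hs => (K.mol_contDiff hs I1.locallyIntegrable).of_le (by simp)) hd
    (fun x hx s hs hsr => (B1 x hx s hs hsr).trans (by
      conv_lhs => rw [ss s hs, ← mul_div_assoc, mul_assoc]
      gcongr; linarith))
    (fun x hx x' hx' s hs hsr => by
      have h3 := Real.sqrt_pos.2 hs
      suffices ‖((s ^ n)⁻¹ • ∫ w, (fderiv ℝ K.Ψ (s⁻¹ • (x - w)) e) • cut (closedBall z (2 * r)) f w) -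
          (s ^ n)⁻¹ • ∫ w, (fderiv ℝ K.Ψ (s⁻¹ • (x' - w)) e) • cut (closedBall z (2 * r)) f w‖ ≤
          C * A * v0 * 4 * ‖x - x'‖ / √s from this.trans (by gcongr; linarith)
      rcases le_total ‖x - x'‖ s with hds | hds
      · rw [sh x hx s hs hsr (f x), sh x' hx' s hs hsr (f x), ← smul_sub, norm_smul,
          Real.norm_of_nonneg (by positivity), inv_mul_le_iff₀ (by positivity)]
        refine (kd k1 k2 k3 k4 (I3 (f x)) hs x x').2.2.trans ((mul_le_mul_of_nonneg_left
          (add_le_add (B0 x hx x hx s hs hsr (by simpa using hs.le)) (B0 x hx x' hx' s hs hsr hds))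
          (by positivity)).trans_eq ?_)
        have := Real.sq_sqrt hs.le
        field_simp
        rw [this]; ring
      · refine (norm_sub_le _ _).trans ((add_le_add (B1 x hx s hs hsr) (B1 x' hx' s hs hsr)).trans ?_)
        rw [show C * A * v0 * 2 * √s + C * A * v0 * 2 * √s = C * A * v0 * 4 * √s by ring]
        conv_lhs => rw [ss s hs, ← mul_div_assoc]
        gcongr)
  exact (c1_of isOpen_ball hFG hG).congr fun x hx => tendsto_nhds_unique (ht x hx) (hT x hx).1
end

theorem clm_le_sum {n : ℕ} {V : Type*} [NormedAddCommGroup V] [NormedSpace ℝ V] (A : Eu n →L[ℝ] V) :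
    ‖A‖ ≤ ∑ i, ‖A (bv n i)‖ := by
  refine A.opNorm_le_bound (Finset.sum_nonneg fun i _ => norm_nonneg _) fun x => ?_
  conv_lhs => rw [eu_sum x, map_sum]
  rw [Finset.sum_mul]
  refine norm_sum_le_of_le _ fun i _ => ?_
  rw [map_smul, norm_smul, mul_comm]
  gcongr
  exact PiLp.norm_apply_le x i

theorem boot_c2 {n : ℕ} {V : Type*} [NormedAddCommGroup V] [NormedSpace ℝ V] [CompleteSpace V]
    {U : Set (Eu n)} (K : Kern n) (hU : IsOpen U) {Q : V × (Eu n →L[ℝ] V) → V} (hQ : ContDiff ℝ ∞ Q)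
    {v : Eu n → V} (hv : ContDiffOn ℝ 1 v U) (hS : Sol U v fun x => Q (v x, fderiv ℝ v x)) :
    ContDiffOn ℝ 1 (fderiv ℝ v) U := by
  obtain ⟨c1, c2, d1⟩ := c1_facts hU hv
  have cw : ContinuousOn (fun x => (v x, fderiv ℝ v x)) U := c1.prodMk c2
  have cf : ContinuousOn (fun x => Q (v x, fderiv ℝ v x)) U := hQ.continuous.comp_continuousOn cw
  intro z hz
  obtain ⟨ρ, hρ, hρU⟩ := Metric.isOpen_iff.1 hU z hz
  have hsub : closedBall z (2 * (ρ / 4)) ⊆ U := (closedBall_subset_ball (by linarith)).trans hρU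
  choose A hA0 hA using fun i => boot_hold K hU hv cf hS (by positivity : 0 < ρ / 4) hsub (bv n i)
  obtain ⟨L1, t1, ht1, hL1⟩ := (hv.contDiffAt (hU.mem_nhds hz)).exists_lipschitzOnWith
  obtain ⟨L2, t2, ht2, hL2⟩ :=
    (ContDiff.contDiffAt (n := 1) (hQ.of_le (by simp)) (x := (v z, fderiv ℝ v z))).exists_lipschitzOnWith
  have hev : ∀ᶠ x in 𝓝 z, x ∈ t1 ∧ (v x, fderiv ℝ v x) ∈ t2 ∧ x ∈ ball z (ρ / 4) ∧ x ∈ ball z (1/2) :=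
    Filter.Eventually.and ht1 (((cw.continuousAt (hU.mem_nhds hz)).eventually ht2).and
      (Filter.Eventually.and (ball_mem_nhds z (by positivity)) (ball_mem_nhds z (by norm_num))))
  obtain ⟨δ, hδ, hδs⟩ := Metric.eventually_nhds_iff_ball.1 hev
  have hs2 : closedBall z (2 * (δ / 4)) ⊆ ball z δ := closedBall_subset_ball (by linarith)
  have hU2 : closedBall z (2 * (δ / 4)) ⊆ U := fun x hx =>
    hρU (ball_subset_ball (by linarith) (hδs x (hs2 hx)).2.2.1)
  have hSA : 0 ≤ ∑ i, A i := Finset.sum_nonneg fun i _ => hA0 i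
  have hH : ∀ x ∈ closedBall z (2 * (δ / 4)), ∀ x' ∈ closedBall z (2 * (δ / 4)),
      ‖Q (v x, fderiv ℝ v x) - Q (v x', fderiv ℝ v x')‖ ≤ (L2 * (L1 + ∑ i, A i)) * √‖x - x'‖ := by
    intro x hx x' hx'
    obtain ⟨a1, a2, a3, a4⟩ := hδs x (hs2 hx)
    obtain ⟨b1, b2, b3, b4⟩ := hδs x' (hs2 hx')
    have e1 := hL1.dist_le_mul x a1 x' b1
    have e2 := hL2.dist_le_mul _ a2 _ b2
    rw [dist_eq_norm, dist_eq_norm] at e1 e2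
    have e3 : ‖fderiv ℝ v x - fderiv ℝ v x'‖ ≤ (∑ i, A i) * √‖x - x'‖ := by
      refine (clm_le_sum _).trans ?_
      rw [Finset.sum_mul]
      exact Finset.sum_le_sum fun i _ => hA i x a3 x' b3
    have e4 : ‖x - x'‖ ≤ √‖x - x'‖ := by
      refine Real.le_sqrt_of_sq_le ?_
      have : ‖x - x'‖ ≤ 1 := by
        rw [← dist_eq_norm]
        have := dist_triangle_right x x' z
        rw [mem_ball] at a4 b4
        linarith
      nlinarith [norm_nonneg (x - x')]
    have s0 := Real.sqrt_nonneg ‖x - x'‖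
    refine e2.trans ?_
    rw [mul_assoc]
    refine mul_le_mul_of_nonneg_left ?_ L2.2
    rw [Prod.mk_sub_mk, Prod.norm_mk, add_mul]
    refine max_le (le_add_of_le_of_nonneg (e1.trans ?_) (by positivity)) (le_add_of_nonneg_of_le
      (mul_nonneg L1.2 s0) e3)
    exact mul_le_mul_of_nonneg_left e4 L1.2
  have hfin : ContDiffOn ℝ 1 (fderiv ℝ v) (ball z (δ / 4)) := contDiffOn_clm_apply.2 fun e =>
    boot_c1 K hU hv cf hS (by positivity) hU2 (by positivity) hH e
  exact (hfin.contDiffAt (ball_mem_nhds z (by positivity))).contDiffWithinAt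

theorem boot {n : ℕ} (K : Kern n) {U : Set (Eu n)} (hU : IsOpen U) (k : ℕ) :
    ∀ (V : Type) [NormedAddCommGroup V] [NormedSpace ℝ V] [CompleteSpace V]
    (Q : V × (Eu n →L[ℝ] V) → V) (_ : ContDiff ℝ ∞ Q) (v : Eu n → V), ContDiffOn ℝ 1 v U →
    (Sol U v fun x => Q (v x, fderiv ℝ v x)) → ContDiffOn ℝ (k + 1) v U := by
  induction k with
  | zero => intro V _ _ _ Q hQ v hv hS; simpa using hv
  | succ k ih =>
    intro V _ _ _ Q hQ v hv hS
    have hc2 := boot_c2 K hU hQ hv hS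
    obtain ⟨c1, c2, d1⟩ := c1_facts hU hv
    have hw : ContDiffOn ℝ 1 (fun x => (v x, fderiv ℝ v x)) U := hv.prodMk hc2
    obtain ⟨w1, w2, w3⟩ := c1_facts hU hw
    have hf : ContDiffOn ℝ 1 (fun x => Q (v x, fderiv ℝ v x)) U :=
      (hQ.of_le (by simp)).comp_contDiffOn hw
    have hQ' : ContDiff ℝ ∞ (fun P : (V × (Eu n →L[ℝ] V)) × (Eu n →L[ℝ] (V × (Eu n →L[ℝ] V))) =>
        (Q P.1, (fderiv ℝ Q P.1).comp P.2)) :=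
      (hQ.comp contDiff_fst).prodMk
        (((hQ.fderiv_right (m := ∞) (by simp)).comp contDiff_fst).clm_comp contDiff_snd)
    have hS' : Sol U (fun x => (v x, fderiv ℝ v x)) fun x => (Q (v x, fderiv ℝ v x),
        (fderiv ℝ Q (v x, fderiv ℝ v x)).comp (fderiv ℝ (fun x => (v x, fderiv ℝ v x)) x)) := by
      intro φ hφ hc hs
      obtain ⟨l1, l2, l3, -⟩ := lap_facts hφ hc
      have m := hU.measurableSet
      have i1 := int_test (c1.locallyIntegrableOn m) l1.continuous l3 (l2.trans hs)
      have i2 := int_test (c2.locallyIntegrableOn m) l1.continuous l3 (l2.trans hs)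
      have i3 := int_test (hf.continuousOn.locallyIntegrableOn m) hφ.continuous hc hs
      have cc : ContinuousOn (fun x => (fderiv ℝ Q (v x, fderiv ℝ v x)).comp
          (fderiv ℝ (fun x => (v x, fderiv ℝ v x)) x)) U :=
        ((hQ.continuous_fderiv (by simp)).comp_continuousOn w1).clm_comp w2
      have i4 := int_test (cc.locallyIntegrableOn m) hφ.continuous hc hs
      simp only [Prod.smul_mk]
      rw [integral_pair i1 i2, integral_pair i3 i4]
      refine Prod.ext (hS φ hφ hc hs) ?_
      refine ContinuousLinearMap.ext fun e => ?_
      dsimp only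
      rw [ContinuousLinearMap.integral_apply i2, ContinuousLinearMap.integral_apply i4]
      simp only [smul_apply]
      rw [sol_de hU hv hS hφ hc hs e, ibpU hU hf hφ hc hs e, neg_neg]
      refine integral_congr_ae (Eventually.of_forall fun x => ?_)
      by_cases hx : x ∈ tsupport φ
      · dsimp only
        rw [HasFDerivAt.fderiv (f := fun x => Q (v x, fderiv ℝ v x)) (((hQ.differentiable (by simp) (v x, fderiv ℝ v x)).hasFDerivAt).comp x
          (w3 x (hs hx)).hasFDerivAt)]
      · simp [image_eq_zero_of_notMem_tsupport hx]
    have := ih _ _ hQ' _ hw hS'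
    rw [show ((k + 1 : ℕ) : WithTop ℕ∞) + 1 = ((k : WithTop ℕ∞) + 1) + 1 by push_cast; rfl,
      contDiffOn_succ_iff_fderiv_of_isOpen hU]
    refine ⟨fun x hx => (d1 x hx).differentiableWithinAt, fun h => ?_, contDiff_snd.comp_contDiffOn this⟩
    exact absurd h (by exact_mod_cast WithTop.coe_ne_top)

theorem en_smooth {n p : ℕ} : ContDiff ℝ ∞ (en : (Eu n →L[ℝ] Eu p) → ℝ) := by
  unfold en
  exact ContDiff.sum fun i _ => (contDiff_id.clm_apply contDiff_const).norm_sq ℝ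

theorem rpow_dens (n : ℕ) {r : ℝ} (hr : 0 < r) : r ^ ((2 : ℝ) - n) = r ^ 2 / r ^ n := by
  rw [Real.rpow_sub hr, Real.rpow_natCast]
  norm_num

theorem hard_dir {n p : ℕ} (hn : 2 ≤ n) (hp : 2 ≤ p) {Ω : Set (Eu n)} (hΩ : IsOpen Ω)
    {u : Eu n → Eu p} {g : Eu n → (Eu n →L[ℝ] Eu p)} (hu : IsEnergyMinimizingToSphere n p Ω u g)
    {y : Eu n} (hy : y ∈ Ω)
    (ht : Tendsto (fun ρ : ℝ => ρ ^ ((2 : ℝ) - n) * ∫ x in ball y ρ, energyDensity n p g x)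
        (𝓝[>] 0) (𝓝 0)) : y ∈ regSet n p Ω u := by
  obtain ⟨K⟩ := kern_exists hn
  obtain ⟨R, hR, hRΩ⟩ := Metric.nhds_basis_closedBall.mem_iff.1 (hΩ.mem_nhds hy)
  have H := locMin_of hΩ hu hRΩ
  obtain ⟨u', hu'⟩ : ∃ u', u' = cut (closedBall y R) u := ⟨_, rfl⟩
  obtain ⟨g', hg'⟩ : ∃ g', g' = cut (closedBall y R) g := ⟨_, rfl⟩
  rw [← hu', ← hg'] at H
  have hd : ∀ ε > 0, ∃ r > 0, r < R ∧ r ^ 2 * (∫ x in ball y r, en (g' x)) ≤ ε * r ^ n := by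
    intro ε hε
    obtain ⟨r, h1, h2⟩ := ((ht.eventually (gt_mem_nhds hε)).and (Ioo_mem_nhdsGT hR)).exists
    refine ⟨r, h2.1, h2.2, ?_⟩
    have e1 : ∫ x in ball y r, energyDensity n p g x = ∫ x in ball y r, en (g' x) := by
      refine setIntegral_congr_fun measurableSet_ball fun x hx => ?_
      rw [en_eq, hg', cut_mem (ball_subset_closedBall (ball_subset_ball h2.2.le hx))]
    rw [rpow_dens n h2.1, e1, div_mul_eq_mul_div, div_lt_iff₀ (pow_pos h2.1 n)] at h1
    exact h1.le
  obtain ⟨r0, hr0, hr2, Λ, hΛ, hM⟩ := morrey hp K hR H hd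
  obtain ⟨F, hF, hFu, hFg⟩ := u_c1 K hR H hr0 hr2 hΛ hM
  have hS : Sol (ball y r0) F fun x =>
      (fun P : Eu p × (Eu n →L[ℝ] Eu p) => -(en P.2 • P.1)) (F x, fderiv ℝ F x) := by
    intro φ hφ hc hs
    obtain ⟨l1, l2, -, -⟩ := lap_facts hφ hc
    have := H.pde K hR hφ hc (hs.trans (ball_subset_ball (by linarith)))
    rw [← integral_neg] at this
    convert this using 1
    · refine integral_congr_ae ?_
      filter_upwards [hFu] with x hx
      by_cases h : x ∈ tsupport φ
      · rw [hx (hs h)]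
      · rw [image_eq_zero_of_notMem_tsupport fun h' => h (l2 h'), zero_smul, zero_smul]
    · refine integral_congr_ae ?_
      filter_upwards [hFu, hFg] with x hx hx'
      by_cases h : x ∈ tsupport φ
      · rw [hx (hs h), hx' (hs h), smul_neg]
      · rw [image_eq_zero_of_notMem_tsupport h, zero_smul, zero_smul, neg_zero]
  have hB : ball y r0 ⊆ closedBall y R := (ball_subset_ball (by linarith)).trans ball_subset_closedBall
  refine ⟨hy, ball y r0, isOpen_ball, mem_ball_self hr0, hB.trans hRΩ, F, ?_, ?_⟩
  · refine contDiffOn_infty.2 fun k => (boot K isOpen_ball k _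
      (fun P : Eu p × (Eu n →L[ℝ] Eu p) => -(en P.2 • P.1)) ?_ F hF hS).of_le (by simp)
    exact ((en_smooth.comp contDiff_snd).smul contDiff_fst).neg
  · rw [ae_restrict_iff' measurableSet_ball]
    filter_upwards [hFu] with x hx hxB
    rw [← hx hxB, hu', cut_mem (hB hxB)]

theorem easy_dir {n p : ℕ} {Ω : Set (Eu n)}
    {u : Eu n → Eu p} {g : Eu n → (Eu n →L[ℝ] Eu p)} (hu : IsEnergyMinimizingToSphere n p Ω u g)
    {y : Eu n} (hy : y ∈ regSet n p Ω u) :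
    Tendsto (fun ρ : ℝ => ρ ^ ((2 : ℝ) - n) * ∫ x in ball y ρ, energyDensity n p g x)
        (𝓝[>] 0) (𝓝 0) := by
  obtain ⟨-, V, hV, hyV, hVΩ, v, hv, hae⟩ := hy
  rw [ae_restrict_iff' hV.measurableSet] at hae
  have hv1 : ContDiffOn ℝ 1 v V := hv.of_le (by simp)
  obtain ⟨c1, c2, d1⟩ := c1_facts hV hv1
  obtain ⟨-, h2, h3⟩ := (hwg_iff u g).1 hu.1
  have lg := h2.mono_set hVΩ
  have lv := c2.locallyIntegrableOn (μ := volume) hV.measurableSet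
  have hgv : ∀ᵐ x, x ∈ V → g x - fderiv ℝ v x = 0 := by
    refine hV.ae_eq_zero_of_integral_contDiff_smul_eq_zero (f := fun x => g x - fderiv ℝ v x)
      (lg.sub lv) fun φ hφ hc hs => ?_
    have i1 := int_test lg hφ.continuous hc hs
    have i2 := int_test lv hφ.continuous hc hs
    simp only [smul_sub]
    rw [integral_sub i1 i2, sub_eq_zero]
    refine ContinuousLinearMap.ext fun e => ?_
    rw [ContinuousLinearMap.integral_apply i1, ContinuousLinearMap.integral_apply i2]
    simp only [smul_apply]
    rw [← neg_inj, ← h3 φ hφ hc (hs.trans hVΩ) e, ← ibpU hV hv1 hφ hc hs e]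
    have t := test_facts hφ hc e
    refine integral_congr_ae ?_
    filter_upwards [hae] with x hx
    by_cases h : x ∈ tsupport φ
    · rw [hx (hs h)]
    · rw [t.2.2.2.2 x h]; simp
  obtain ⟨R, hR, hRV⟩ := Metric.nhds_basis_closedBall.mem_iff.1 (hV.mem_nhds hyV)
  obtain ⟨M, hM⟩ := (isCompact_closedBall y R).exists_bound_of_continuousOn
    (en_cont.comp_continuousOn (c2.mono hRV))
  obtain ⟨v0, hv0⟩ : ∃ v0, v0 = (volume (ball (0 : Eu n) 1)).toReal := ⟨_, rfl⟩
  have hlim : Tendsto (fun ρ : ℝ => ρ ^ 2 * (M * v0)) (𝓝[>] 0) (𝓝 0) := by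
    have : Continuous (fun ρ : ℝ => ρ ^ 2 * (M * v0)) := by fun_prop
    simpa using (this.tendsto 0).mono_left nhdsWithin_le_nhds
  refine squeeze_zero_norm' ?_ hlim
  filter_upwards [Ioo_mem_nhdsGT hR] with ρ hρ
  have hρ0 := hρ.1
  have e1 : ∫ x in ball y ρ, energyDensity n p g x = ∫ x in ball y ρ, en (fderiv ℝ v x) := by
    refine setIntegral_congr_ae measurableSet_ball ?_
    filter_upwards [hgv] with x hx hxρ
    rw [en_eq, sub_eq_zero.1 (hx (hRV (ball_subset_closedBall (ball_subset_ball hρ.2.le hxρ))))]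
  have e2 := norm_setIntegral_le_of_norm_le_const (μ := volume) (C := M) (s := ball y ρ)
    measure_ball_lt_top (fun w hw => hM w (ball_subset_closedBall (ball_subset_ball hρ.2.le hw)))
  rw [Measure.real, vol_ball y hρ0, ← hv0] at e2
  rw [e1, rpow_dens n hρ0, norm_mul, Real.norm_of_nonneg (by positivity)]
  calc _ ≤ ρ ^ 2 / ρ ^ n * (M * (ρ ^ n * v0)) := mul_le_mul_of_nonneg_left e2 (by positivity)
    _ = _ := by field_simp

/-- Corollary 2 of Section 2.3 of the paper, for energy minimizing maps into the unit
sphere: a point `y ∈ Ω` is regular if and only if the density of `u` at `y` vanishes,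
i.e. `ρ^(2-n) ∫_{B_ρ(y)} |Du|² → 0` as `ρ ↓ 0`. -/
theorem regular_iff_density_zero
    (n p : ℕ) (hn : 2 ≤ n) (hp : 2 ≤ p)
    (Ω : Set (EuclideanSpace ℝ (Fin n))) (hΩ : IsOpen Ω)
    (u : EuclideanSpace ℝ (Fin n) → EuclideanSpace ℝ (Fin p))
    (g : EuclideanSpace ℝ (Fin n) →
      (EuclideanSpace ℝ (Fin n) →L[ℝ] EuclideanSpace ℝ (Fin p)))
    (hu : IsEnergyMinimizingToSphere n p Ω u g) :
    ∀ y ∈ Ω, y ∈ regSet n p Ω u ↔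
      Tendsto
        (fun ρ : ℝ => ρ ^ ((2 : ℝ) - n) * ∫ x in ball y ρ, energyDensity n p g x)
        (nhdsWithin 0 (Ioi 0)) (nhds 0) := by
  intro y hy
  exact ⟨fun h => easy_dir hu h, fun h => hard_dir hn hp hΩ hu hy h⟩
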